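/- Let f : ℂ → ℂ be an entire function, neither constant nor affine, having only finitely many critical points and only finitely many finite asymptotic values. Let z₀ ∈ ℂ be a periodic point of exact period n ≥ 1 with multiplier λ := (f^n)'(z₀) = e^{2πiα} for some irrational real α. Suppose D ⊆ ℂ is a Siegel disk for f^n at z₀: an open connected set with z₀ ∈ D and f^n(D) ⊆ D, admitting a biholomorphism φ from D onto the open unit disk with φ(z₀) = 0 and φ(f^n(z)) = λφ(z) for all z ∈ D, and maximal with respect to inclusion among open connected sets with these properties. Then there exists a point s ∈ ℂ, which is either a finite asymptotic value of f or a recurrent critical point of f, such that the boundary ∂D is contained in the derived set d(s) of the forward orbit of s. -/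

import Mathlib

open Metric Set Function Filter

/-- `a` is a finite asymptotic value of `f`: there is a continuous curve `γ` tending to `∞`
along which `f` tends to `a`. -/
def AsymptoticValue (f : ℂ → ℂ) (a : ℂ) : Prop :=
  ∃ γ : ℝ → ℂ, Continuous γ ∧ Tendsto (fun t => ‖γ t‖) atTop atTop ∧
    Tendsto (fun t => f (γ t)) atTop (nhds a)

/-- The derived set of the forward orbit of `s` under `f`: all accumulation points of
`{f^k(s) : k ≥ 0}`. -/
def orbitDerivedSet (f : ℂ → ℂ) (s : ℂ) : Set ℂ :=
  {z : ℂ | ∀ U ∈ nhds z, ∃ k : ℕ, f^[k] s ∈ U ∧ f^[k] s ≠ z}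

/-- `c` is a recurrent critical point of `f`: `f'(c) = 0` and `c` lies in its ω-limit set. -/
def RecurrentCriticalPoint (f : ℂ → ℂ) (c : ℂ) : Prop :=
  deriv f c = 0 ∧
    ∃ φ : ℕ → ℕ, StrictMono φ ∧ Tendsto (fun i => f^[φ i] c) atTop (nhds c)

/-- `D` is an invariant linearization domain for `g` at the fixed point `z₀` with multiplier
`lam`: an open connected invariant set containing `z₀`, biholomorphic to the unit disk via a
map conjugating `g` to the rotation `z ↦ lam * z`. -/
def IsSiegelDomain (g : ℂ → ℂ) (z₀ lam : ℂ) (D : Set ℂ) : Prop :=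
  IsOpen D ∧ IsConnected D ∧ z₀ ∈ D ∧ MapsTo g D D ∧
    ∃ φ : ℂ → ℂ, DifferentiableOn ℂ φ D ∧ BijOn φ D (ball (0 : ℂ) 1) ∧ φ z₀ = 0 ∧
      ∀ z ∈ D, φ (g z) = lam * φ z


open Metric Set Function Filter

/-- Identity theorem, convenient form. -/
theorem id_thm {U : Set ℂ} (hU : IsOpen U) (hc : IsPreconnected U) {f g : ℂ → ℂ}
    (hf : DifferentiableOn ℂ f U) (hg : DifferentiableOn ℂ g U)
    {O : Set ℂ} (hO : IsOpen O) (hOU : O ⊆ U) (hne : O.Nonempty) (h : EqOn f g O) : EqOn f g U := by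
  obtain ⟨x, hx⟩ := hne
  exact (hf.analyticOnNhd hU).eqOn_of_preconnected_of_eventuallyEq (hg.analyticOnNhd hU) hc (hOU hx)
    (Filter.eventuallyEq_of_mem (hO.mem_nhds hx) h)

/-- Normal form of a nonconstant analytic function. -/
theorem normal_form {f : ℂ → ℂ} {p : ℂ} (hf : AnalyticAt ℂ f p)
    (hnc : ¬ ∀ᶠ z in nhds p, f z = f p) :
    ∃ m : ℕ, 1 ≤ m ∧ ∃ k : ℂ → ℂ, AnalyticAt ℂ k p ∧ k p = 0 ∧ deriv k p ≠ 0 ∧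
      ∀ᶠ z in nhds p, f z = f p + k z ^ m := by
  have h1 : AnalyticAt ℂ (fun z => f z - f p) p := hf.sub analyticAt_const
  have h2 : ¬ ∀ᶠ z in nhds p, f z - f p = 0 := by
    simpa [sub_eq_zero] using hnc
  obtain ⟨m, g, hg, hg0, he⟩ := h1.exists_eventuallyEq_pow_smul_nonzero_iff.mpr h2
  have hm : m ≠ 0 := by
    rintro rfl
    have := he.self_of_nhds
    simp at this
    exact hg0 this.symm
  refine ⟨m, Nat.one_le_iff_ne_zero.mpr hm, fun z => (z - p) * (g p ^ ((m:ℂ)⁻¹) * (g z / g p) ^ ((m:ℂ)⁻¹)), ?_, by simp, ?_, ?_⟩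
  · refine (analyticAt_id.sub analyticAt_const).mul (analyticAt_const.mul ?_)
    refine (hg.div analyticAt_const hg0).cpow analyticAt_const ?_
    simp [hg0]
  · have h3 : AnalyticAt ℂ (fun z => g p ^ ((m:ℂ)⁻¹) * (g z / g p) ^ ((m:ℂ)⁻¹)) p := by
      refine (analyticAt_const.mul ?_)
      refine (hg.div analyticAt_const hg0).cpow analyticAt_const ?_
      simp [hg0]
    have := ((hasDerivAt_id p).sub_const p).mul h3.differentiableAt.hasDerivAt
    have h4 := this.deriv
    simp only [id, Pi.mul_def] at h4
    rw [h4]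
    simp [hg0]
  · filter_upwards [he, hg.continuousAt.eventually_ne hg0] with z hz hgz
    have : f z = f p + (z - p)^m * g z := by rw [smul_eq_mul] at hz; linear_combination hz
    rw [this, mul_pow, mul_pow, ← Complex.cpow_nat_mul, ← Complex.cpow_nat_mul]
    have hm' : (m:ℂ) ≠ 0 := by exact_mod_cast hm
    rw [mul_inv_cancel₀ hm']
    simp only [Complex.cpow_one]
    field_simp

theorem inj_deriv_ne_zero {U : Set ℂ} (hU : IsOpen U) {f : ℂ → ℂ} (hf : DifferentiableOn ℂ f U)
    (hi : InjOn f U) {z : ℂ} (hz : z ∈ U) : deriv f z ≠ 0 := by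
  intro hd
  have hfa : AnalyticAt ℂ f z := hf.analyticAt (hU.mem_nhds hz)
  have hnc : ¬ ∀ᶠ w in nhds z, f w = f z := by
    intro h
    have h1 : ∀ᶠ w in nhds z, w = z := by
      filter_upwards [h, hU.mem_nhds hz] with w h1 h2 using hi h2 hz h1
    have : ∀ᶠ w in nhdsWithin z {z}ᶜ, False := by
      filter_upwards [h1.filter_mono nhdsWithin_le_nhds, self_mem_nhdsWithin] with w h1 h2 using h2 h1
    simp at this
    exact (NormedField.nhdsNE_neBot z).ne this
  obtain ⟨m, hm, k, hk, hk0, hk1, he⟩ := normal_form hfa hnc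
  rcases Nat.lt_or_ge m 2 with h2 | h2
  · obtain rfl : m = 1 := by omega
    have : deriv f z = deriv k z := by
      have : f =ᶠ[nhds z] fun w => f z + k w := by
        filter_upwards [he] with w hw
        simpa using hw
      rw [this.deriv_eq]; simp
    exact hk1 (this ▸ hd)
  · have hst : HasStrictDerivAt k (deriv k z) z := hk.hasStrictDerivAt
    have hmap := hst.map_nhds_eq hk1
    rw [hk0] at hmap
    set ω : ℂ := Complex.exp (2 * Real.pi * Complex.I / m)
    have hω : IsPrimitiveRoot ω m := Complex.isPrimitiveRoot_exp m (by omega)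
    have hω1 : ω ≠ 1 := hω.ne_one (by omega)
    have hS : {w | w ∈ U ∧ f w = f z + k w ^ m} ∈ nhds z := inter_mem (hU.mem_nhds hz) he
    have hI : k '' {w | w ∈ U ∧ f w = f z + k w ^ m} ∈ nhds (0:ℂ) := by
      rw [← hmap]; exact image_mem_map hS
    have hI2 : ∀ᶠ x in nhds (0:ℂ), ω * x ∈ k '' {w | w ∈ U ∧ f w = f z + k w ^ m} := by
      have : Tendsto (fun x => ω * x) (nhds 0) (nhds (0:ℂ)) := by
        have : Continuous fun x : ℂ => ω * x := by fun_prop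
        simpa using this.tendsto 0
      exact this hI
    have h3 : ∀ᶠ x in nhdsWithin (0:ℂ) {0}ᶜ, x ≠ 0 ∧ x ∈ k '' {w | w ∈ U ∧ f w = f z + k w ^ m} ∧ ω * x ∈ k '' {w | w ∈ U ∧ f w = f z + k w ^ m} := by
      filter_upwards [self_mem_nhdsWithin, nhdsWithin_le_nhds hI, hI2.filter_mono nhdsWithin_le_nhds] with x h1 h2 h3 using ⟨h1, h2, h3⟩
    obtain ⟨x, hx0, ⟨a, ⟨haU, ha⟩, hax⟩, ⟨b, ⟨hbU, hb⟩, hbx⟩⟩ := h3.exists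
    have : f a = f b := by rw [ha, hb, hax, hbx, mul_pow, hω.pow_eq_one, one_mul]
    have := hi haU hbU this
    rw [this, hbx] at hax
    exact hω1 (mul_right_cancel₀ hx0 (by simpa using hax))

theorem image_mem_nhds_of_inj {U : Set ℂ} (hU : IsOpen U) {f : ℂ → ℂ} (hf : DifferentiableOn ℂ f U)
    (hi : InjOn f U) {z : ℂ} (hz : z ∈ U) {s : Set ℂ} (hs : s ∈ nhds z) : f '' s ∈ nhds (f z) := by
  have hfa : AnalyticAt ℂ f z := hf.analyticAt (hU.mem_nhds hz)
  rw [← hfa.hasStrictDerivAt.map_nhds_eq (inj_deriv_ne_zero hU hf hi hz)]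
  exact image_mem_map hs

theorem isOpen_image_of_inj {U : Set ℂ} (hU : IsOpen U) {f : ℂ → ℂ} (hf : DifferentiableOn ℂ f U)
    (hi : InjOn f U) : IsOpen (f '' U) := by
  rw [isOpen_iff_mem_nhds]
  rintro _ ⟨z, hz, rfl⟩
  exact image_mem_nhds_of_inj hU hf hi hz (hU.mem_nhds hz)

theorem inv_holo {U : Set ℂ} (hU : IsOpen U) {f g : ℂ → ℂ} (hf : DifferentiableOn ℂ f U)
    (hi : InjOn f U) (hg : LeftInvOn g f U) : DifferentiableOn ℂ g (f '' U) := by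
  rintro _ ⟨z, hz, rfl⟩
  have hc : ContinuousAt g (f z) := by
    rw [ContinuousAt, hg hz]
    intro s hs
    have : f '' (s ∩ U) ∈ nhds (f z) := image_mem_nhds_of_inj hU hf hi hz (inter_mem hs (hU.mem_nhds hz))
    rw [mem_map]
    refine mem_of_superset this ?_
    rintro _ ⟨w, ⟨hw, hwU⟩, rfl⟩
    show g (f w) ∈ s
    rwa [hg hwU]
  have hd : HasDerivAt f (deriv f z) (g (f z)) := by
    rw [hg hz]; exact (hf.differentiableAt (hU.mem_nhds hz)).hasDerivAt
  refine (HasDerivAt.of_local_left_inverse hc hd (inj_deriv_ne_zero hU hf hi hz) ?_).differentiableAt.differentiableWithinAt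
  filter_upwards [image_mem_nhds_of_inj hU hf hi hz (hU.mem_nhds hz)]
  rintro _ ⟨w, hw, rfl⟩
  rw [hg hw]

/-- local boundedness along a filter -/
def LocBdd {ι : Type*} (F : ι → ℂ → ℂ) (l : Filter ι) (U : Set ℂ) : Prop :=
  ∀ z ∈ U, ∃ r > 0, ∃ M : ℝ, ball z r ⊆ U ∧ ∀ᶠ i in l, ∀ w ∈ ball z r, ‖F i w‖ ≤ M

theorem lip_center {f : ℂ → ℂ} {z : ℂ} {r M : ℝ} (hf : DifferentiableOn ℂ f (ball z r))
    (hM : ∀ w ∈ ball z r, ‖f w‖ ≤ M) {w : ℂ} (hw : w ∈ ball z r) :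
    dist (f w) (f z) ≤ (2 * M + 1) / r * dist w z := by
  have hz : z ∈ ball z r := mem_ball_self (lt_of_le_of_lt dist_nonneg hw)
  refine Complex.dist_le_div_mul_dist_of_mapsTo_ball (R₂ := 2 * M + 1) hf ?_ hw
  intro y hy
  rw [mem_closedBall, dist_eq_norm]
  have := norm_sub_le (f y) (f z)
  linarith [hM y hy, hM z hz]

theorem locUnif_of_pointwise {ι : Type*} {F : ι → ℂ → ℂ} {l : Filter ι} [l.NeBot] {U : Set ℂ} {h : ℂ → ℂ}
    (hF : ∀ i, DifferentiableOn ℂ (F i) U) (hb : LocBdd F l U)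
    (hp : ∀ z ∈ U, Tendsto (fun i => F i z) l (nhds (h z))) : TendstoLocallyUniformlyOn F h l U := by
  rw [Metric.tendstoLocallyUniformlyOn_iff]
  intro ε hε x hx
  obtain ⟨r, hr, M, hrU, hM⟩ := hb x hx
  have hM0 : 0 ≤ M := by
    obtain ⟨i, hi⟩ := hM.exists
    exact (norm_nonneg _).trans (hi x (mem_ball_self hr))
  set L := (2 * M + 1) / r with hL
  have hL0 : 0 < L := by positivity
  have hlim : ∀ y ∈ ball x r, dist (h y) (h x) ≤ L * dist y x := by
    intro y hy
    refine le_of_tendsto ((hp y (hrU hy)).dist (hp x hx)) ?_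
    filter_upwards [hM] with i hi
    exact lip_center ((hF i).mono hrU) hi hy
  set δ := min r (ε / (4 * L)) with hδ
  have hδ0 : 0 < δ := by positivity
  refine ⟨ball x δ, mem_nhdsWithin_of_mem_nhds (ball_mem_nhds x hδ0), ?_⟩
  filter_upwards [hM, Metric.tendsto_nhds.mp (hp x hx) (ε/4) (by positivity)] with i hi hi2 y hy
  have hyr : y ∈ ball x r := ball_subset_ball (min_le_left _ _) hy
  have h1 := lip_center ((hF i).mono hrU) hi hyr
  have h2 := hlim y hyr
  have h3 : L * dist y x ≤ ε / 4 := by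
    have : dist y x ≤ ε / (4 * L) := (mem_ball.mp hy).le.trans (min_le_right _ _)
    calc L * dist y x ≤ L * (ε / (4 * L)) := by gcongr
      _ = ε / 4 := by field_simp
  calc dist (h y) (F i y) ≤ dist (h y) (h x) + dist (h x) (F i x) + dist (F i x) (F i y) := dist_triangle4 _ _ _ _
    _ < ε := by rw [dist_comm (h x), dist_comm (F i x) (F i y)]; linarith

theorem montel_ultra {ι : Type*} {F : ι → ℂ → ℂ} (l : Ultrafilter ι) {U : Set ℂ} (hU : IsOpen U)
    (hF : ∀ i, DifferentiableOn ℂ (F i) U) (hb : LocBdd F l U) :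
    ∃ h : ℂ → ℂ, DifferentiableOn ℂ h U ∧ TendstoLocallyUniformlyOn F h l U := by
  have : ∀ z ∈ U, ∃ y, Tendsto (fun i => F i z) l (nhds y) := by
    intro z hz
    obtain ⟨r, hr, M, hrU, hM⟩ := hb z hz
    have h1 : ∀ᶠ i in (l : Filter ι), F i z ∈ closedBall (0:ℂ) M := by
      filter_upwards [hM] with i hi
      simpa using hi z (mem_ball_self hr)
    obtain ⟨y, -, hy⟩ := (isCompact_closedBall (0:ℂ) M).ultrafilter_le_nhds (l.map (fun i => F i z))
      (by rw [le_principal_iff]; exact h1)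
    exact ⟨y, hy⟩
  choose! h hh using this
  have := locUnif_of_pointwise hF hb hh
  exact ⟨h, this.differentiableOn (Eventually.of_forall hF) hU, this⟩

theorem vitali {ι : Type*} {F : ι → ℂ → ℂ} {l : Filter ι} [l.NeBot] {U : Set ℂ} (hU : IsOpen U)
    (hc : IsPreconnected U) {g : ℂ → ℂ} (hg : DifferentiableOn ℂ g U)
    (hF : ∀ i, DifferentiableOn ℂ (F i) U) (hb : LocBdd F l U)
    {O : Set ℂ} (hO : IsOpen O) (hOU : O ⊆ U) (hne : O.Nonempty)
    (hp : ∀ z ∈ O, Tendsto (fun i => F i z) l (nhds (g z))) : TendstoLocallyUniformlyOn F g l U := by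
  refine locUnif_of_pointwise hF hb ?_
  intro z hz
  rw [tendsto_iff_ultrafilter]
  intro u hu
  have hbu : LocBdd F u U := by
    intro z hz
    obtain ⟨r, hr, M, h1, h2⟩ := hb z hz
    exact ⟨r, hr, M, h1, h2.filter_mono hu⟩
  obtain ⟨h, hh, hlim⟩ := montel_ultra u hU hF hbu
  have : EqOn h g O := fun y hy => tendsto_nhds_unique (hlim.tendsto_at (hOU hy)) ((hp y hy).mono_left hu)
  rw [← id_thm hU hc hh hg hO hOU hne this hz]
  exact hlim.tendsto_at hz

theorem preconn_const_of_eventually {U : Set ℂ} (hU : IsOpen U) (hc : IsPreconnected U) {h : ℂ → ℂ}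
    (hh : DifferentiableOn ℂ h U) {a : ℂ} (ha : a ∈ U) (hE : ∃ᶠ z in nhdsWithin a {a}ᶜ, h z = h a) :
    ∀ z ∈ U, h z = h a := by
  have := (hh.analyticOnNhd hU).eqOn_of_preconnected_of_frequently_eq (analyticOnNhd_const (v := h a)) hc ha hE
  exact this

theorem exists_sphere_bound {U : Set ℂ} (hU : IsOpen U) {h : ℂ → ℂ}
    (hh : DifferentiableOn ℂ h U) {a : ℂ} (ha : a ∈ U)
    (hE : ∀ᶠ z in nhdsWithin a {a}ᶜ, h z ≠ h a) {d : ℝ} (hd : 0 < d) :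
    ∃ r > 0, r < d ∧ closedBall a r ⊆ U ∧ ∃ ε > 0, ∀ z ∈ sphere a r, ε ≤ ‖h z - h a‖ := by
  rw [eventually_nhdsWithin_iff, Metric.eventually_nhds_iff_ball] at hE
  obtain ⟨r1, hr1, h1⟩ := hE
  obtain ⟨r2, hr2, h2⟩ := Metric.isOpen_iff.mp hU a ha
  set r := min d (min r1 r2) / 2 with hr
  have hr0 : 0 < r := by positivity
  have hrd : r < d := by have := min_le_left d (min r1 r2); rw [hr]; linarith
  have hrr1 : r < r1 := by
    have := (min_le_right d (min r1 r2)).trans (min_le_left _ _)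
    have h0 : 0 < min d (min r1 r2) := by positivity
    rw [hr]; linarith
  have hrr2 : r < r2 := by
    have := (min_le_right d (min r1 r2)).trans (min_le_right _ _)
    have h0 : 0 < min d (min r1 r2) := by positivity
    rw [hr]; linarith
  have hsub : closedBall a r ⊆ U := (closedBall_subset_ball hrr2).trans h2
  refine ⟨r, hr0, hrd, hsub, ?_⟩
  have hcont : ContinuousOn (fun z => ‖h z - h a‖) (sphere a r) :=
    ((hh.continuousOn.mono (sphere_subset_closedBall.trans hsub)).sub continuousOn_const).norm
  obtain ⟨z, hz, hmin⟩ := (isCompact_sphere a r).exists_isMinOn (NormedSpace.sphere_nonempty.mpr hr0.le) hcont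
  refine ⟨‖h z - h a‖, ?_, fun w hw => hmin hw⟩
  have hza : z ≠ a := by rintro rfl; simp at hz; exact hr0.ne hz
  have := h1 z (by rw [mem_ball, mem_sphere.mp hz]; exact hrr1) hza
  exact norm_pos_iff.mpr (sub_ne_zero.mpr this)

theorem hurwitz_inj {ι : Type*} {F : ι → ℂ → ℂ} {l : Filter ι} [l.NeBot] {U : Set ℂ} (hU : IsOpen U)
    (hc : IsPreconnected U) {h : ℂ → ℂ} (hh : DifferentiableOn ℂ h U)
    (hF : ∀ᶠ i in l, DifferentiableOn ℂ (F i) U) (hi : ∀ᶠ i in l, InjOn (F i) U)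
    (hlim : TendstoLocallyUniformlyOn F h l U) {x y : ℂ} (hx : x ∈ U) (hy : y ∈ U) (hxy : h x ≠ h y) :
    InjOn h U := by
  intro a ha b hb hab
  by_contra hne
  have hev : ∀ c ∈ U, ∀ᶠ z in nhdsWithin c {c}ᶜ, h z ≠ h c := by
    intro c hcU
    by_contra hcon
    have hfr : ∃ᶠ z in nhdsWithin c {c}ᶜ, h z = h c := by
      intro hcon2; exact hcon hcon2
    have := preconn_const_of_eventually hU hc hh hcU hfr
    exact hxy ((this x hx).trans (this y hy).symm)
  have hd : 0 < dist a b / 2 := by have := dist_pos.mpr hne; positivity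
  -- common conclusion: v in image of closed ball
  have key : ∀ c ∈ U, ∃ r > 0, r < dist a b / 2 ∧ closedBall c r ⊆ U ∧
      ∀ᶠ i in l, h c ∈ F i '' closedBall c r := by
    intro c hcU
    obtain ⟨r, hr, hrd, hsub, ε, hε, hs⟩ := exists_sphere_bound hU hh hcU (hev c hcU) hd
    refine ⟨r, hr, hrd, hsub, ?_⟩
    have hu : TendstoUniformlyOn F h l (closedBall c r) :=
      (tendstoLocallyUniformlyOn_iff_forall_isCompact hU).mp hlim _ hsub (isCompact_closedBall _ _)
    rw [Metric.tendstoUniformlyOn_iff] at hu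
    filter_upwards [hF, hi, hu (ε/8) (by positivity)] with i h1 h2 h3
    have hcc := h3 c (mem_closedBall_self hr.le)
    have hdc : DiffContOnCl ℂ (F i) (ball c r) := by
      refine (h1.mono ?_).diffContOnCl
      rwa [closure_ball c hr.ne']
    have := hdc.ball_subset_image_closedBall (ε := 3 * ε / 4) hr ?_ ?_
    · apply this
      rw [mem_ball]; linarith
    · intro z hz
      have hz' := h3 z (sphere_subset_closedBall hz)
      have := hs z hz
      rw [dist_eq_norm] at hz' hcc
      have e : h z - h c = (h z - F i z) + (F i z - F i c) - (h c - F i c) := by ring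
      have := norm_sub_le ((h z - F i z) + (F i z - F i c)) (h c - F i c)
      have := norm_add_le (h z - F i z) (F i z - F i c)
      rw [← e] at *
      linarith
    · have : ∀ᶠ z in nhdsWithin c {c}ᶜ, F i z ≠ F i c := by
        filter_upwards [self_mem_nhdsWithin, nhdsWithin_le_nhds (hU.mem_nhds hcU)] with z hz hzU he
        exact hz (h2 hzU hcU he)
      exact this.frequently.filter_mono nhdsWithin_le_nhds
  obtain ⟨ra, hra, hra2, hsa, hka⟩ := key a ha
  obtain ⟨rb, hrb, hrb2, hsb, hkb⟩ := key b hb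
  obtain ⟨i, ⟨p, hp, hpe⟩, ⟨q, hq, hqe⟩, hinj⟩ := (hka.and (hkb.and hi)).exists
  have : p = q := hinj (hsa hp) (hsb hq) (by rw [hpe, hqe, hab])
  subst this
  have := dist_triangle_left a b p
  rw [mem_closedBall] at hp hq
  linarith

open Metric Set Function Filter

theorem gl_extend {r : ℝ} (hr : 0 < r) {h : ℂ → ℂ} (hh : DifferentiableOn ℂ h (ball 0 r))
    (hloc : ∀ ζ ∈ sphere (0:ℂ) r, ∃ ρ > 0, ∃ Θ : ℂ → ℂ, DifferentiableOn ℂ Θ (ball ζ ρ) ∧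
      EqOn Θ h (ball ζ ρ ∩ ball 0 r)) :
    ∃ R > r, ∃ H : ℂ → ℂ, DifferentiableOn ℂ H (ball 0 R) ∧ EqOn H h (ball 0 r) := by
  have hcov : ∀ ζ ∈ sphere (0:ℂ) r, ∃ ρ > 0, ∃ Θ : ℂ → ℂ, DifferentiableOn ℂ Θ (ball ζ ρ) ∧
      EqOn Θ h (ball ζ ρ ∩ ball 0 r) := hloc
  choose! ρ hρ T hT hTe using hcov
  obtain ⟨δ, hδ, hleb⟩ := lebesgue_number_lemma_of_metric (s := sphere (0:ℂ) r)
    (c := fun ζ : sphere (0:ℂ) r => ball (ζ:ℂ) (ρ ζ)) (isCompact_sphere _ _) (fun _ => isOpen_ball)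
    (fun ζ hζ => mem_iUnion.mpr ⟨⟨ζ, hζ⟩, mem_ball_self (hρ ζ hζ)⟩)
  have : ∀ ζ ∈ sphere (0:ℂ) r, ∃ Θ : ℂ → ℂ, DifferentiableOn ℂ Θ (ball ζ δ) ∧
      EqOn Θ h (ball ζ δ ∩ ball 0 r) := by
    intro ζ hζ
    obtain ⟨⟨ξ, hξ⟩, hs⟩ := hleb ζ hζ
    exact ⟨T ξ, (hT ξ hξ).mono hs, (hTe ξ hξ).mono (inter_subset_inter_left _ hs)⟩
  choose! Θ hΘ hΘe using this
  -- consistency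
  have hcons : ∀ ζ ∈ sphere (0:ℂ) r, ∀ ξ ∈ sphere (0:ℂ) r, dist ζ ξ < δ →
      EqOn (Θ ζ) (Θ ξ) (ball ζ δ ∩ ball ξ δ) := by
    intro ζ hζ ξ hξ hd
    have hconv : Convex ℝ (ball ζ δ ∩ ball ξ δ) := (convex_ball _ _).inter (convex_ball _ _)
    refine id_thm (isOpen_ball.inter isOpen_ball) hconv.isPreconnected
      ((hΘ ζ hζ).mono inter_subset_left) ((hΘ ξ hξ).mono inter_subset_right)
      (O := (ball ζ δ ∩ ball ξ δ) ∩ ball 0 r) ((isOpen_ball.inter isOpen_ball).inter isOpen_ball)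
      inter_subset_left ?_ ?_
    · have hcl : ζ ∈ closure (ball (0:ℂ) r) := by
        rw [closure_ball _ hr.ne']; exact sphere_subset_closedBall hζ
      rw [_root_.mem_closure_iff] at hcl
      exact hcl _ (isOpen_ball.inter isOpen_ball) ⟨mem_ball_self hδ, hd⟩
    · rintro w ⟨⟨h1, h2⟩, h3⟩
      rw [hΘe ζ hζ ⟨h1, h3⟩, hΘe ξ hξ ⟨h2, h3⟩]
  set π : ℂ → ℂ := fun w => (r / ‖w‖ : ℝ) * w with hπ
  have hπs : ∀ w : ℂ, w ≠ 0 → π w ∈ sphere (0:ℂ) r := by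
    intro w hw
    have : 0 < ‖w‖ := norm_pos_iff.mpr hw
    rw [mem_sphere_zero_iff_norm, hπ]
    simp only [norm_mul, Complex.norm_real, Real.norm_eq_abs]
    rw [abs_of_pos (by positivity)]
    field_simp
  have hπd : ∀ w : ℂ, w ≠ 0 → dist w (π w) = |‖w‖ - r| := by
    intro w hw
    have h0 : 0 < ‖w‖ := norm_pos_iff.mpr hw
    rw [dist_eq_norm, hπ]
    have : w - ((r / ‖w‖ : ℝ):ℂ) * w = ((1 - r / ‖w‖ : ℝ) : ℂ) * w := by push_cast; ring
    simp only
    rw [this, norm_mul, Complex.norm_real, Real.norm_eq_abs]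
    nth_rewrite 2 [← abs_of_pos h0]
    rw [← abs_mul]; congr 1; field_simp
  classical
  refine ⟨r + δ, by linarith, fun w => if ‖w‖ < r then h w else Θ (π w) w, ?_, ?_⟩
  · intro w0 hw0
    rw [mem_ball_zero_iff] at hw0
    by_cases hlt : ‖w0‖ < r
    · have h1 : DifferentiableAt ℂ h w0 := hh.differentiableAt (isOpen_ball.mem_nhds (by simpa using hlt))
      refine (h1.congr_of_eventuallyEq ?_).differentiableWithinAt
      filter_upwards [isOpen_ball.mem_nhds (show w0 ∈ ball (0:ℂ) r by simpa using hlt)] with w hw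
      rw [mem_ball_zero_iff] at hw
      simp [hw]
    · have hne : w0 ≠ 0 := by rintro rfl; simp at hlt; linarith
      have hd0 : dist w0 (π w0) < δ := by
        rw [hπd w0 hne, abs_lt]; constructor <;> linarith
      have h1 : DifferentiableAt ℂ (Θ (π w0)) w0 :=
        (hΘ _ (hπs w0 hne)).differentiableAt (isOpen_ball.mem_nhds hd0)
      refine (h1.congr_of_eventuallyEq ?_).differentiableWithinAt
      have hcπ : ContinuousAt π w0 := by
        have : ‖w0‖ ≠ 0 := norm_ne_zero_iff.mpr hne
        rw [hπ]
        refine ContinuousAt.mul (Complex.continuous_ofReal.continuousAt.comp ?_) continuousAt_id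
        exact continuousAt_const.div continuous_norm.continuousAt this
      have e1 : ∀ᶠ w in nhds w0, dist (π w) (π w0) < δ := hcπ.eventually (ball_mem_nhds _ hδ)
      filter_upwards [e1, isOpen_ball.mem_nhds hd0, isOpen_ne.mem_nhds hne,
        continuous_norm.continuousAt.eventually (gt_mem_nhds hw0)] with w hw1 hw2 hw3 hw4
      by_cases hlw : ‖w‖ < r
      · simp only [hlw, if_true]
        exact (hΘe _ (hπs w0 hne) ⟨hw2, by simpa using hlw⟩).symm
      · simp only [hlw, if_false]
        refine hcons _ (hπs w hw3) _ (hπs w0 hne) hw1 ⟨?_, hw2⟩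
        rw [mem_ball, hπd w hw3, abs_lt]
        constructor <;> linarith
  · intro w hw
    rw [mem_ball_zero_iff] at hw
    simp [hw]

theorem local_inj {P : ℂ → ℂ} {p : ℂ} (hP : AnalyticAt ℂ P p) (hd : deriv P p ≠ 0) :
    ∃ r > 0, InjOn P (ball p r) := by
  have hst := hP.hasStrictDerivAt.hasStrictFDerivAt_equiv hd
  set e := hst.toOpenPartialHomeomorph P with hedef
  have hz'e : p ∈ e.source := hst.mem_toOpenPartialHomeomorph_source
  obtain ⟨r, hr, h⟩ := Metric.isOpen_iff.mp e.open_source p hz'e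
  exact ⟨r, hr, fun x hx y hy hxy => e.injOn (h hx) (h hy) hxy⟩

open Metric Set Function Filter

/-- Siegel data -/
structure SD (g : ℂ → ℂ) (z₀ lam : ℂ) (D : Set ℂ) (φ ψ : ℂ → ℂ) : Prop where
  g_diff : Differentiable ℂ g
  lam_norm : ‖lam‖ = 1
  lam_ne : ∀ k : ℕ, 1 ≤ k → lam ^ k ≠ 1
  lam_rec : ∀ ε > 0, ∀ N : ℕ, ∃ k ≥ N, ‖lam ^ k - 1‖ < ε
  lam_dense : ∀ u : ℂ, ‖u‖ = 1 → ∀ ε > 0, ∃ k : ℕ, ‖lam ^ k - u‖ < ε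
  isOpen : IsOpen D
  conn : IsConnected D
  z0_mem : z₀ ∈ D
  maps : MapsTo g D D
  φ_diff : DifferentiableOn ℂ φ D
  φ_inj : InjOn φ D
  φ_maps : MapsTo φ D (ball 0 1)
  φ0 : φ z₀ = 0
  conj : ∀ z ∈ D, φ (g z) = lam * φ z
  ψ_diff : DifferentiableOn ℂ ψ (ball 0 1)
  ψ_maps : MapsTo ψ (ball 0 1) D
  ψφ : ∀ z ∈ D, ψ (φ z) = z
  φψ : ∀ ζ ∈ ball (0:ℂ) 1, φ (ψ ζ) = ζ
  deriv0 : deriv g z₀ = lam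

theorem circle_dense {α : ℝ} (hα : Irrational α) {lam : ℂ}
    (hlam : lam = Complex.exp (2 * Real.pi * Complex.I * α)) :
    ‖lam‖ = 1 ∧ (∀ k : ℕ, 1 ≤ k → lam ^ k ≠ 1) ∧ (∀ ε > 0, ∀ N : ℕ, ∃ k ≥ N, ‖lam ^ k - 1‖ < ε) ∧
    (∀ u : ℂ, ‖u‖ = 1 → ∀ ε > 0, ∃ k : ℕ, ‖lam ^ k - u‖ < ε) := by
  set L : Circle := Circle.exp (2 * Real.pi * α) with hL
  have hLl : (L : ℂ) = lam := by
    rw [hL, hlam, Circle.coe_exp]; push_cast; ring_nf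
  have hn : ‖lam‖ = 1 := by rw [← hLl]; exact Circle.norm_coe L
  refine ⟨hn, ?_, ?_, ?_⟩
  · intro k hk h
    rw [hlam, ← Complex.exp_nat_mul, Complex.exp_eq_one_iff] at h
    obtain ⟨m, hm⟩ := h
    have hpi : (2 * Real.pi * Complex.I : ℂ) ≠ 0 := Complex.two_pi_I_ne_zero
    have h2 : (k:ℂ) * α = m := by
      apply mul_left_cancel₀ hpi; linear_combination hm
    have h3 : (k:ℝ) * α = m := by exact_mod_cast h2
    have : Irrational ((k:ℕ) * α) := hα.natCast_mul (by omega)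
    rw [h3] at this
    exact (Int.not_irrational m) this
  · intro ε hε N
    have := (mapClusterPt_one_atTop_pow L)
    have h1 : {x : Circle | ‖(x:ℂ) - 1‖ < ε} ∈ nhds (1:Circle) := by
      have : Continuous fun x : Circle => ‖(x:ℂ) - 1‖ := by fun_prop
      exact (isOpen_lt this continuous_const).mem_nhds (by simpa using hε)
    obtain ⟨k, hk, h2⟩ := (frequently_atTop.mp (this.frequently h1)) N
    exact ⟨k, hk, by simpa [hLl] using h2⟩
  · intro u hu ε hε
    have hd : DenseRange (fun n : ℤ => n • ((α : ℝ) : AddCircle (1:ℝ))) := by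
      rw [AddCircle.denseRange_zsmul_coe_iff]; simpa using hα
    rw [denseRange_zsmul_iff_nsmul] at hd
    have hsurj : Function.Surjective (AddCircle.toCircle (T := (1:ℝ))) := by
      intro x
      obtain ⟨y, hy⟩ := (AddCircle.homeomorphCircle (T := (1:ℝ)) one_ne_zero).surjective x
      exact ⟨y, by rw [← AddCircle.homeomorphCircle_apply (T := (1:ℝ)) one_ne_zero]; exact hy⟩
    have hd2 := hsurj.denseRange.comp hd AddCircle.continuous_toCircle
    obtain ⟨v, rfl⟩ : ∃ v : Circle, (v:ℂ) = u := ⟨⟨u, by simp [Submonoid.unitSphere, hu]⟩, rfl⟩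
    have ho : IsOpen {x : Circle | ‖(x:ℂ) - v‖ < ε} := by
      have : Continuous fun x : Circle => ‖(x:ℂ) - v‖ := by fun_prop
      exact (isOpen_lt this continuous_const)
    obtain ⟨k, hk⟩ := hd2.exists_mem_open ho ⟨v, by simpa using hε⟩
    refine ⟨k, ?_⟩
    have : (((AddCircle.toCircle (T := (1:ℝ))) (k • ((α : ℝ) : AddCircle (1:ℝ))) : Circle) : ℂ) = lam ^ k := by
      rw [AddCircle.toCircle_nsmul, AddCircle.toCircle_apply_mk, ← hLl, hL]
      simp
    simpa [this] using hk

theorem SD.of {g : ℂ → ℂ} (hg : Differentiable ℂ g) {z₀ lam : ℂ} {D : Set ℂ} {α : ℝ} (hα : Irrational α)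
    (hlam : lam = Complex.exp (2 * Real.pi * Complex.I * α))
    (hd : deriv g z₀ = lam) (hD : IsSiegelDomain g z₀ lam D) :
    ∃ φ ψ, SD g z₀ lam D φ ψ := by
  obtain ⟨h1, h2, h3, h4⟩ := circle_dense hα hlam
  obtain ⟨ho, hc, hz, hm, φ, hφ, hb, h0, hcj⟩ := hD
  have hl : LeftInvOn (invFunOn φ D) φ D := hb.injOn.leftInvOn_invFunOn
  refine ⟨φ, invFunOn φ D, hg, h1, h2, h3, h4, ho, hc, hz, hm, hφ, hb.injOn, hb.mapsTo, h0, hcj, ?_, ?_, ?_, ?_, hd⟩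
  · rw [← hb.image_eq]; exact inv_holo ho hφ hb.injOn hl
  · intro ζ hζ
    rw [← hb.image_eq] at hζ
    exact invFunOn_mem hζ
  · exact fun z hz => hl hz
  · intro ζ hζ
    rw [← hb.image_eq] at hζ
    exact invFunOn_eq hζ

namespace SD
variable {g : ℂ → ℂ} {z₀ lam : ℂ} {D : Set ℂ} {φ ψ : ℂ → ℂ}

theorem lam_ne0 (S : SD g z₀ lam D φ ψ) : lam ≠ 0 := by
  intro h; have := S.lam_norm; simp [h] at this

theorem ψ_conj (S : SD g z₀ lam D φ ψ) {ζ : ℂ} (hζ : ζ ∈ ball (0:ℂ) 1) : ψ (lam * ζ) = g (ψ ζ) := by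
  rw [← S.ψφ (g (ψ ζ)) (S.maps (S.ψ_maps hζ)), S.conj _ (S.ψ_maps hζ), S.φψ ζ hζ]

theorem lam_pow_norm (S : SD g z₀ lam D φ ψ) (k : ℕ) : ‖lam ^ k‖ = 1 := by
  rw [norm_pow, S.lam_norm, one_pow]

theorem ψ_conj_iter (S : SD g z₀ lam D φ ψ) {ζ : ℂ} (hζ : ζ ∈ ball (0:ℂ) 1) (k : ℕ) :
    ψ (lam ^ k * ζ) = g^[k] (ψ ζ) := by
  induction k with
  | zero => simp
  | succ k ih =>
    rw [iterate_succ_apply', ← ih, ← S.ψ_conj, pow_succ']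
    · ring_nf
    · rw [mem_ball_zero_iff] at *
      rwa [norm_mul, S.lam_pow_norm, one_mul]

theorem iter_maps (S : SD g z₀ lam D φ ψ) (k : ℕ) : MapsTo g^[k] D D := S.maps.iterate k

theorem ψ0 (S : SD g z₀ lam D φ ψ) : ψ 0 = z₀ := by
  rw [← S.φ0, S.ψφ _ S.z0_mem]

theorem g_z0 (S : SD g z₀ lam D φ ψ) : g z₀ = z₀ := by
  have := S.ψ_conj (ζ := 0) (by simp)
  rw [mul_zero, S.ψ0] at this
  exact this.symm

theorem ψ_inj (S : SD g z₀ lam D φ ψ) : InjOn ψ (ball 0 1) := by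
  intro a ha b hb h
  rw [← S.φψ a ha, h, S.φψ b hb]

/-- φ tends to the unit circle at the boundary. -/
theorem bdry (S : SD g z₀ lam D φ ψ) {z : ℂ} (hz : z ∉ D) {ρ : ℝ} (hρ : ρ < 1) :
    ∃ ε > 0, ∀ y ∈ D, y ∈ ball z ε → ρ < ‖φ y‖ := by
  have hK : IsCompact (ψ '' closedBall 0 ρ) :=
    (isCompact_closedBall _ _).image_of_continuousOn
      (S.ψ_diff.continuousOn.mono (closedBall_subset_ball hρ))
  have hzK : z ∉ ψ '' closedBall 0 ρ := by
    rintro ⟨ζ, hζ, rfl⟩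
    exact hz (S.ψ_maps (closedBall_subset_ball hρ hζ))
  obtain ⟨ε, hε, h⟩ := Metric.isOpen_iff.mp hK.isClosed.isOpen_compl z hzK
  refine ⟨ε, hε, fun y hy hyb => ?_⟩
  by_contra hcon
  refine h hyb ⟨φ y, by simpa using hcon, S.ψφ y hy⟩

theorem not_mem_of_frontier (S : SD g z₀ lam D φ ψ) {z : ℂ} (hz : z ∈ frontier D) : z ∉ D := by
  rw [S.isOpen.frontier_eq] at hz; exact hz.2

end SD

/-- If a holomorphic `h` near circle-multiples satisfies an identity for all `lam^k`, it holds identically. -/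
theorem zero_of_lam_pow {g : ℂ → ℂ} {z₀ lam : ℂ} {D : Set ℂ} {φ ψ : ℂ → ℂ} (S : SD g z₀ lam D φ ψ)
    {R : ℝ} (hR : 1 < R) {h : ℂ → ℂ} (hh : DifferentiableOn ℂ h (ball 0 R))
    (h0 : ∀ k : ℕ, h (lam ^ k) = 0) : ∀ w ∈ ball (0:ℂ) R, h w = 0 := by
  have h1 : (1:ℂ) ∈ ball (0:ℂ) R := by simpa using hR
  have hh1 : h 1 = 0 := by simpa using h0 0
  have := preconn_const_of_eventually isOpen_ball (convex_ball (0:ℂ) R).isPreconnected hh h1 ?_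
  · intro w hw; rw [this w hw, hh1]
  · rw [hh1]
    intro hcon
    rw [eventually_nhdsWithin_iff, Metric.eventually_nhds_iff_ball] at hcon
    obtain ⟨ε, hε, he⟩ := hcon
    obtain ⟨k, hk, hk2⟩ := S.lam_rec ε hε 1
    exact he (lam ^ k) (by rwa [mem_ball, dist_eq_norm]) (S.lam_ne k hk) (h0 k)

theorem linear_of_conj {g : ℂ → ℂ} {z₀ lam : ℂ} {D : Set ℂ} {φ ψ : ℂ → ℂ} (S : SD g z₀ lam D φ ψ)
    {h : ℂ → ℂ} (hh : DifferentiableOn ℂ h (ball 0 1))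
    (hc : ∀ ζ ∈ ball (0:ℂ) 1, h (lam * ζ) = lam * h ζ) :
    ∀ ζ ∈ ball (0:ℂ) 1, h ζ = deriv h 0 * ζ := by
  have hc' : ∀ k : ℕ, ∀ ζ ∈ ball (0:ℂ) 1, h (lam ^ k * ζ) = lam ^ k * h ζ := by
    intro k ζ hζ
    induction k with
    | zero => simp
    | succ k ih =>
      rw [pow_succ', mul_assoc, hc, ih, mul_assoc]
      rw [mem_ball_zero_iff] at *
      rwa [norm_mul, S.lam_pow_norm, one_mul]
  intro ζ hζ
  rcases eq_or_ne ζ 0 with rfl | hne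
  · have := hc 0 (by simp)
    rw [mul_zero] at this
    have : (lam - 1) * h 0 = 0 := by linear_combination -this
    rcases mul_eq_zero.mp this with h1 | h1
    · exact absurd (by linear_combination h1) (S.lam_ne 1 le_rfl)
    · simp [h1]
  · have hn : 0 < ‖ζ‖ := norm_pos_iff.mpr hne
    rw [mem_ball_zero_iff] at hζ
    have hR : 1 < 1 / ‖ζ‖ := by rw [lt_div_iff₀ hn]; linarith
    have hmap : MapsTo (fun w : ℂ => w * ζ) (ball (0:ℂ) (1/‖ζ‖)) (ball 0 1) := by
      intro w hw
      rw [mem_ball_zero_iff] at *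
      rw [norm_mul]
      rwa [lt_div_iff₀ hn] at hw
    have hz := zero_of_lam_pow S hR (h := fun w => h (w * ζ) - w * h ζ) ?_ ?_
    · -- derivative at w = 0
      have e : (fun w => h (w * ζ)) =ᶠ[nhds 0] fun w => w * h ζ := by
        filter_upwards [ball_mem_nhds (0:ℂ) (show 0 < 1/‖ζ‖ by positivity)] with w hw
        exact sub_eq_zero.mp (hz w hw)
      have d1 : HasDerivAt (fun w => h (w * ζ)) (deriv h 0 * ζ) 0 := by
        have h0 : HasDerivAt h (deriv h 0) ((0:ℂ) * ζ) := by
          rw [zero_mul]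
          exact (hh.differentiableAt (ball_mem_nhds _ one_pos)).hasDerivAt
        have := h0.comp (0:ℂ) ((hasDerivAt_id (0:ℂ)).mul_const ζ)
        simpa [Function.comp_def] using this
      have d2 : HasDerivAt (fun w : ℂ => w * h ζ) (h ζ) 0 := by
        simpa using (hasDerivAt_id (0:ℂ)).mul_const (h ζ)
      have := e.deriv_eq
      rw [d1.deriv, d2.deriv] at this
      exact this.symm
    · refine DifferentiableOn.sub (hh.comp (by fun_prop) hmap) (by fun_prop)
    · intro k
      rw [hc' k ζ (by simpa using hζ), sub_self]

open Metric Set Function Filter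

theorem punct_ball_preconn (z : ℂ) {r : ℝ} (hr : 0 < r) : IsPreconnected (ball z r \ {z}) := by
  have : ball z r \ {z} = (fun w => z + Complex.exp w) '' {w : ℂ | w.re < Real.log r} := by
    ext y; constructor
    · rintro ⟨h1, h2⟩
      have hne : y - z ≠ 0 := sub_ne_zero.mpr h2
      refine ⟨Complex.log (y - z), ?_, by simp [Complex.exp_log hne]⟩
      show (Complex.log (y-z)).re < _
      rw [Complex.log_re]
      exact Real.log_lt_log (norm_pos_iff.mpr hne) (by simpa [dist_eq_norm] using h1)
    · rintro ⟨w, hw, rfl⟩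
      refine ⟨?_, ?_⟩
      · rw [mem_ball, dist_eq_norm]
        simp only [add_sub_cancel_left, Complex.norm_exp]
        rwa [← Real.lt_log_iff_exp_lt hr]
      · simp [Complex.exp_ne_zero]
  rw [this]
  exact ((convex_halfSpace_re_lt _).isPreconnected).image _ (by fun_prop)

theorem frontier_perfect {g : ℂ → ℂ} {z₀ lam : ℂ} {D : Set ℂ} {φ ψ : ℂ → ℂ} (S : SD g z₀ lam D φ ψ)
    {z : ℂ} (hz : z ∈ frontier D) {r : ℝ} (hr : 0 < r) : ∃ y ∈ frontier D, y ≠ z ∧ y ∈ ball z r := by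
  by_contra hcon
  push Not at hcon
  have hzD := S.not_mem_of_frontier hz
  have hcl : z ∈ closure D := frontier_subset_closure hz
  have hsub : ball z r \ {z} ⊆ D := by
    refine (punct_ball_preconn z hr).subset_of_closure_inter_subset S.isOpen ?_ ?_
    · obtain ⟨y, hy, hyD⟩ := _root_.mem_closure_iff.mp hcl _ isOpen_ball (mem_ball_self hr)
      exact ⟨y, ⟨hy, fun h => hzD (by rwa [← mem_singleton_iff.mp h])⟩, hyD⟩
    · rintro y ⟨h1, h2, h3⟩
      by_contra h4
      exact hcon y (by rw [S.isOpen.frontier_eq]; exact ⟨h1, h4⟩) h3 h2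
  have hd : DifferentiableOn ℂ φ (ball z r \ {z}) := S.φ_diff.mono hsub
  have hb : ∀ y ∈ ball z r \ {z}, ‖φ y‖ < 1 := fun y hy => by simpa using S.φ_maps (hsub hy)
  have hext := Complex.differentiableOn_update_limUnder_of_bddAbove (ball_mem_nhds z hr) hd
    ⟨1, by rintro _ ⟨y, hy, rfl⟩; exact (hb y hy).le⟩
  set Φ := Function.update φ z (limUnder (nhdsWithin z {z}ᶜ) φ) with hΦ
  have hΦe : ∀ y, y ≠ z → Φ y = φ y := fun y hy => by simp [hΦ, hy]
  have hcont : ContinuousAt Φ z := (hext.differentiableAt (ball_mem_nhds z hr)).continuousAt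
  have hlim : Tendsto (fun y => ‖Φ y‖) (nhdsWithin z {z}ᶜ) (nhds ‖Φ z‖) :=
    (hcont.norm.tendsto).mono_left nhdsWithin_le_nhds
  have hge : 1 ≤ ‖Φ z‖ := by
    by_contra hlt
    push Not at hlt
    obtain ⟨ρ, h1, h2⟩ := exists_between hlt
    obtain ⟨ε, hε, h3⟩ := S.bdry hzD h2
    have e1 : ∀ᶠ y in nhdsWithin z {z}ᶜ, ‖Φ y‖ < ρ := hlim.eventually (gt_mem_nhds h1)
    have e2 : ∀ᶠ y in nhdsWithin z {z}ᶜ, y ∈ ball z (min ε r) :=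
      nhdsWithin_le_nhds (ball_mem_nhds z (by positivity))
    obtain ⟨y, h4, h5, h6⟩ := (e1.and (e2.and self_mem_nhdsWithin)).exists
    have h7 : y ∈ D := hsub ⟨ball_subset_ball (min_le_right _ _) h5, h6⟩
    have := h3 y h7 (ball_subset_ball (min_le_left _ _) h5)
    rw [hΦe y h6] at h4
    linarith
  have hmaxi : IsMaxOn (norm ∘ Φ) (ball z r) z := by
    intro y hy
    by_cases h : y = z
    · simp [h]
    · show ‖Φ y‖ ≤ ‖Φ z‖
      rw [hΦe y h]; exact (hb y ⟨hy, h⟩).le.trans hge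
  have := Complex.norm_eqOn_of_isPreconnected_of_isMaxOn isPreconnected_ball isOpen_ball hext (mem_ball_self hr) hmaxi
  have hw : z + (r/2 : ℝ) ∈ ball z r := by
    rw [mem_ball, dist_eq_norm]; simp [abs_of_pos hr]; linarith
  have hwz : z + (r/2 : ℝ) ≠ z := by simp [hr.ne']
  have h8 := this hw
  simp only [Function.comp, Function.const] at h8
  rw [hΦe _ hwz] at h8
  have := hb _ ⟨hw, hwz⟩
  linarith

/-- If the inverse of the linearizer extends, the Siegel disk is not maximal. -/
theorem siegel_extend {g : ℂ → ℂ} {z₀ lam : ℂ} {D : Set ℂ} {φ ψ : ℂ → ℂ} (S : SD g z₀ lam D φ ψ)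
    (hmax : ∀ D' : Set ℂ, D ⊆ D' → IsSiegelDomain g z₀ lam D' → D' = D)
    {R : ℝ} (hR : 1 < R) {H : ℂ → ℂ} (hH : DifferentiableOn ℂ H (ball 0 R)) (he : EqOn H ψ (ball 0 1)) : False := by
  have hb1 : ball (0:ℂ) 1 ⊆ ball 0 R := ball_subset_ball hR.le
  have hrot : ∀ ζ ∈ ball (0:ℂ) R, ∀ k : ℕ, lam ^ k * ζ ∈ ball (0:ℂ) R := by
    intro ζ hζ k; rw [mem_ball_zero_iff] at *; rwa [norm_mul, S.lam_pow_norm, one_mul]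
  have hconj : ∀ ζ ∈ ball (0:ℂ) R, H (lam * ζ) = g (H ζ) := by
    refine id_thm isOpen_ball isPreconnected_ball (f := fun ζ => H (lam * ζ)) (g := fun ζ => g (H ζ)) ?_ ?_ isOpen_ball hb1 ⟨0, by simp⟩ ?_
    · exact hH.comp (by fun_prop) (fun ζ hζ => by simpa using hrot ζ hζ 1)
    · exact S.g_diff.comp_differentiableOn hH
    · intro ζ hζ
      show H (lam * ζ) = g (H ζ)
      rw [he hζ, ← S.ψ_conj hζ]
      apply he
      rw [mem_ball_zero_iff] at *; rwa [norm_mul, S.lam_norm, one_mul]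
  have hconjk : ∀ ζ ∈ ball (0:ℂ) R, ∀ k : ℕ, H (lam ^ k * ζ) = g^[k] (H ζ) := by
    intro ζ hζ k
    induction k with
    | zero => simp
    | succ k ih => rw [iterate_succ_apply', ← ih, ← hconj _ (hrot ζ hζ k), pow_succ']; ring_nf
  have hinj : InjOn H (ball 0 R) := by
    intro a ha b hb hab
    by_contra hne
    rw [mem_ball_zero_iff] at ha hb
    have hm : 0 < max ‖a‖ ‖b‖ := by
      rcases eq_or_ne a 0 with rfl | h
      · exact lt_max_of_lt_right (norm_pos_iff.mpr (Ne.symm hne))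
      · exact lt_max_of_lt_left (norm_pos_iff.mpr h)
    set m := max ‖a‖ ‖b‖ with hmdef
    have hmR : 1 < R / m := by rw [lt_div_iff₀ hm, one_mul]; exact max_lt ha hb
    have hma : ∀ w ∈ ball (0:ℂ) (R/m), w * a ∈ ball (0:ℂ) R ∧ w * b ∈ ball (0:ℂ) R := by
      intro w hw
      rw [mem_ball_zero_iff, lt_div_iff₀ hm] at hw
      constructor <;> rw [mem_ball_zero_iff, norm_mul]
      · exact (mul_le_mul_of_nonneg_left (le_max_left _ _) (norm_nonneg _)).trans_lt hw
      · exact (mul_le_mul_of_nonneg_left (le_max_right _ _) (norm_nonneg _)).trans_lt hw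
    have hz := zero_of_lam_pow S hmR (h := fun w => H (w * a) - H (w * b))
      ((hH.comp (by fun_prop) (fun w hw => (hma w hw).1)).sub (hH.comp (by fun_prop) (fun w hw => (hma w hw).2)))
      (fun k => by rw [hconjk a (by simpa using ha), hconjk b (by simpa using hb), hab, sub_self])
    set w : ℂ := ((1 / (2 * max m 1) : ℝ) : ℂ) with hw
    have hwn : ‖w‖ = 1 / (2 * max m 1) := by rw [hw, Complex.norm_real, Real.norm_of_nonneg (by positivity)]
    have hw0 : w ≠ 0 := by rw [← norm_pos_iff, hwn]; positivity
    have hwm : ‖w‖ * m < 1 := by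
      rw [hwn, one_div, inv_mul_lt_iff₀ (by positivity)]
      have := le_max_left m 1; linarith
    have h1 := hz w (by rw [mem_ball_zero_iff, lt_div_iff₀ hm]; linarith)
    have hwa : w * a ∈ ball (0:ℂ) 1 := by
      rw [mem_ball_zero_iff, norm_mul]
      exact (mul_le_mul_of_nonneg_left (le_max_left _ _) (norm_nonneg _)).trans_lt hwm
    have hwb : w * b ∈ ball (0:ℂ) 1 := by
      rw [mem_ball_zero_iff, norm_mul]
      exact (mul_le_mul_of_nonneg_left (le_max_right _ _) (norm_nonneg _)).trans_lt hwm
    have h2 := sub_eq_zero.mp h1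
    rw [he hwa, he hwb] at h2
    exact hne (mul_left_cancel₀ hw0 (S.ψ_inj hwa hwb h2))
  have hl : LeftInvOn (invFunOn H (ball 0 R)) H (ball 0 R) := hinj.leftInvOn_invFunOn
  have hR0 : (R:ℂ) ≠ 0 := by exact_mod_cast (by linarith : R ≠ 0)
  have hSD : IsSiegelDomain g z₀ lam (H '' ball 0 R) := by
    have hz0 : H 0 = z₀ := by rw [he (by simp), S.ψ0]
    have h0R : (0:ℂ) ∈ ball (0:ℂ) R := hb1 (by simp)
    refine ⟨isOpen_image_of_inj isOpen_ball hH hinj, (isConnected_ball (by linarith)).image _ hH.continuousOn, ⟨0, h0R, hz0⟩, ?_, fun z => invFunOn H (ball 0 R) z / R, ?_, ?_, ?_, ?_⟩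
    · rintro _ ⟨ζ, hζ, rfl⟩
      exact ⟨lam * ζ, by simpa using hrot ζ hζ 1, hconj ζ hζ⟩
    · exact (inv_holo isOpen_ball hH hinj hl).div_const _
    · refine ⟨?_, ?_, ?_⟩
      · rintro _ ⟨ζ, hζ, rfl⟩
        show invFunOn H (ball 0 R) (H ζ) / R ∈ _
        rw [hl hζ]
        rw [mem_ball_zero_iff] at *
        rw [norm_div, Complex.norm_real, Real.norm_of_nonneg (by linarith), div_lt_one (by linarith)]
        exact hζ
      · rintro _ ⟨ζ, hζ, rfl⟩ _ ⟨ξ, hξ, rfl⟩ h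
        simp only [hl hζ, hl hξ] at h
        rw [div_left_inj' hR0] at h
        rw [h]
      · intro ζ hζ
        have hm : R * ζ ∈ ball (0:ℂ) R := by
          rw [mem_ball_zero_iff] at *
          rw [norm_mul, Complex.norm_real, Real.norm_of_nonneg (by linarith)]
          nlinarith
        refine ⟨H (R * ζ), ⟨_, hm, rfl⟩, ?_⟩
        simp only [hl hm]
        field_simp
    · show invFunOn H (ball 0 R) z₀ / R = 0
      rw [← hz0, hl h0R]; simp
    · rintro _ ⟨ζ, hζ, rfl⟩
      rw [← hconj ζ hζ]
      simp only [hl hζ, hl (show lam * ζ ∈ ball 0 R by simpa using hrot ζ hζ 1)]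
      ring
  have hsub : D ⊆ H '' ball 0 R := by
    intro z hz
    refine ⟨φ z, hb1 (S.φ_maps hz), ?_⟩
    rw [he (S.φ_maps hz), S.ψφ z hz]
  have hEq := hmax _ hsub hSD
  have h1 : (1:ℂ) ∈ ball (0:ℂ) R := by simpa using hR
  have h2 : H 1 ∈ D := by rw [← hEq]; exact ⟨1, h1, rfl⟩
  have h3 : H (φ (H 1)) = H 1 := by rw [he (S.φ_maps h2), S.ψφ _ h2]
  have h4 := hinj (hb1 (S.φ_maps h2)) h1 h3
  have := S.φ_maps h2
  rw [h4] at this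
  simp at this

open Metric Set Function Filter

theorem exists_hat {g : ℂ → ℂ} {z₀ lam : ℂ} {D : Set ℂ} {φ ψ : ℂ → ℂ} (S : SD g z₀ lam D φ ψ)
    {z : ℂ} {δ M : ℝ} (hM : ∀ k : ℕ, ∀ w ∈ ball z δ, ‖g^[k] w‖ ≤ M) :
    ∃ P : ℂ → ℂ, DifferentiableOn ℂ P (D ∪ ball z δ) ∧ ∃ a : ℂ, a ≠ 0 ∧ ∀ y ∈ D, P y = a * φ y := by
  set U := D ∪ ball z δ with hU
  have hUo : IsOpen U := S.isOpen.union isOpen_ball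
  set A : ℕ → ℂ → ℂ := fun K y => (K:ℂ)⁻¹ * ∑ k ∈ Finset.range K, (lam ^ k)⁻¹ * (g^[k] y - z₀) with hA
  have hgk : ∀ k, Differentiable ℂ g^[k] := fun k => S.g_diff.iterate k
  have hAd : ∀ K, Differentiable ℂ (A K) := by
    intro K
    rw [hA]
    refine Differentiable.const_mul ?_ _
    refine Differentiable.fun_sum fun k _ => ?_
    exact ((hgk k).sub_const _).const_mul _
  have hAbd : ∀ K y C, (∀ k, ‖g^[k] y‖ ≤ C) → ‖A K y‖ ≤ C + ‖z₀‖ := by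
    intro K y C hC
    have hC0 : 0 ≤ C := (norm_nonneg _).trans (hC 0)
    simp only [hA]
    rw [norm_mul]
    have h1 : ‖∑ k ∈ Finset.range K, (lam ^ k)⁻¹ * (g^[k] y - z₀)‖ ≤ K * (C + ‖z₀‖) := by
      have := norm_sum_le_of_le (Finset.range K) (f := fun k => (lam ^ k)⁻¹ * (g^[k] y - z₀)) (n := fun _ => C + ‖z₀‖) ?_
      · rw [Finset.sum_const, Finset.card_range, nsmul_eq_mul] at this
        exact this
      · intro k _
        rw [norm_mul, norm_inv, S.lam_pow_norm, inv_one, one_mul]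
        exact (norm_sub_le _ _).trans (by linarith [hC k])
    rcases Nat.eq_zero_or_pos K with rfl | hK
    · simp; positivity
    · have hK' : (0:ℝ) < K := by exact_mod_cast hK
      rw [norm_inv, Complex.norm_natCast, inv_mul_le_iff₀ hK']
      exact h1
  have hDb : ∀ y ∈ D, ∃ r > 0, ∃ C, ball y r ⊆ D ∧ ∀ w ∈ ball y r, ∀ k, ‖g^[k] w‖ ≤ C := by
    intro y hy
    have hφy : ‖φ y‖ < 1 := by simpa using S.φ_maps hy
    obtain ⟨ρ, h1, h2⟩ := exists_between hφy
    have hK : IsCompact (ψ '' closedBall 0 ρ) :=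
      (isCompact_closedBall _ _).image_of_continuousOn
        (S.ψ_diff.continuousOn.mono (closedBall_subset_ball h2))
    obtain ⟨C, hC⟩ := hK.isBounded.exists_norm_le
    have hcont : ContinuousAt φ y := (S.φ_diff.differentiableAt (S.isOpen.mem_nhds hy)).continuousAt
    have h3 : ∀ᶠ w in nhds y, w ∈ D ∧ ‖φ w‖ < ρ :=
      (show ∀ᶠ w in nhds y, w ∈ D from S.isOpen.mem_nhds hy).and (hcont.norm.eventually (gt_mem_nhds h1))
    obtain ⟨r, hr, h4⟩ := Metric.eventually_nhds_iff_ball.mp h3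
    refine ⟨r, hr, C, fun w hw => (h4 w hw).1, fun w hw k => hC _ ⟨lam ^ k * φ w, ?_, ?_⟩⟩
    · simp only [mem_closedBall_zero_iff, norm_mul, S.lam_norm, norm_pow]
      simpa using (h4 w hw).2.le
    · rw [S.ψ_conj_iter (S.φ_maps (h4 w hw).1), S.ψφ w (h4 w hw).1]
  set l : Ultrafilter ℕ := hyperfilter ℕ with hl
  have hLB : LocBdd A l U := by
    intro y hy
    rcases hy with hy | hy
    · obtain ⟨r, hr, C, h1, h2⟩ := hDb y hy
      exact ⟨r, hr, C + ‖z₀‖, h1.trans subset_union_left, Eventually.of_forall fun K w hw => hAbd K w C (h2 w hw)⟩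
    · obtain ⟨r, hr, h1⟩ := Metric.isOpen_iff.mp isOpen_ball y hy
      exact ⟨r, hr, M + ‖z₀‖, h1.trans subset_union_right, Eventually.of_forall fun K w hw => hAbd K w M (fun k => hM k w (h1 hw))⟩
  obtain ⟨P, hP, hlim⟩ := montel_ultra l hUo (fun K => (hAd K).differentiableOn) hLB
  have hll : (l : Filter ℕ) ≤ atTop := by rw [hl]; exact Nat.hyperfilter_le_atTop
  refine ⟨P, hP, ?_⟩
  have hPconj : ∀ y ∈ D, P (g y) = lam * P y := by
    intro y hy
    have t1 := hlim.tendsto_at (show y ∈ U from Or.inl hy)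
    have t2 := hlim.tendsto_at (show g y ∈ U from Or.inl (S.maps hy))
    obtain ⟨r, hr, C, h1, h2⟩ := hDb y hy
    have t3 : Tendsto (fun K => A K (g y) - lam * A K y) l (nhds 0) := by
      have e : ∀ K : ℕ, A K (g y) - lam * A K y = (K:ℂ)⁻¹ * (lam * ((lam ^ K)⁻¹ * (g^[K] y - z₀) - (y - z₀))) := by
        intro K
        simp only [hA]
        have : ∑ k ∈ Finset.range K, (lam ^ k)⁻¹ * (g^[k] (g y) - z₀) - lam * ∑ k ∈ Finset.range K, (lam ^ k)⁻¹ * (g^[k] y - z₀)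
          = lam * ((lam ^ K)⁻¹ * (g^[K] y - z₀) - (y - z₀)) := by
          induction K with
          | zero => simp
          | succ K ih =>
            rw [Finset.sum_range_succ, Finset.sum_range_succ]
            have hl0 := S.lam_ne0
            have e1 : g^[K] (g y) = g^[K+1] y := (iterate_succ_apply g K y).symm
            rw [e1]
            have e2 : lam * (lam ^ (K+1))⁻¹ = (lam ^ K)⁻¹ := by field_simp; rw [pow_succ']
            linear_combination ih - (g^[K+1] y - z₀) * e2
        rw [← this]; ring
      refine Tendsto.mono_left ?_ hll
      rw [tendsto_zero_iff_norm_tendsto_zero]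
      have hb : ∀ K : ℕ, ‖A K (g y) - lam * A K y‖ ≤ (K:ℝ)⁻¹ * (C + ‖z₀‖ + ‖y - z₀‖) := by
        intro K
        rw [e K, norm_mul, norm_mul, S.lam_norm, one_mul, norm_inv, Complex.norm_natCast]
        gcongr
        refine (norm_sub_le _ _).trans ?_
        gcongr
        rw [norm_mul, norm_inv, S.lam_pow_norm, inv_one, one_mul]
        exact (norm_sub_le _ _).trans (by linarith [h2 y (mem_ball_self hr) K])
      refine squeeze_zero (fun _ => norm_nonneg _) hb ?_
      simpa using (tendsto_inv_atTop_nhds_zero_nat (𝕜 := ℝ)).mul_const (C + ‖z₀‖ + ‖y - z₀‖)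
    have := tendsto_nhds_unique (t2.sub (t1.const_mul lam)) t3
    linear_combination this
  have hz0U : z₀ ∈ U := Or.inl S.z0_mem
  have hPd : deriv P z₀ = 1 := by
    have h1 := (hlim.deriv (Eventually.of_forall fun K => (hAd K).differentiableOn) hUo).tendsto_at hz0U
    have h2 : ∀ K : ℕ, 1 ≤ K → deriv (A K) z₀ = 1 := by
      intro K hK
      have hgd : HasDerivAt g lam z₀ := by rw [← S.deriv0]; exact (S.g_diff z₀).hasDerivAt
      have : HasDerivAt (A K) ((K:ℂ)⁻¹ * ∑ k ∈ Finset.range K, (lam ^ k)⁻¹ * lam ^ k) z₀ := by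
        rw [hA]
        refine HasDerivAt.const_mul _ ?_
        refine HasDerivAt.fun_sum fun k _ => ?_
        exact ((HasDerivAt.iterate _ hgd S.g_z0 k).sub_const _).const_mul _
      rw [this.deriv]
      have hK0 : (K:ℂ) ≠ 0 := by exact_mod_cast (by omega : K ≠ 0)
      have : ∀ k ∈ Finset.range K, (lam ^ k)⁻¹ * lam ^ k = 1 := fun k _ => inv_mul_cancel₀ (pow_ne_zero _ S.lam_ne0)
      rw [Finset.sum_congr rfl this]
      simp [hK0]
    have h3 : Tendsto (fun K => deriv (A K) z₀) l (nhds 1) := by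
      refine Tendsto.mono_left ?_ hll
      refine tendsto_const_nhds.congr' ?_
      filter_upwards [eventually_ge_atTop 1] with K hK
      exact (h2 K hK).symm
    exact tendsto_nhds_unique h1 h3
  have hPψ : DifferentiableOn ℂ (fun ζ => P (ψ ζ)) (ball 0 1) :=
    hP.comp S.ψ_diff (fun ζ hζ => Or.inl (S.ψ_maps hζ))
  have hlin := linear_of_conj S hPψ (fun ζ hζ => by
    show P (ψ (lam * ζ)) = lam * P (ψ ζ)
    rw [S.ψ_conj hζ, hPconj _ (S.ψ_maps hζ)])
  have hPφ : ∀ y ∈ D, P y = deriv (fun ζ => P (ψ ζ)) 0 * φ y := by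
    intro y hy
    have := hlin (φ y) (S.φ_maps hy)
    simp only [S.ψφ y hy] at this
    exact this
  refine ⟨_, ?_, hPφ⟩
  intro h0
  have : P =ᶠ[nhds z₀] fun _ => 0 := by
    filter_upwards [S.isOpen.mem_nhds S.z0_mem] with y hy
    rw [hPφ y hy, h0, zero_mul]
  rw [this.deriv_eq] at hPd
  simp at hPd

theorem step6 {g : ℂ → ℂ} {z₀ lam : ℂ} {D : Set ℂ} {φ ψ : ℂ → ℂ} (S : SD g z₀ lam D φ ψ)
    (hmax : ∀ D' : Set ℂ, D ⊆ D' → IsSiegelDomain g z₀ lam D' → D' = D)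
    {z : ℂ} (hz : z ∈ frontier D) {δ M : ℝ} (hδ : 0 < δ) (hM : ∀ k : ℕ, ∀ w ∈ ball z δ, ‖g^[k] w‖ ≤ M) : False := by
  obtain ⟨P, hP, a, ha, hPa⟩ := exists_hat S hM
  have hUo : IsOpen (D ∪ ball z δ) := S.isOpen.union isOpen_ball
  have hPb : DifferentiableOn ℂ P (ball z δ) := hP.mono subset_union_right
  -- find a good boundary point
  have hP' : DifferentiableOn ℂ (deriv P) (ball z δ) := hPb.deriv isOpen_ball
  obtain ⟨y0, hy0b, hy0D⟩ := _root_.mem_closure_iff.mp (frontier_subset_closure hz) _ isOpen_ball (mem_ball_self hδ)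
  have hPd : ∀ y ∈ D, deriv P y ≠ 0 := by
    intro y hy
    have e : P =ᶠ[nhds y] fun w => a * φ w := by
      filter_upwards [S.isOpen.mem_nhds hy] with w hw using hPa w hw
    rw [e.deriv_eq, deriv_const_mul_field]
    exact mul_ne_zero ha (inj_deriv_ne_zero S.isOpen S.φ_diff S.φ_inj hy)
  obtain ⟨z', hz'F, hz'b, hz'd⟩ : ∃ z' ∈ frontier D, z' ∈ ball z δ ∧ deriv P z' ≠ 0 := by
    by_cases h0 : deriv P z = 0
    · have hev : ∀ᶠ w in nhdsWithin z {z}ᶜ, deriv P w ≠ 0 := by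
        by_contra hcon
        have := preconn_const_of_eventually isOpen_ball isPreconnected_ball hP' (mem_ball_self hδ) (by
          rw [h0]; intro h; exact hcon h) y0 hy0b
        exact hPd y0 hy0D (this.trans h0)
      rw [eventually_nhdsWithin_iff, Metric.eventually_nhds_iff_ball] at hev
      obtain ⟨ε, hε, he⟩ := hev
      obtain ⟨y, hy1, hy2, hy3⟩ := frontier_perfect S hz (show 0 < min ε δ by positivity)
      exact ⟨y, hy1, ball_subset_ball (min_le_right _ _) hy3, he y (ball_subset_ball (min_le_left _ _) hy3) hy2⟩
    · exact ⟨z, hz, mem_ball_self hδ, h0⟩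
  have hz'D := S.not_mem_of_frontier hz'F
  have hPan : AnalyticAt ℂ P z' := hPb.analyticAt (isOpen_ball.mem_nhds hz'b)
  obtain ⟨rN, hrN, hinjN⟩ := local_inj hPan hz'd
  have hz'e : z' ∈ ball z' rN := mem_ball_self hrN
  -- local inverse on an open set
  set N := ball z' rN ∩ ball z δ with hN
  have hNo : IsOpen N := isOpen_ball.inter isOpen_ball
  have hNinj : InjOn P N := hinjN.mono inter_subset_left
  have hPN : DifferentiableOn ℂ P N := hPb.mono inter_subset_right
  have hlN : LeftInvOn (invFunOn P N) P N := hNinj.leftInvOn_invFunOn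
  have hΘ := inv_holo hNo hPN hNinj hlN
  have hPNo : IsOpen (P '' N) := isOpen_image_of_inj hNo hPN hNinj
  set ζ0 := P z' / a with hζ0
  have hcontP : ContinuousAt P z' := hPan.continuousAt
  have hcl' : z' ∈ closure D := frontier_subset_closure hz'F
  have hζ0n : ‖ζ0‖ = 1 := by
    have hfr : ∀ ρ < (1:ℝ), ∀ η > 0, ∃ y ∈ D, ‖P y / a - ζ0‖ < η ∧ ρ < ‖P y / a‖ ∧ ‖P y / a‖ < 1 := by
      intro ρ hρ η hη
      obtain ⟨ε, hε, h1⟩ := S.bdry hz'D hρ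
      have h2 : ∀ᶠ y in nhds z', ‖P y / a - ζ0‖ < η := by
        have : ContinuousAt (fun y => ‖P y / a - ζ0‖) z' := ((hcontP.div_const a).sub continuousAt_const).norm
        exact this.eventually (gt_mem_nhds (by simpa [hζ0] using hη))
      obtain ⟨ε2, hε2, h3⟩ := Metric.eventually_nhds_iff_ball.mp h2
      obtain ⟨y, hy, hyD⟩ := _root_.mem_closure_iff.mp hcl' _ isOpen_ball (mem_ball_self (show 0 < min ε ε2 by positivity))
      have e1 : P y / a = φ y := by rw [hPa y hyD]; field_simp
      refine ⟨y, hyD, h3 y (ball_subset_ball (min_le_right _ _) hy), ?_, ?_⟩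
      · rw [e1]; exact h1 y hyD (ball_subset_ball (min_le_left _ _) hy)
      · rw [e1]; simpa using S.φ_maps hyD
    apply le_antisymm
    · refine le_of_forall_pos_le_add fun η hη => ?_
      obtain ⟨y, -, h1, h2, h3⟩ := hfr 0 one_pos η hη
      have := norm_sub_norm_le ζ0 (P y / a)
      rw [norm_sub_rev] at this; linarith
    · refine le_of_forall_pos_le_add fun η hη => ?_
      obtain ⟨y, -, h1, h2, h3⟩ := hfr (1 - η/2) (by linarith) (η/2) (by positivity)
      have := norm_sub_norm_le (P y / a) ζ0
      linarith
  have hmul : Continuous fun ζ : ℂ => a * ζ := by fun_prop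
  have haζ0 : a * ζ0 = P z' := by rw [hζ0]; field_simp
  obtain ⟨δ3, hδ3, hsub3⟩ : ∃ δ3 > 0, ball ζ0 δ3 ⊆ (fun ζ => a * ζ) ⁻¹' (P '' N) := by
    refine Metric.isOpen_iff.mp (hPNo.preimage hmul) ζ0 ?_
    show a * ζ0 ∈ P '' N
    rw [haζ0]; exact ⟨z', ⟨hz'e, hz'b⟩, rfl⟩
  set T : ℂ → ℂ := fun ζ => invFunOn P N (a * ζ) with hT
  have hTd : DifferentiableOn ℂ T (ball ζ0 δ3) := hΘ.comp (by fun_prop) hsub3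
  have hPT : ∀ ζ ∈ ball ζ0 δ3, P (T ζ) = a * ζ := by
    intro ζ hζ
    obtain ⟨y, hy, hye⟩ := hsub3 hζ
    simp only [hT]
    simp only at hye
    rw [← hye, hlN hy]
  have hTψ : EqOn T ψ (ball ζ0 δ3 ∩ ball 0 1) := by
    have hconv : Convex ℝ (ball ζ0 δ3 ∩ ball (0:ℂ) 1) := (convex_ball _ _).inter (convex_ball _ _)
    refine id_thm (isOpen_ball.inter isOpen_ball) hconv.isPreconnected (hTd.mono inter_subset_left)
      (S.ψ_diff.mono inter_subset_right) (O := (ball ζ0 δ3 ∩ ball 0 1) ∩ T ⁻¹' D) ?_ inter_subset_left ?_ ?_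
    · exact (hTd.mono inter_subset_left).continuousOn.isOpen_inter_preimage (isOpen_ball.inter isOpen_ball) S.isOpen
    · have h2 : ∀ᶠ y in nhds z', y ∈ N ∧ P y / a ∈ ball ζ0 δ3 := by
        have : ContinuousAt (fun y => P y / a) z' := hcontP.div_const a
        exact (show ∀ᶠ y in nhds z', y ∈ N from hNo.mem_nhds ⟨hz'e, hz'b⟩).and (this (ball_mem_nhds _ hδ3))
      obtain ⟨ε2, hε2, h3⟩ := Metric.eventually_nhds_iff_ball.mp h2
      obtain ⟨y, hy, hyD⟩ := _root_.mem_closure_iff.mp hcl' _ isOpen_ball (mem_ball_self hε2)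
      have e1 : P y / a = φ y := by rw [hPa y hyD]; field_simp
      have h4 := h3 y hy
      rw [e1] at h4
      refine ⟨φ y, ⟨h4.2, S.φ_maps hyD⟩, ?_⟩
      show invFunOn P N (a * φ y) ∈ D
      rw [← hPa y hyD, hlN h4.1]; exact hyD
    · rintro ζ ⟨⟨h1, h2⟩, h3⟩
      have := hPT ζ h1
      rw [hPa _ h3] at this
      have := mul_left_cancel₀ ha this
      exact (S.ψφ _ h3).symm.trans (by rw [this])
  obtain ⟨R, hR, H, hH, he⟩ := gl_extend one_pos S.ψ_diff (by
    intro ζ hζ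
    rw [mem_sphere_zero_iff_norm] at hζ
    have hζ0ne : ζ0 ≠ 0 := by intro h; rw [h] at hζ0n; simp at hζ0n
    obtain ⟨k, hk⟩ := S.lam_dense (ζ / ζ0) (by rw [norm_div, hζ, hζ0n, div_one]) (δ3/2) (by positivity)
    have hl0 : lam ^ k ≠ 0 := pow_ne_zero _ S.lam_ne0
    have hd : dist ((lam ^ k)⁻¹ * ζ) ζ0 < δ3/2 := by
      have : (lam ^ k)⁻¹ * ζ - ζ0 = -((lam ^ k)⁻¹ * (lam ^ k - ζ / ζ0) * ζ0) := by field_simp; ring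
      rw [dist_eq_norm, this, norm_neg, norm_mul, norm_mul, norm_inv, S.lam_pow_norm, hζ0n]
      simpa using hk
    have hmap : MapsTo (fun w => (lam ^ k)⁻¹ * w) (ball ζ (δ3/2)) (ball ζ0 δ3) := by
      intro w hw
      have : dist ((lam ^ k)⁻¹ * w) ((lam ^ k)⁻¹ * ζ) < δ3/2 := by
        rw [dist_eq_norm, ← mul_sub, norm_mul, norm_inv, S.lam_pow_norm, inv_one, one_mul, ← dist_eq_norm]
        exact hw
      rw [mem_ball]
      have := dist_triangle ((lam ^ k)⁻¹ * w) ((lam ^ k)⁻¹ * ζ) ζ0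
      linarith
    refine ⟨δ3/2, by positivity, fun w => g^[k] (T ((lam ^ k)⁻¹ * w)), ?_, ?_⟩
    · exact (S.g_diff.iterate k).comp_differentiableOn (hTd.comp (by fun_prop) hmap)
    · rintro w ⟨hw1, hw2⟩
      have h1 : (lam ^ k)⁻¹ * w ∈ ball (0:ℂ) 1 := by
        rw [mem_ball_zero_iff] at *
        rwa [norm_mul, norm_inv, S.lam_pow_norm, inv_one, one_mul]
      show g^[k] (T ((lam ^ k)⁻¹ * w)) = ψ w
      rw [hTψ ⟨hmap hw1, h1⟩, ← S.ψ_conj_iter h1, mul_inv_cancel_left₀ hl0])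
  exact siegel_extend S hmax hR hH he

open Metric Set Function Filter

theorem exists_log_ball {h : ℂ → ℂ} {c : ℂ} {r : ℝ} (hh : DifferentiableOn ℂ h (ball c r))
    (h0 : ∀ z ∈ ball c r, h z ≠ 0) :
    ∃ L : ℂ → ℂ, DifferentiableOn ℂ L (ball c r) ∧ ∀ z ∈ ball c r, Complex.exp (L z) = h z := by
  rcases le_or_gt r 0 with hr | hr
  · exact ⟨0, by simp [ball_eq_empty.2 hr], by simp [ball_eq_empty.2 hr]⟩
  have hc : c ∈ ball c r := mem_ball_self hr
  have hd : DifferentiableOn ℂ (fun z => deriv h z / h z) (ball c r) :=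
    (hh.deriv isOpen_ball).div hh h0
  obtain ⟨L, hL0, hL⟩ := (hd.isExactOn_ball).with_val_at c (Complex.log (h c))
  have hLd : DifferentiableOn ℂ L (ball c r) := fun z hz => (hL z hz).differentiableAt.differentiableWithinAt
  refine ⟨L, hLd, ?_⟩
  have key : ∀ z ∈ ball c r, HasDerivAt (fun z => h z * Complex.exp (-L z)) 0 z := by
    intro z hz
    have h1 := (hh.differentiableAt (isOpen_ball.mem_nhds hz)).hasDerivAt
    have h2 := (hL z hz).neg.cexp
    have h3 := h1.mul h2
    have := h0 z hz
    have e : h z * (Complex.exp (-L z) * -(deriv h z / h z)) = - (deriv h z * Complex.exp (-L z)) := by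
      field_simp
    have e2 : deriv h z * Complex.exp ((-L) z) + h z * (Complex.exp ((-L) z) * -(deriv h z / h z)) = 0 := by
      simp only [Pi.neg_apply]; rw [e]; ring
    rw [e2] at h3
    exact h3
  intro z hz
  have hconst : (fun z => h z * Complex.exp (-L z)) z = (fun z => h z * Complex.exp (-L z)) c := by
    apply (isOpen_ball).is_const_of_deriv_eq_zero isPreconnected_ball
      (fun z hz => (key z hz).differentiableAt.differentiableWithinAt)
      (fun z hz => (key z hz).deriv) hz hc
  simp only [hL0, Complex.exp_neg, Complex.exp_log (h0 c hc), mul_inv_cancel₀ (h0 c hc)] at hconst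
  have := Complex.exp_ne_zero (L z)
  field_simp at hconst
  exact hconst.symm

theorem measure_inj_le {A : Set ℝ} (hA : IsCompact A)
    (hinj : ∀ s ∈ A, ∀ t ∈ A, Complex.exp (s * Complex.I) = Complex.exp (t * Complex.I) → s = t) :
    MeasureTheory.volume A ≤ ENNReal.ofReal (2 * Real.pi) := by
  have hF := isAddFundamentalDomain_Ioc (Real.two_pi_pos) 0
  have := hF.measure_le_of_pairwise_disjoint (t := A) (hA.measurableSet.nullMeasurableSet) ?_
  · simpa using this
  · intro a b hab
    apply Disjoint.aedisjoint
    rw [Set.disjoint_left]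
    rintro x ⟨hx1, -⟩ ⟨hx2, -⟩
    apply hab
    obtain ⟨s, hs, hsx⟩ := hx1
    obtain ⟨t, ht, htx⟩ := hx2
    obtain ⟨a, k, rfl⟩ := a
    obtain ⟨b, l, rfl⟩ := b
    simp only [] at hsx htx
    have e1 : k * (2 * Real.pi) + s = x := by rw [← hsx]; simp [AddSubgroup.vadd_def]
    have e2 : l * (2 * Real.pi) + t = x := by rw [← htx]; simp [AddSubgroup.vadd_def]
    have : s = t := by
      apply hinj s hs t ht
      rw [Complex.exp_eq_exp_iff_exists_int]
      refine ⟨l - k, ?_⟩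
      have : (s:ℂ) = t + (l-k) * (2 * Real.pi) := by
        have : s = t + (l-k) * (2 * Real.pi) := by linarith
        rw [this]; push_cast; ring
      rw [this]; push_cast; ring
    subst this
    have : (k:ℝ) * (2 * Real.pi) = l * (2*Real.pi) := by linarith
    simpa using this

/-- half plane Poisson majorant -/
theorem poisson_maj {A : Set ℝ} (hA : IsCompact A)
    (hv : MeasureTheory.volume A ≤ ENNReal.ofReal (2 * Real.pi)) :
    ∃ P : ℂ → ℂ, ∃ δ > 0, DifferentiableOn ℂ P {L | L.re < δ} ∧
      (∀ L : ℂ, L.re ≤ 0 → 0 ≤ (P L).re) ∧ (∀ t ∈ A, 1 ≤ (P (t * Complex.I)).re) ∧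
      (∀ L : ℂ, L.re < 0 → (P L).re * (-L.re) ≤ 7) := by
  have h7 : ENNReal.ofReal (2 * Real.pi) < ENNReal.ofReal 7 := by
    rw [ENNReal.ofReal_lt_ofReal_iff (by norm_num)]
    nlinarith [Real.pi_lt_d2]
  obtain ⟨δ, hδ, hvol⟩ : ∃ δ > 0, MeasureTheory.volume (cthickening δ A) < ENNReal.ofReal 7 := by
    have ht := tendsto_measure_cthickening_of_isClosed (μ := MeasureTheory.volume) (s := A)
      ⟨1, one_pos, (hA.cthickening (r := 1)).measure_lt_top.ne⟩ hA.isClosed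
    have h1 : ∀ᶠ r in nhdsWithin (0:ℝ) (Ioi 0), MeasureTheory.volume (cthickening r A) < ENNReal.ofReal 7 :=
      (ht.mono_left nhdsWithin_le_nhds).eventually_lt_const (hv.trans_lt h7)
    obtain ⟨δ, h2, h3⟩ := (h1.and self_mem_nhdsWithin).exists
    exact ⟨δ, h3, h2⟩
  set U := cthickening δ A with hU
  have hUc : IsCompact U := hA.cthickening
  have hUm : MeasurableSet U := hUc.measurableSet
  have hUf : MeasureTheory.volume U ≠ ⊤ := hUc.measure_lt_top.ne
  have hUr : (MeasureTheory.volume U).toReal ≤ 7 := by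
    apply ENNReal.toReal_le_of_le_ofReal (by norm_num) hvol.le
  have hne : ∀ L : ℂ, L.re < δ → ∀ t : ℝ, ((δ:ℂ) + t * Complex.I - L) ≠ 0 := by
    intro L hL t h
    have := congrArg Complex.re h
    simp at this; linarith
  have hintg : ∀ L : ℂ, L.re < δ → MeasureTheory.IntegrableOn (fun t : ℝ => ((δ:ℂ) + t * Complex.I - L)⁻¹) U := by
    intro L hL
    apply ContinuousOn.integrableOn_compact hUc
    apply ContinuousOn.inv₀ (by fun_prop)
    exact fun t _ => hne L hL t
  have hre : ∀ L : ℂ, L.re < δ → (∫ t in U, ((δ:ℂ) + t * Complex.I - L)⁻¹).re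
      = ∫ t in U, (δ - L.re) / ((δ - L.re)^2 + (t - L.im)^2) := by
    intro L hL
    have := (Complex.reCLM.integral_comp_comm (hintg L hL))
    rw [← Complex.reCLM_apply, ← this]
    congr 1; ext t
    simp [Complex.inv_re, Complex.normSq_apply]; ring_nf
  have hintr : ∀ L : ℂ, L.re < δ → MeasureTheory.IntegrableOn (fun t : ℝ => (δ - L.re) / ((δ - L.re)^2 + (t - L.im)^2)) U := by
    intro L hL
    apply ContinuousOn.integrableOn_compact hUc
    apply ContinuousOn.div (by fun_prop) (by fun_prop)
    intro t _
    have : 0 < δ - L.re := by linarith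
    positivity
  refine ⟨fun L => ∫ t in U, ((δ:ℂ) + t * Complex.I - L)⁻¹, δ, hδ, ?_, ?_, ?_, ?_⟩
  · intro L hL
    set e := (δ - L.re)/2 with he
    have hep : 0 < e := by
      have hL : L.re < δ := hL
      rw [he]; linarith
    have hb : ∀ M ∈ ball L e, ∀ t : ℝ, e ≤ ‖(δ:ℂ) + t * Complex.I - M‖ := by
      intro M hM t
      have h1 := Complex.abs_re_le_norm (M - L)
      have h2 : ‖M - L‖ < e := by simpa [dist_eq_norm] using hM
      have h3 := (abs_lt.1 (h1.trans_lt h2)).2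
      refine le_trans ?_ (Complex.re_le_norm _)
      simp at h3 ⊢
      linarith
    have hsub : ∀ M ∈ ball L e, M.re < δ := by
      intro M hM
      have h1 := Complex.abs_re_le_norm (M - L)
      have h2 : ‖M - L‖ < e := by simpa [dist_eq_norm] using hM
      have h3 := (abs_lt.1 (h1.trans_lt h2)).2
      simp at h3
      linarith
    refine (hasDerivAt_integral_of_dominated_loc_of_deriv_le (μ := MeasureTheory.volume.restrict U)
      (F := fun (L : ℂ) (t : ℝ) => ((δ:ℂ) + t * Complex.I - L)⁻¹)
      (F' := fun (L : ℂ) (t : ℝ) => (((δ:ℂ) + t * Complex.I - L)^2)⁻¹) (s := ball L e) (x₀ := L) (bound := fun _ => (e^2)⁻¹)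
      (ball_mem_nhds L hep) ?_ (hintg L hL) ?_ ?_ ?_ ?_).2.differentiableAt.differentiableWithinAt
    · filter_upwards [ball_mem_nhds L hep] with M hM
      exact (hintg M (hsub M hM)).aestronglyMeasurable
    · apply ContinuousOn.aestronglyMeasurable _ hUm
      apply ContinuousOn.inv₀ (by fun_prop)
      exact fun t _ => pow_ne_zero _ (hne L hL t)
    · refine Eventually.of_forall fun t M hM => ?_
      rw [norm_inv, norm_pow]
      have := hb M hM t
      gcongr
    · rw [MeasureTheory.integrable_const_iff]; right
      exact ⟨by simpa using hUf.lt_top⟩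
    · refine Eventually.of_forall fun t M hM => ?_
      have h1 : HasDerivAt (fun M : ℂ => (δ:ℂ) + t * Complex.I - M) (-1) M := by
        simpa using (hasDerivAt_id M).const_sub ((δ:ℂ) + t * Complex.I)
      have h2 := h1.inv (hne M (hsub M hM) t)
      have h3 : - (-1 : ℂ) / ((δ:ℂ) + t * Complex.I - M)^2 = (((δ:ℂ) + t * Complex.I - M)^2)⁻¹ := by
        simp
      rw [h3] at h2
      exact h2
  · intro L hL
    rw [hre L (by linarith)]
    apply MeasureTheory.integral_nonneg
    intro t
    have : 0 < δ - L.re := by linarith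
    simp only [Pi.zero_apply]; positivity
  · intro t ht
    simp only
    rw [hre _ (by simpa using hδ)]
    have hsub : Icc (t - δ) (t + δ) ⊆ U := by
      rw [← Real.closedBall_eq_Icc]; exact closedBall_subset_cthickening ht δ
    have h1 := hintr (t * Complex.I) (by simpa using hδ)
    have h2 : ∫ x in Icc (t - δ) (t + δ), (1/(2*δ) : ℝ) ≤ ∫ x in Icc (t - δ) (t + δ), (δ - (t * Complex.I).re) / ((δ - (t * Complex.I).re)^2 + (x - (t * Complex.I).im)^2) := by
      apply MeasureTheory.setIntegral_mono_on
      · exact continuousOn_const.integrableOn_compact isCompact_Icc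
      · exact h1.mono_set hsub
      · exact measurableSet_Icc
      · intro x hx
        have hx' : |x - t| ≤ δ := by rw [abs_le]; constructor <;> linarith [hx.1, hx.2]
        have : (x-t)^2 ≤ δ^2 := by rw [← sq_abs]; gcongr
        simp
        rw [inv_eq_one_div, inv_eq_one_div, div_mul_div_comm, div_le_div_iff₀ (by positivity) (by positivity)]
        nlinarith
    have h3 := MeasureTheory.setIntegral_mono_set h1 (s := Icc (t - δ) (t + δ)) ?_ (Eventually.of_forall hsub)
    · refine le_trans ?_ (h2.trans h3)
      simp
      rw [max_eq_left (by positivity)]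
      have : (δ + δ) * (δ⁻¹ * 2⁻¹) = 1 := by field_simp; norm_num
      rw [this]
    · refine Eventually.of_forall fun x => ?_
      simp; positivity
  · intro L hL
    simp only
    rw [hre L (by linarith)]
    have h1 : ∫ t in U, (δ - L.re) / ((δ - L.re)^2 + (t - L.im)^2) ≤ ∫ t in U, (1 / (-L.re)) := by
      apply MeasureTheory.setIntegral_mono (hintr L (by linarith))
      · simp [hUf.lt_top]
      · intro t
        have : 0 < -L.re := by linarith
        have : 0 < δ - L.re := by linarith
        simp only []
        rw [div_le_div_iff₀ (by positivity) (by positivity)]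
        nlinarith [sq_nonneg (t - L.im)]
    have hp : 0 < -L.re := by linarith
    rw [MeasureTheory.setIntegral_const, smul_eq_mul] at h1
    have h4 : MeasureTheory.volume.real U ≤ 7 := hUr
    calc _ ≤ (MeasureTheory.volume.real U * (1 / (-L.re))) * (-L.re) := by gcongr
      _ = MeasureTheory.volume.real U := by
          rw [mul_assoc, one_div, inv_mul_cancel₀ hp.ne', mul_one]
      _ ≤ 7 := h4

theorem lemma_i {Y : ℂ → ℂ} (hY : DifferentiableOn ℂ Y (ball 0 1)) (hinj : InjOn Y (ball 0 1))
    (h0 : ∀ ζ ∈ ball (0:ℂ) 1, Y ζ ≠ 0) {ρ : ℝ} (hρ1 : ρ < 1) {p : ℂ → ℂ} (hp : Differentiable ℂ p)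
    (hp1 : ∀ ζ, ‖ζ‖ ≤ ρ → (p ζ).re ≤ 1) (hp2 : ∀ ζ, ‖ζ‖ = ρ → ‖Y ζ‖ ≤ 1 → (p ζ).re ≤ 0)
    {ζ : ℂ} (hζ : ‖ζ‖ < ρ) (hYζ : ‖Y ζ‖ < 1) : (p ζ).re * (-Real.log ‖Y ζ‖) ≤ 7 := by
  obtain ⟨L, hL, hLe⟩ := exists_log_ball hY h0
  have hsub : closedBall (0:ℂ) ρ ⊆ ball 0 1 := closedBall_subset_ball hρ1
  have hmem : ∀ ζ : ℂ, ‖ζ‖ ≤ ρ → ζ ∈ ball (0:ℂ) 1 := fun ζ h => hsub (by simpa using h)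
  have hLr : ∀ ζ : ℂ, ‖ζ‖ ≤ ρ → (L ζ).re = Real.log ‖Y ζ‖ := by
    intro ζ h; rw [← hLe ζ (hmem ζ h), Complex.norm_exp, Real.log_exp]
  set A : Set ℝ := (fun ζ => (L ζ).im) '' (closedBall 0 ρ ∩ {ζ | ‖Y ζ‖ = 1}) with hA
  have hAc : IsCompact A := by
    have h1 : IsCompact (closedBall (0:ℂ) ρ ∩ {ζ | ‖Y ζ‖ = 1}) := by
      apply (isCompact_closedBall _ _).of_isClosed_subset _ inter_subset_left
      exact (hY.continuousOn.mono hsub).norm.preimage_isClosed_of_isClosed isClosed_closedBall isClosed_singleton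
    apply h1.image_of_continuousOn
    exact Complex.continuous_im.comp_continuousOn (hL.continuousOn.mono (inter_subset_left.trans hsub))
  have hLA : ∀ ζ ∈ closedBall (0:ℂ) ρ ∩ {ζ | ‖Y ζ‖ = 1}, L ζ = ((L ζ).im : ℂ) * Complex.I := by
    rintro ζ ⟨h1, h2⟩
    have : (L ζ).re = 0 := by rw [hLr ζ (by simpa using h1), h2, Real.log_one]
    apply Complex.ext <;> simp [this]
  obtain ⟨P, δ, hδ, hPd, hP0, hP1, hP7⟩ := poisson_maj hAc (measure_inj_le hAc (by
    rintro _ ⟨a, ha, rfl⟩ _ ⟨b, hb, rfl⟩ h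
    simp only at h ⊢
    rw [← hLA a ha, ← hLA b hb, hLe a (hsub ha.1), hLe b (hsub hb.1)] at h
    rw [hinj (hsub ha.1) (hsub hb.1) h]))
  set G : Set ℂ := ball 0 ρ ∩ {ζ | ‖Y ζ‖ < 1} with hG
  have hGo : IsOpen G := by
    have := (hY.continuousOn.mono (ball_subset_ball hρ1.le)).norm.isOpen_inter_preimage (isOpen_ball (x := (0:ℂ)) (ε := ρ)) (isOpen_Iio (a := (1:ℝ)))
    exact this
  have hGcl : closure G ⊆ closedBall 0 ρ ∩ {ζ | ‖Y ζ‖ ≤ 1} := by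
    apply closure_minimal
    · rintro x ⟨h1, h2⟩; exact ⟨ball_subset_closedBall h1, (le_of_lt h2 : ‖Y x‖ ≤ 1)⟩
    · exact (hY.continuousOn.mono hsub).norm.preimage_isClosed_of_isClosed isClosed_closedBall isClosed_Iic
  have hGre : ∀ x ∈ closure G, (L x).re ≤ 0 := by
    intro x hx
    obtain ⟨h1, h2⟩ := hGcl hx
    rw [hLr x (by simpa using h1)]
    exact Real.log_nonpos (norm_nonneg _) h2
  have hWd : DifferentiableOn ℂ (fun ζ => Complex.exp (p ζ - P (L ζ))) (ball 0 1 ∩ L ⁻¹' {L | L.re < δ}) := by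
    apply DifferentiableOn.cexp
    apply hp.differentiableOn.sub
    exact hPd.comp (hL.mono inter_subset_left) (fun x hx => hx.2)
  have hcl2 : closure G ⊆ ball 0 1 ∩ L ⁻¹' {L | L.re < δ} := fun x hx =>
    ⟨hsub (hGcl hx).1, lt_of_le_of_lt (hGre x hx) hδ⟩
  have hmax := Complex.norm_le_of_forall_mem_frontier_norm_le (C := 1) (U := G)
    (isBounded_ball.subset inter_subset_left) (f := fun ζ => Complex.exp (p ζ - P (L ζ)))
    ⟨hWd.mono (subset_closure.trans hcl2), hWd.continuousOn.mono hcl2⟩ (by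
      intro x hx
      have hxc := frontier_subset_closure hx
      obtain ⟨h1, h2⟩ := hGcl hxc
      have hxG : x ∉ G := by rw [hGo.frontier_eq] at hx; exact hx.2
      rw [Complex.norm_exp, Real.exp_le_one_iff, Complex.sub_re]
      have h1' : ‖x‖ ≤ ρ := by simpa using h1
      rcases h1'.lt_or_eq with h3 | h3
      · have h4 : ‖Y x‖ = 1 := by
          apply le_antisymm h2
          by_contra h5
          exact hxG ⟨by simpa using h3, not_le.1 h5⟩
        have h5 : x ∈ closedBall (0:ℂ) ρ ∩ {ζ | ‖Y ζ‖ = 1} := ⟨h1, h4⟩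
        have h6 := hP1 _ ⟨x, h5, rfl⟩
        simp only [] at h6
        rw [← hLA x h5] at h6
        linarith [hp1 x h1']
      · linarith [hp2 x h3 h2, hP0 _ (hGre x hxc)]) (z := ζ) (subset_closure ⟨by simpa using hζ, hYζ⟩)
  rw [Complex.norm_exp, Real.exp_le_one_iff, Complex.sub_re] at hmax
  have hYp : 0 < ‖Y ζ‖ := norm_pos_iff.2 (h0 ζ (hmem ζ hζ.le))
  have hlog := Real.log_neg hYp hYζ
  have h7 := hP7 (L ζ) (by rw [hLr ζ hζ.le]; exact hlog)
  rw [hLr ζ hζ.le] at h7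
  nlinarith

open Metric Set Function Filter

theorem trig_approx (u : ℂ → ℝ) (hu : ContinuousOn u (sphere 0 1)) {η : ℝ} (hη : 0 < η) :
    ∃ p : ℂ → ℂ, Differentiable ℂ p ∧ ∀ ζ : ℂ, ‖ζ‖ = 1 → |(p ζ).re - u ζ| ≤ η := by
  haveI : Fact ((0:ℝ) < 1) := ⟨one_pos⟩
  have hcont : Continuous fun x : AddCircle (1:ℝ) => u (AddCircle.toCircle x : ℂ) := by
    apply hu.comp_continuous
    · exact continuous_subtype_val.comp AddCircle.continuous_toCircle
    · intro x; rw [mem_sphere_zero_iff_norm]; exact Circle.norm_coe _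
  let F : C(AddCircle (1:ℝ), ℂ) := ⟨fun x => (u (AddCircle.toCircle x : ℂ) : ℂ), Complex.continuous_ofReal.comp hcont⟩
  have hF : F ∈ (Submodule.span ℂ (range (@fourier 1))).topologicalClosure := by
    rw [span_fourier_closure_eq_top]; trivial
  obtain ⟨Q, hQ, hd⟩ := Metric.mem_closure_iff.1 hF η hη
  have hp : ∃ p : ℂ → ℂ, Differentiable ℂ p ∧ ∀ x : AddCircle (1:ℝ), (p (AddCircle.toCircle x : ℂ)).re = (Q x).re := by
    clear hd
    have hQ' : Q ∈ Submodule.span ℂ (range (@fourier 1)) := hQ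
    refine Submodule.closure_induction (p := fun Q _ => ∃ p : ℂ → ℂ, Differentiable ℂ p ∧ ∀ x : AddCircle (1:ℝ), (p (AddCircle.toCircle x : ℂ)).re = (Q x).re) ?_ ?_ ?_ hQ'
    · exact ⟨0, differentiable_const 0, by simp⟩
    · rintro a b - - ⟨p, hp, hp'⟩ ⟨q, hq, hq'⟩
      exact ⟨p + q, hp.add hq, fun x => by simp [hp', hq']⟩
    · rintro c _ ⟨k, rfl⟩
      rcases Int.eq_nat_or_neg k with ⟨n, rfl | rfl⟩
      · refine ⟨fun z => c * z ^ n, by fun_prop, fun x => ?_⟩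
        simp [fourier_apply, AddCircle.toCircle_nsmul]
      · refine ⟨fun z => (starRingEnd ℂ c) * z ^ n, by fun_prop, fun x => ?_⟩
        have : (fourier (-(n:ℤ)) x : ℂ) = (starRingEnd ℂ) ((AddCircle.toCircle x : ℂ) ^ n) := by
          rw [fourier_neg, fourier_apply]; simp [AddCircle.toCircle_nsmul]
        rw [ContinuousMap.smul_apply, this, smul_eq_mul]
        rw [← Complex.conj_re (c * _), map_mul, Complex.conj_conj]
  obtain ⟨p, hp, hpQ⟩ := hp
  refine ⟨p, hp, fun ζ hζ => ?_⟩
  obtain ⟨x, hx⟩ : ∃ x : AddCircle (1:ℝ), (AddCircle.toCircle x : ℂ) = ζ := by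
    obtain ⟨x, hx⟩ := (AddCircle.homeomorphCircle (T := (1:ℝ)) one_ne_zero).surjective ⟨ζ, by simpa [Submonoid.unitSphere] using hζ⟩
    refine ⟨x, ?_⟩
    rw [AddCircle.homeomorphCircle_apply] at hx
    rw [hx]
  rw [← hx, hpQ]
  have h1 := (ContinuousMap.dist_apply_le_dist (f := F) (g := Q) x).trans hd.le
  rw [dist_comm, dist_eq_norm] at h1
  have h2 := (Complex.abs_re_le_norm _).trans h1
  simpa [F] using h2

theorem transit {g : ℂ → ℂ} {z₀ lam : ℂ} {D : Set ℂ} {φ ψ : ℂ → ℂ} (S : SD g z₀ lam D φ ψ)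
    {K : Set ℂ} (hK : IsClosed K) (hgK : MapsTo g K K) {z : ℂ} (hz : z ∈ frontier D) {r : ℝ} (hr : 0 < r)
    (hsub : closedBall z r ∩ frontier D ⊆ K) : frontier D ⊆ K := by
  intro w hw
  by_contra hwK
  obtain ⟨rw', hrw0, hrw1⟩ := Metric.isOpen_iff.1 hK.isOpen_compl w hwK
  set t := rw' / 2 with ht
  have ht0 : 0 < t := by positivity
  have htK : ∀ y, ‖y - w‖ ≤ t → y ∉ K := by
    intro y hy
    apply hrw1
    rw [mem_ball, dist_eq_norm]; linarith
  have hzD := S.not_mem_of_frontier hz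
  have hwD := S.not_mem_of_frontier hw
  -- finding points
  have find : ∀ v ∈ frontier D, ∀ s : ℝ, s > 0 → ∀ ρ < 1, ∃ ζ ∈ ball (0:ℂ) 1, ρ < ‖ζ‖ ∧ ‖(ψ ζ - v) / (s:ℂ)‖ < Real.exp (-28) := by
    intro v hv s hs ρ hρ
    obtain ⟨ε, hε, hb⟩ := S.bdry (S.not_mem_of_frontier hv) hρ
    have hv' : v ∈ closure D := frontier_subset_closure hv
    obtain ⟨y, hyD, hy⟩ := Metric.mem_closure_iff.1 hv' (min ε (s * Real.exp (-28))) (by positivity)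
    refine ⟨φ y, S.φ_maps hyD, hb y hyD ?_, ?_⟩
    · rw [mem_ball, dist_comm]; exact hy.trans_le (min_le_left _ _)
    · rw [S.ψφ y hyD, norm_div, div_lt_iff₀ (by simpa using hs.ne')]
      rw [dist_comm, dist_eq_norm] at hy
      have := hy.trans_le (min_le_right _ _)
      simp [abs_of_pos hs]; linarith
  obtain ⟨ζ₁, hζ₁, -, hY₁⟩ := find w hw (t/2) (by positivity) 0 one_pos
  obtain ⟨ζ₂, hζ₂, h12, hY₂⟩ := find z hz r hr ‖ζ₁‖ (by simpa using hζ₁)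
  have hζ₂n : ‖ζ₂‖ < 1 := by simpa using hζ₂
  have Ydiff : ∀ v s : ℂ, DifferentiableOn ℂ (fun ζ => (ψ ζ - v) / s) (ball 0 1) := fun v s =>
    (S.ψ_diff.sub_const v).div_const s
  have Yinj : ∀ v s : ℂ, s ≠ 0 → InjOn (fun ζ => (ψ ζ - v) / s) (ball 0 1) := by
    intro v s hs a ha b hb h
    simp only at h
    apply S.ψ_inj ha hb
    field_simp at h
    simpa using h
  have Yne : ∀ v s : ℂ, s ≠ 0 → v ∉ D → ∀ ζ ∈ ball (0:ℂ) 1, (ψ ζ - v) / s ≠ 0 := by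
    intro v s hs hv ζ hζ h
    rw [div_eq_zero_iff] at h
    rcases h with h | h
    · rw [sub_eq_zero] at h; exact hv (h ▸ S.ψ_maps hζ)
    · exact hs h
  have hQ : ∀ m : ℕ, ∃ ρ < 1, ∀ ζ ∈ ball (0:ℂ) 1, ρ < ‖ζ‖ → ‖ψ ζ - z‖ ≤ r → t < ‖ψ (lam ^ m * ζ) - w‖ := by
    intro m
    set T := {y | y ∈ closure D ∧ ‖y - z‖ ≤ r ∧ ‖g^[m] y - w‖ ≤ t} with hT
    have hgc : Continuous g^[m] := S.g_diff.continuous.iterate m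
    have hTc : IsCompact T := by
      apply (isCompact_closedBall z r).of_isClosed_subset
      · apply isClosed_closure.inter
        exact (isClosed_le (f := fun y => ‖y - z‖) (by fun_prop) continuous_const).inter (isClosed_le (f := fun y => ‖g^[m] y - w‖) (by fun_prop) continuous_const)
      · rintro y ⟨-, h, -⟩; simpa [dist_eq_norm] using h
    have hTD : T ⊆ D := by
      rintro y ⟨h1, h2, h3⟩
      by_contra hy
      have hyf : y ∈ frontier D := by rw [S.isOpen.frontier_eq]; exact ⟨h1, hy⟩
      have hyK : y ∈ K := hsub ⟨by simpa [dist_eq_norm] using h2, hyf⟩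
      exact htK _ h3 ((hgK.iterate m) hyK)
    have hmem : ∀ ζ ∈ ball (0:ℂ) 1, ‖ψ ζ - z‖ ≤ r → ‖ψ (lam ^ m * ζ) - w‖ ≤ t → ψ ζ ∈ T := by
      intro ζ hζ h1 h2
      refine ⟨subset_closure (S.ψ_maps hζ), h1, ?_⟩
      rw [← S.ψ_conj_iter]; exact h2; exact hζ
    rcases T.eq_empty_or_nonempty with hTe | hTn
    · refine ⟨0, one_pos, fun ζ hζ _ h1 => ?_⟩
      by_contra h2
      have := hmem ζ hζ h1 (not_lt.1 h2)
      rw [hTe] at this; exact this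
    · obtain ⟨y, hy, hymax⟩ := hTc.exists_isMaxOn hTn ((S.φ_diff.continuousOn.mono hTD).norm)
      refine ⟨‖φ y‖, by simpa using S.φ_maps (hTD hy), fun ζ hζ h h1 => ?_⟩
      by_contra h2
      have := hymax (hmem ζ hζ h1 (not_lt.1 h2))
      simp only [mem_setOf_eq] at this
      rw [S.φψ ζ hζ] at this
      linarith
  choose ρm hρm1 hρm using hQ
  -- equidistribution
  set σ : ℝ := (1 - ‖ζ₂‖)/2 * (1/100) with hσ
  have hσ0 : 0 < σ := by rw [hσ]; have : 0 < 1 - ‖ζ₂‖ := by linarith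
                         positivity
  obtain ⟨s, hs⟩ : ∃ s : Finset ℕ, ∀ u : ℂ, ‖u‖ = 1 → ∃ m ∈ s, ‖lam ^ m - u‖ < σ := by
    obtain ⟨s, hs⟩ := (isCompact_sphere (0:ℂ) 1).elim_finite_subcover (fun m : ℕ => ball (lam ^ m) σ)
      (fun _ => isOpen_ball) (by
        intro u hu
        obtain ⟨k, hk⟩ := S.lam_dense u (by simpa using hu) σ hσ0
        rw [mem_iUnion]; exact ⟨k, by rwa [mem_ball, dist_comm, dist_eq_norm]⟩)
    refine ⟨s, fun u hu => ?_⟩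
    have := hs (show u ∈ sphere (0:ℂ) 1 by simpa using hu)
    simp only [mem_iUnion] at this
    obtain ⟨m, hm, h⟩ := this
    exact ⟨m, hm, by rwa [mem_ball, dist_comm, dist_eq_norm] at h⟩
  obtain ⟨ρ, hρ1, hρ2, hρs⟩ : ∃ ρ < 1, (1 + ‖ζ₂‖)/2 < ρ ∧ ∀ m ∈ s, ρm m < ρ := by
    have h1 : ∀ᶠ ρ in nhdsWithin (1:ℝ) (Iio 1), ∀ m ∈ s, ρm m < ρ := by
      rw [eventually_all_finset]
      intro m _
      exact (eventually_gt_nhds (hρm1 m)).filter_mono nhdsWithin_le_nhds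
    have h2 : ∀ᶠ ρ in nhdsWithin (1:ℝ) (Iio 1), (1 + ‖ζ₂‖)/2 < ρ :=
      (eventually_gt_nhds (by linarith)).filter_mono nhdsWithin_le_nhds
    obtain ⟨ρ, ha, hb, hc⟩ := (h1.and (h2.and self_mem_nhdsWithin)).exists
    exact ⟨ρ, hc, hb, ha⟩
  have hρ0 : 0 < ρ := by linarith [norm_nonneg ζ₂]
  have h2ρ : ‖ζ₂‖ < ρ := by linarith
  have hmemρ : ∀ ζ : ℂ, ‖ζ‖ ≤ ρ → ζ ∈ ball (0:ℂ) 1 := fun ζ h => by simpa using h.trans_lt hρ1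
  -- boundary function
  let q : ℂ → ℝ := fun y => max 0 (min 1 (2 - 2 * ‖y - w‖ / t))
  have hqc : Continuous q := by fun_prop
  have hq0 : ∀ y, 0 ≤ q y := fun y => le_max_left _ _
  have hq1 : ∀ y, q y ≤ 1 := fun y => max_le zero_le_one (min_le_left _ _)
  have hqin : ∀ y, ‖y - w‖ ≤ t/2 → q y = 1 := by
    intro y hy
    have : 1 ≤ 2 - 2 * ‖y - w‖ / t := by
      have : 2 * ‖y - w‖ / t ≤ 1 := by rw [div_le_one ht0]; linarith
      linarith
    simp [q, min_eq_left this]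
  have hqout : ∀ y, t ≤ ‖y - w‖ → q y = 0 := by
    intro y hy
    have : 2 - 2 * ‖y - w‖ / t ≤ 0 := by
      have : 2 ≤ 2 * ‖y - w‖ / t := by rw [le_div_iff₀ ht0]; linarith
      linarith
    apply max_eq_left
    exact (min_le_right _ _).trans this
  obtain ⟨p₀, hp₀, hp₀q⟩ := trig_approx (fun ζ => q (ψ (ρ * ζ))) (by
    apply hqc.comp_continuousOn
    apply S.ψ_diff.continuousOn.comp (by fun_prop)
    intro ζ hζ
    apply hmemρ
    have : ‖ζ‖ = 1 := by simpa using hζ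
    simp [this, abs_of_pos hρ0]) (η := 1/100) (by norm_num)
  set p : ℂ → ℂ := fun ζ => p₀ (ζ / ρ) with hp
  have hpd : Differentiable ℂ p := hp₀.comp (by fun_prop)
  have hpq : ∀ ζ : ℂ, ‖ζ‖ = ρ → |(p ζ).re - q (ψ ζ)| ≤ 1/100 := by
    intro ζ hζ
    have h1 := hp₀q (ζ / ρ) (by simp [hζ, abs_of_pos hρ0, hρ0.ne'])
    have : (ρ:ℂ) * (ζ / ρ) = ζ := by
      have : (ρ:ℂ) ≠ 0 := by exact_mod_cast hρ0.ne'
      field_simp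
    simpa [this] using h1
  have maxp : ∀ (P : ℂ → ℂ), Differentiable ℂ P → ∀ C R : ℝ, (∀ ζ : ℂ, ‖ζ‖ = R → (P ζ).re ≤ C) → 0 < R →
      ∀ ζ : ℂ, ‖ζ‖ ≤ R → (P ζ).re ≤ C := by
    intro P hP C R h hR ζ hζ
    have := Complex.norm_le_of_forall_mem_frontier_norm_le (C := Real.exp C) (U := ball 0 R) isBounded_ball
      (f := fun ζ => Complex.exp (P ζ)) (hP.cexp.diffContOnCl) (by
        intro x hx
        rw [frontier_ball _ hR.ne'] at hx
        rw [Complex.norm_exp, Real.exp_le_exp]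
        exact h x (by simpa using hx)) (z := ζ) (by rw [closure_ball _ hR.ne']; simpa using hζ)
    rwa [Complex.norm_exp, Real.exp_le_exp] at this
  have hub : ∀ ζ : ℂ, ‖ζ‖ ≤ ρ → (p ζ).re ≤ 1 + 1/100 := by
    apply maxp p hpd _ _ _ hρ0
    intro ζ hζ
    linarith [(abs_le.1 (hpq ζ hζ)).2, hq1 (ψ ζ)]
  have hlb : ∀ ζ : ℂ, ‖ζ‖ ≤ ρ → -(p ζ).re ≤ 1/100 := by
    have := maxp (fun ζ => - p ζ) hpd.neg (1/100) ρ (by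
      intro ζ hζ
      rw [Complex.neg_re]
      linarith [(abs_le.1 (hpq ζ hζ)).1, hq0 (ψ ζ)]) hρ0
    simpa using this
  have hlog : ∀ x : ℝ, 0 < x → x < Real.exp (-28) → 28 ≤ - Real.log x := by
    intro x hx h
    have := Real.log_lt_log hx h
    rw [Real.log_exp] at this; linarith
  have hexp1 : Real.exp (-28) ≤ 1 := by rw [Real.exp_le_one_iff]; norm_num
  -- at w
  have htc : ((t/2 : ℝ) : ℂ) ≠ 0 := by exact_mod_cast (half_pos ht0).ne'
  have hrc : (r : ℂ) ≠ 0 := by exact_mod_cast hr.ne'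
  have h1 : 3/4 - 1/100 ≤ (p ζ₁).re := by
    have := lemma_i (Ydiff w ((t/2:ℝ):ℂ)) (Yinj _ _ htc) (Yne _ _ htc hwD) hρ1 (p := fun ζ => 1 - 1/100 - p ζ)
      (by fun_prop) (by
        intro ζ hζ
        have := hlb ζ hζ
        norm_num at this ⊢; linarith) (by
        intro ζ hζ hY
        rw [norm_div, div_le_one (by rw [norm_pos_iff]; exact htc)] at hY
        rw [Complex.norm_real, Real.norm_of_nonneg (by positivity)] at hY
        have h3 := (abs_le.1 (hpq ζ hζ)).1
        rw [hqin _ hY] at h3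
        norm_num at h3 ⊢; linarith) (ζ := ζ₁) (by linarith) (hY₁.trans_le hexp1)
    have hpos : 0 < ‖(ψ ζ₁ - w) / ((t/2:ℝ):ℂ)‖ := norm_pos_iff.2 (Yne _ _ htc hwD _ hζ₁)
    have h28 := hlog _ hpos hY₁
    by_contra hcon
    push Not at hcon
    have h5 : 1/4 < (1 - 1/100 - p ζ₁ : ℂ).re := by norm_num at hcon ⊢; linarith
    nlinarith
  have h2 : ∀ m ∈ s, (p (lam ^ m * ζ₂)).re ≤ 1/4 + 1/100 := by
    intro m hm
    have hn : ∀ ζ : ℂ, ‖lam ^ m * ζ‖ = ‖ζ‖ := fun ζ => by rw [norm_mul, S.lam_pow_norm, one_mul]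
    have := lemma_i (Ydiff z r) (Yinj _ _ hrc) (Yne _ _ hrc hzD) hρ1 (p := fun ζ => p (lam ^ m * ζ) - 1/100)
      (by fun_prop) (by
        intro ζ hζ
        have := hub (lam ^ m * ζ) (by rw [hn]; exact hζ)
        norm_num at this ⊢; linarith) (by
        intro ζ hζ hY
        rw [norm_div, div_le_one (by rw [norm_pos_iff]; exact hrc)] at hY
        rw [Complex.norm_real, Real.norm_of_nonneg hr.le] at hY
        have h3 := (abs_le.1 (hpq (lam ^ m * ζ) (by rw [hn]; exact hζ))).2
        rw [hqout _ (hρm m ζ (hmemρ ζ hζ.le) (by rw [hζ]; exact hρs m hm) hY).le] at h3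
        norm_num at h3 ⊢; linarith) (ζ := ζ₂) h2ρ (hY₂.trans_le hexp1)
    have hpos : 0 < ‖(ψ ζ₂ - z) / (r:ℂ)‖ := norm_pos_iff.2 (Yne _ _ hrc hzD _ hζ₂)
    have h28 := hlog _ hpos hY₂
    by_contra hcon
    push Not at hcon
    have h5 : 1/4 < (p (lam ^ m * ζ₂) - 1/100 : ℂ).re := by norm_num at hcon ⊢; linarith
    nlinarith
  -- all of circle
  have hexpb : Real.exp (1 + 1/100) ≤ 3 := by
    have := Real.exp_one_lt_d9
    have h3 : Real.exp (1/100) ≤ 1.02 := by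
      have := Real.exp_bound_div_one_sub_of_interval (x := 1/100) (by norm_num) (by norm_num)
      norm_num at this ⊢; linarith
    rw [Real.exp_add]
    nlinarith [Real.exp_pos 1, Real.exp_pos (1/100)]
  have h3 : ∀ ζ : ℂ, ‖ζ‖ = ‖ζ₂‖ → (p ζ).re ≤ 1/2 := by
    intro ζ hζ
    have hζ₂0 : ζ₂ ≠ 0 := by
      rw [← norm_pos_iff]; exact (norm_nonneg _).trans_lt h12
    obtain ⟨m, hm, hmu⟩ := hs (ζ / ζ₂) (by rw [norm_div, hζ, div_self (norm_ne_zero_iff.2 hζ₂0)])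
    set a := lam ^ m * ζ₂ with ha
    have han : ‖a‖ = ‖ζ₂‖ := by rw [ha, norm_mul, S.lam_pow_norm, one_mul]
    have hda : ‖ζ - a‖ ≤ σ := by
      have : ζ - a = -(lam ^ m - ζ / ζ₂) * ζ₂ := by rw [ha]; field_simp; ring
      rw [this, norm_mul, norm_neg]
      nlinarith [norm_nonneg ζ₂, norm_nonneg (lam ^ m - ζ / ζ₂)]
    set R := (1 - ‖ζ₂‖)/2 with hR
    have hR0 : 0 < R := by rw [hR]; linarith
    have hballs : ∀ x ∈ ball a R, ‖x‖ ≤ ρ := by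
      intro x hx
      rw [mem_ball, dist_eq_norm] at hx
      have := norm_le_norm_add_norm_sub a x
      rw [norm_sub_rev] at this
      linarith
    have hmaps : MapsTo (fun ζ => Complex.exp (p ζ)) (ball a R) (closedBall (Complex.exp (p a)) 6) := by
      intro x hx
      rw [mem_closedBall, dist_eq_norm]
      have e1 : ‖Complex.exp (p x)‖ ≤ 3 := by
        rw [Complex.norm_exp]; exact (Real.exp_le_exp.2 (hub x (hballs x hx))).trans hexpb
      have e2 : ‖Complex.exp (p a)‖ ≤ 3 := by
        rw [Complex.norm_exp]; exact (Real.exp_le_exp.2 (hub a (by linarith))).trans hexpb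
      linarith [norm_sub_le (Complex.exp (p x)) (Complex.exp (p a))]
    have hσR : σ < R := by rw [hσ]; linarith
    have hsch := Complex.dist_le_div_mul_dist_of_mapsTo_ball (hpd.cexp.differentiableOn) hmaps (z := ζ)
      (by rw [mem_ball, dist_eq_norm]; linarith)
    rw [dist_eq_norm, dist_eq_norm] at hsch
    have h6 : 6 / R * ‖ζ - a‖ ≤ 6/100 := by
      calc 6 / R * ‖ζ - a‖ ≤ 6 / R * σ := by gcongr
        _ = 6/100 := by rw [hσ]; field_simp
    have h7 := norm_le_norm_add_norm_sub (Complex.exp (p a)) (Complex.exp (p ζ))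
    rw [norm_sub_rev] at h7
    rw [Complex.norm_exp, Complex.norm_exp] at h7
    have h8 := Real.exp_le_exp.2 (h2 m hm)
    rw [← Real.exp_le_exp]
    have e3 : Real.exp (1/2) = Real.exp (1/4+1/100) * Real.exp (24/100) := by
      rw [← Real.exp_add]; norm_num
    have e4 := Real.add_one_le_exp (24/100 : ℝ)
    have e5 := Real.add_one_le_exp (1/4+1/100 : ℝ)
    rw [e3]
    nlinarith
  have h4 := maxp p hpd (1/2) ‖ζ₂‖ h3 ((norm_nonneg _).trans_lt h12) ζ₁ h12.le
  linarith

open Metric Set Function Filter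

noncomputable def db (χ : ℂ → ℂ) (ζ : ℂ) : ℂ := fderiv ℝ χ ζ 1 + Complex.I * fderiv ℝ χ ζ Complex.I

theorem cont_mul_supp {c h : ℂ → ℂ} {V : Set ℂ} (hc : Continuous c) (hV : IsOpen V) (hs : tsupport c ⊆ V)
    (hh : ContinuousOn h V) : Continuous fun ζ => c ζ * h ζ := by
  rw [continuous_iff_continuousAt]
  intro ζ
  by_cases hζ : ζ ∈ V
  · exact hc.continuousAt.mul (hh.continuousAt (hV.mem_nhds hζ))
  · have h1 : ζ ∉ tsupport c := fun h => hζ (hs h)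
    have h2 : (fun ζ => c ζ * h ζ) =ᶠ[nhds ζ] fun _ => 0 := by
      filter_upwards [notMem_tsupport_iff_eventuallyEq.mp h1] with x hx
      simp [hx]
    exact continuousAt_const.congr h2.symm

theorem tsupport_db (χ : ℂ → ℂ) : tsupport (db χ) ⊆ tsupport χ := by
  refine closure_minimal ?_ (isClosed_tsupport _)
  intro x hx
  by_contra h
  have h1 := notMem_tsupport_iff_eventuallyEq.mp h
  have : fderiv ℝ χ x = 0 := by
    rw [h1.fderiv_eq]; simp
  exact hx (by simp [db, this])

theorem cont_db {χ : ℂ → ℂ} (hχ : ContDiff ℝ 1 χ) : Continuous (db χ) := by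
  have := hχ.continuous_fderiv one_ne_zero
  unfold db
  fun_prop

theorem dbar_zero {χ h : ℂ → ℂ} {V : Set ℂ} (hχ : ContDiff ℝ 1 χ) (hc : HasCompactSupport χ)
    (hV : IsOpen V) (hs : tsupport χ ⊆ V) (hh : DifferentiableOn ℂ h V) :
    ∫ ζ, db χ ζ * h ζ = 0 := by
  have hfd := hχ.continuous_fderiv one_ne_zero
  have hd : ∀ v : ℂ, Continuous fun ζ => fderiv ℝ χ ζ v := fun v => by fun_prop
  have hts : ∀ v : ℂ, tsupport (fun ζ => fderiv ℝ χ ζ v) ⊆ tsupport χ := fun v =>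
    tsupport_fderiv_apply_subset ℝ v
  have hintg : ∀ c k : ℂ → ℂ, Continuous c → tsupport c ⊆ tsupport χ → ContinuousOn k V →
      MeasureTheory.Integrable fun ζ => c ζ * k ζ := by
    intro c k h1 h2 h3
    refine (cont_mul_supp h1 hV (h2.trans hs) h3).integrable_of_hasCompactSupport ?_
    refine HasCompactSupport.mul_right ?_
    exact HasCompactSupport.of_support_subset_isCompact hc ((subset_tsupport c).trans h2)
  have hh' : ContinuousOn (deriv h) V := (hh.deriv hV).continuousOn
  have hfe : ∀ x ∈ V, ∀ v, fderiv ℝ h x v = deriv h x * v := by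
    intro x hx v
    have h1 := (hh.differentiableAt (hV.mem_nhds hx)).hasDerivAt.hasFDerivAt.restrictScalars ℝ
    rw [h1.fderiv]; simp [mul_comm]
  have hfe' : ∀ v, (fun x => χ x * fderiv ℝ h x v) = fun x => χ x * (deriv h x * v) := by
    intro v; ext x
    by_cases hx : x ∈ V
    · rw [hfe x hx]
    · have : χ x = 0 := by
        by_contra h'; exact hx (hs (subset_tsupport _ h'))
      simp [this]
  have key : ∀ v : ℂ, (∫ x, χ x * deriv h x) * v = - ∫ x, fderiv ℝ χ x v * h x := by
    intro v
    rw [← integral_mul_fderiv_eq_neg_fderiv_mul_of_integrable (g := h) (f := χ) (v := v)]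
    · rw [hfe', ← MeasureTheory.integral_mul_const]
      congr 1; ext x; ring
    · exact hintg _ _ (hd v) (hts v) hh.continuousOn
    · rw [hfe']
      exact hintg _ _ hχ.continuous le_rfl (hh'.mul continuousOn_const)
    · exact hintg _ _ hχ.continuous le_rfl hh.continuousOn
    · exact fun x _ => hχ.differentiable one_ne_zero x
    · exact fun x hx => (hh.differentiableAt (hV.mem_nhds (hs hx))).restrictScalars ℝ
  have k1 := key 1
  have k2 := key Complex.I
  have : (fun ζ => db χ ζ * h ζ) = fun ζ => fderiv ℝ χ ζ 1 * h ζ + Complex.I * (fderiv ℝ χ ζ Complex.I * h ζ) := by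
    ext ζ; unfold db; ring
  rw [this, MeasureTheory.integral_add (hintg _ _ (hd 1) (hts 1) hh.continuousOn)
    ((hintg _ _ (hd _) (hts _) hh.continuousOn).const_mul _), MeasureTheory.integral_const_mul]
  linear_combination k1 + Complex.I * k2 - (∫ x, χ x * deriv h x) * Complex.I_mul_I

/-- the universal constant. -/
theorem exists_J : ∃ J : ℂ, J ≠ 0 ∧ ∀ χ : ℂ → ℂ, ContDiff ℝ 1 χ → HasCompactSupport χ →
    ∀ y : ℂ, (∀ᶠ ζ in nhds y, χ ζ = 1) → ∫ ζ, db χ ζ * (ζ - y)⁻¹ = J := by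
  let s : ℝ → ℝ := fun t => Real.smoothTransition (2 - t)
  have hsd : ContDiff ℝ 1 s := by
    exact (Real.smoothTransition.contDiff (n := 1)).comp (contDiff_const.sub contDiff_id)
  let θ : ℂ → ℂ := fun ζ => ((s (‖ζ‖^2) : ℝ) : ℂ)
  have hθd : ContDiff ℝ 1 θ := Complex.ofRealCLM.contDiff.comp (hsd.comp (contDiff_norm_sq ℝ))
  have hθs : ∀ ζ, ζ ∉ closedBall (0:ℂ) 2 → θ ζ = 0 := by
    intro ζ hζ
    rw [mem_closedBall_zero_iff, not_le] at hζ
    simp only [θ, s]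
    rw [Real.smoothTransition.zero_of_nonpos (by nlinarith)]; simp
  have hθc : HasCompactSupport θ := HasCompactSupport.intro (isCompact_closedBall _ _) hθs
  have hθ1 : ∀ ζ ∈ ball (0:ℂ) 1, θ ζ = 1 := by
    intro ζ hζ
    rw [mem_ball_zero_iff] at hζ
    simp only [θ, s]
    rw [Real.smoothTransition.one_of_one_le (by nlinarith [norm_nonneg ζ])]; simp
  have hdb : ∀ ζ, ζ ≠ 0 → db θ ζ * (ζ - 0)⁻¹ = ((2 * deriv s (‖ζ‖^2) : ℝ) : ℂ) := by
    intro ζ hζ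
    have h1 : HasFDerivAt θ (Complex.ofRealCLM.comp ((deriv s (‖ζ‖^2)) • (2 • innerSL ℝ ζ))) ζ := by
      have h2 := (hasStrictFDerivAt_norm_sq ζ).hasFDerivAt
      have h3 : HasDerivAt s (deriv s (‖ζ‖^2)) (‖ζ‖^2) := (hsd.differentiable one_ne_zero _).hasDerivAt
      have h4 : HasFDerivAt (s ∘ fun x : ℂ => ‖x‖^2) ((deriv s (‖ζ‖^2)) • (2 • innerSL ℝ ζ)) ζ := h3.comp_hasFDerivAt ζ h2
      exact HasFDerivAt.comp (g := Complex.ofRealCLM) ζ Complex.ofRealCLM.hasFDerivAt h4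
    unfold db
    rw [h1.fderiv]
    simp only [sub_zero]
    rw [← div_eq_mul_inv, div_eq_iff hζ]
    apply Complex.ext <;> simp [Complex.inner] <;> ring
  refine ⟨∫ ζ, db θ ζ * (ζ - 0)⁻¹, ?_, ?_⟩
  · have h1 : ∫ ζ, db θ ζ * (ζ - 0)⁻¹ = ∫ ζ : ℂ, ((2 * deriv s (‖ζ‖^2) : ℝ) : ℂ) := by
      refine MeasureTheory.integral_congr_ae ?_
      have : ∀ᵐ ζ : ℂ, ζ ≠ 0 := by
        rw [MeasureTheory.ae_iff]; simp
      filter_upwards [this] with ζ hζ using hdb ζ hζ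
    rw [h1, integral_complex_ofReal]
    have hcont : Continuous (deriv s) := hsd.continuous_deriv le_rfl
    have hsan : Antitone s := fun a b hab => Real.smoothTransition.monotone (by linarith)
    have h2 : 0 < ∫ ζ : ℂ, -(2 * deriv s (‖ζ‖^2)) := by
      obtain ⟨t, ht, hte⟩ := exists_deriv_eq_slope s (show (0:ℝ) < 3 by norm_num) hsd.continuous.continuousOn (hsd.differentiable one_ne_zero).differentiableOn
      have hs0 : s 0 = 1 := Real.smoothTransition.one_of_one_le (by norm_num)
      have hs3 : s 3 = 0 := Real.smoothTransition.zero_of_nonpos (by norm_num)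
      refine Continuous.integral_pos_of_hasCompactSupport_nonneg_nonzero (x := ((Real.sqrt t : ℝ) : ℂ)) ?_ ?_ ?_ ?_
      · fun_prop
      · refine HasCompactSupport.intro (isCompact_closedBall 0 2) ?_
        intro ζ hζ
        rw [mem_closedBall_zero_iff, not_le] at hζ
        have : s =ᶠ[nhds (‖ζ‖^2)] fun _ => 0 := by
          filter_upwards [lt_mem_nhds (show (2:ℝ) < ‖ζ‖^2 by nlinarith)] with t ht
          exact Real.smoothTransition.zero_of_nonpos (by linarith)
        rw [this.deriv_eq]; simp
      · intro ζ
        have : deriv s (‖ζ‖^2) ≤ 0 := hsan.deriv_nonpos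
        simp only [Pi.zero_apply]; linarith
      · have : ‖((Real.sqrt t : ℝ) : ℂ)‖^2 = t := by
          rw [Complex.norm_real, Real.norm_eq_abs, sq_abs, Real.sq_sqrt ht.1.le]
        rw [this, hte, hs0, hs3]; norm_num
    rw [MeasureTheory.integral_neg] at h2
    intro h3
    have h3' := Complex.ofReal_eq_zero.mp h3
    linarith
  · intro χ hχ hc y hy
    have htr : ∫ ζ, db θ ζ * (ζ - 0)⁻¹ = ∫ ζ, db (fun w => θ (w - y)) ζ * (ζ - y)⁻¹ := by
      rw [← MeasureTheory.integral_sub_right_eq_self _ y]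
      congr 1; ext ζ
      simp only [db, sub_zero, fderiv_comp_sub]
    rw [htr, ← sub_eq_zero]
    have hθy : ContDiff ℝ 1 fun w => θ (w - y) := hθd.comp (contDiff_id.sub contDiff_const)
    have hθyc : HasCompactSupport fun w => θ (w - y) := by
      refine HasCompactSupport.intro (isCompact_closedBall y 2) ?_
      intro ζ hζ; apply hθs
      simpa [dist_eq_norm] using hζ
    have hey : ∀ᶠ ζ in nhds y, θ (ζ - y) = 1 := by
      filter_upwards [ball_mem_nhds y one_pos] with ζ hζ
      apply hθ1; simpa [dist_eq_norm] using hζ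
    have hsupp : ∀ χ : ℂ → ℂ, (∀ᶠ ζ in nhds y, χ ζ = 1) → tsupport (db χ) ⊆ {y}ᶜ := by
      intro χ h x hx hxy
      rw [mem_singleton_iff] at hxy; subst hxy
      refine (notMem_tsupport_iff_eventuallyEq.mpr ?_) hx
      filter_upwards [h.eventually_nhds] with ζ hζ
      have : χ =ᶠ[nhds ζ] fun _ => 1 := hζ
      simp [db, this.fderiv_eq]
    have hI : ∀ χ : ℂ → ℂ, ContDiff ℝ 1 χ → HasCompactSupport χ → (∀ᶠ ζ in nhds y, χ ζ = 1) →
        MeasureTheory.Integrable fun ζ => db χ ζ * (ζ - y)⁻¹ := by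
      intro χ h1 h2 h3
      refine (cont_mul_supp (cont_db h1) isOpen_compl_singleton (hsupp χ h3) ?_).integrable_of_hasCompactSupport ?_
      · exact (continuousOn_id.sub continuousOn_const).inv₀ (fun x hx => sub_ne_zero.mpr hx)
      · refine HasCompactSupport.mul_right ?_
        exact HasCompactSupport.of_support_subset_isCompact h2 ((subset_tsupport _).trans (tsupport_db χ))
    rw [← MeasureTheory.integral_sub (hI χ hχ hc hy) (hI _ hθy hθyc hey)]
    have hz := dbar_zero (χ := fun w => χ w - θ (w - y)) (h := fun ζ => (ζ - y)⁻¹) (V := {y}ᶜ) (hχ.sub hθy)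
      (hc.sub hθyc) isOpen_compl_singleton ?_ ?_
    · rw [← hz]
      congr 1; ext ζ
      simp only [db]
      rw [fderiv_fun_sub (hχ.differentiable one_ne_zero _) (hθy.differentiable one_ne_zero _)]
      simp only [ContinuousLinearMap.sub_apply]
      ring
    · intro x hx hxy
      rw [mem_singleton_iff] at hxy; subst hxy
      refine (notMem_tsupport_iff_eventuallyEq.mpr ?_) hx
      filter_upwards [hy, hey] with ζ h1 h2
      simp [h1, h2]
    · intro ζ hζ
      exact ((differentiableAt_id.sub_const y).inv (sub_ne_zero.mpr hζ)).differentiableWithinAt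

open Metric Set Function Filter

structure HH (V : Set ℂ) (G : ℂ → ℂ) (x : ℂ) (R : ℝ) : Prop where
  isOpen : IsOpen V
  conn : IsConnected V
  diff : Differentiable ℂ G
  pos : 0 < R
  maps : ∀ y ∈ V, ‖G y - x‖ < R
  cpt : ∀ s < R, IsCompact {y | y ∈ V ∧ ‖G y - x‖ ≤ s}

theorem cauchy_kernel_approx {K : Set ℂ} (hK : IsCompact K) {G : ℂ → ℂ} (hG : Differentiable ℂ G) {x : ℂ} {s : ℝ}
    (hs : ∀ y ∈ K, ‖G y - x‖ ≤ s) {ζ : ℂ} (hζ : ζ ∉ K) (hζs : s < ‖G ζ - x‖) {ε : ℝ} (hε : 0 < ε) :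
    ∃ E : ℂ → ℂ, Differentiable ℂ E ∧ ∀ y ∈ K, ‖E y - (ζ - y)⁻¹‖ ≤ ε := by
  rcases K.eq_empty_or_nonempty with rfl | ⟨y0, hy0⟩
  · exact ⟨0, differentiable_const 0, by simp⟩
  have hs0 : 0 ≤ s := (norm_nonneg _).trans (hs y0 hy0)
  set a := G ζ - x with ha
  have ha0 : 0 < ‖a‖ := hs0.trans_lt hζs
  have ha0' : a ≠ 0 := norm_pos_iff.mp ha0
  have hc : ContinuousOn (fun y => ‖(ζ - y)⁻¹‖) K := by
    refine ((continuousOn_const.sub continuousOn_id).inv₀ ?_).norm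
    intro y hy h
    have h : ζ - y = 0 := h
    exact hζ (by rw [sub_eq_zero.mp h]; exact hy)
  obtain ⟨C, hC⟩ := hK.bddAbove_image hc
  have hC' : ∀ y ∈ K, ‖(ζ - y)⁻¹‖ ≤ C := fun y hy => hC ⟨y, hy, rfl⟩
  have hC0 : 0 ≤ C := (norm_nonneg _).trans (hC' y0 hy0)
  have ht : Tendsto (fun N : ℕ => (s / ‖a‖)^N * C) atTop (nhds (0 * C)) :=
    (tendsto_pow_atTop_nhds_zero_of_lt_one (by positivity) ((div_lt_one ha0).mpr hζs)).mul_const C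
  rw [zero_mul] at ht
  obtain ⟨N, hN⟩ := (ht.eventually_le_const hε).exists
  refine ⟨fun y => dslope G ζ y * ∑ k ∈ Finset.range N, (G y - x)^k / a^(k+1), ?_, ?_⟩
  · have h1 : Differentiable ℂ (dslope G ζ) := by
      rw [← differentiableOn_univ, Complex.differentiableOn_dslope univ_mem, differentiableOn_univ]
      exact hG
    refine h1.mul (Differentiable.fun_sum fun k _ => ?_)
    exact ((hG.sub_const x).pow k).div_const _
  · intro y hy
    have hyz : y ≠ ζ := fun h => hζ (h ▸ hy)
    have hne : ζ - y ≠ 0 := sub_ne_zero.mpr hyz.symm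
    have hr : (G y - x)/a ≠ 1 := by
      intro h
      rw [div_eq_one_iff_eq ha0'] at h
      have := hs y hy; rw [h] at this; linarith
    have hsum : ∑ k ∈ Finset.range N, (G y - x)^k / a^(k+1) = a⁻¹ * ∑ k ∈ Finset.range N, ((G y - x)/a)^k := by
      rw [Finset.mul_sum]; refine Finset.sum_congr rfl fun k _ => ?_
      rw [div_pow]; field_simp; ring
    have hd : dslope G ζ y = (G y - G ζ) / (y - ζ) := by
      rw [dslope_of_ne _ hyz, slope_def_field]
    have heq : dslope G ζ y * ∑ k ∈ Finset.range N, (G y - x)^k / a^(k+1) - (ζ - y)⁻¹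
        = -(((G y - x)/a)^N * (ζ - y)⁻¹) := by
      rw [hsum, geom_sum_eq hr, hd]
      have h1 : (G y - x)/a - 1 ≠ 0 := sub_ne_zero.mpr hr
      have h2 : y - ζ ≠ 0 := sub_ne_zero.mpr hyz
      have h3 : G y - G ζ = a * ((G y - x)/a - 1) := by
        rw [mul_sub, mul_div_cancel₀ _ ha0', ha]; ring
      rw [h3]
      generalize (G y - x)/a = r at *
      have h4 : ζ - y = -(y - ζ) := by ring
      rw [h4]
      field_simp
      ring
    rw [heq, norm_neg, norm_mul, norm_pow, norm_div]
    refine le_trans ?_ hN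
    gcongr
    · exact hs y hy
    · exact hC' y hy

theorem runge {V : Set ℂ} {G : ℂ → ℂ} {x : ℂ} {R : ℝ} (H : HH V G x R) {s : ℝ} (hs : s < R)
    {u : ℂ → ℂ} (hu : DifferentiableOn ℂ u V) {ε : ℝ} (hε : 0 < ε) :
    ∃ E : ℂ → ℂ, Differentiable ℂ E ∧ ∀ y ∈ V, ‖G y - x‖ ≤ s → ‖E y - u y‖ ≤ ε := by
  obtain ⟨s', hs1, hs2⟩ := exists_between hs
  obtain ⟨s'', hs3, hs4⟩ := exists_between hs2
  set K : Set ℂ := {y | y ∈ V ∧ ‖G y - x‖ ≤ s} with hKdef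
  have hK : IsCompact K := H.cpt s hs
  set K' : Set ℂ := {y | y ∈ V ∧ ‖G y - x‖ ≤ s'} with hKdef'
  have hK' : IsCompact K' := H.cpt s' hs2
  set K'' : Set ℂ := {y | y ∈ V ∧ ‖G y - x‖ ≤ s''} with hKdef''
  have hK'' : IsCompact K'' := H.cpt s'' hs4
  have hKK : K ⊆ K' := fun y hy => ⟨hy.1, hy.2.trans hs1.le⟩
  have hintg : K' ⊆ interior K'' := by
    intro y hy
    rw [mem_interior_iff_mem_nhds]
    have : Continuous fun y => ‖G y - x‖ := by have := H.diff.continuous; fun_prop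
    filter_upwards [H.isOpen.mem_nhds hy.1, this.continuousAt.eventually_lt_const (hy.2.trans_lt hs3)] with w h1 h2
    exact ⟨h1, h2.le⟩
  obtain ⟨χ₀, h1, h0, -⟩ := exists_contMDiffMap_one_nhds_of_subset_interior (n := 1) (modelWithCornersSelf ℝ ℂ) hK'.isClosed hintg
  let χ : ℂ → ℂ := fun ζ => (χ₀ ζ : ℂ)
  have hχ : ContDiff ℝ 1 χ := Complex.ofRealCLM.contDiff.comp χ₀.contMDiff.contDiff
  have hχ0 : ∀ ζ ∉ K'', χ ζ = 0 := fun ζ hζ => by simp [χ, h0 ζ hζ]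
  have hχc : HasCompactSupport χ := HasCompactSupport.intro hK'' hχ0
  have hχt : tsupport χ ⊆ K'' := by
    refine closure_minimal ?_ hK''.isClosed
    intro ζ hζ; by_contra h; exact hζ (hχ0 ζ h)
  have hχ1 : ∀ y ∈ K', ∀ᶠ ζ in nhds y, χ ζ = 1 := by
    intro y hy
    filter_upwards [(eventually_nhdsSet_iff_forall.mp h1) y hy] with ζ hζ
    simp [χ, hζ]
  have hdb0 : ∀ y ∈ K', y ∉ tsupport (db χ) := by
    intro y hy
    rw [notMem_tsupport_iff_eventuallyEq]
    filter_upwards [(hχ1 y hy).eventually_nhds] with ζ hζ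
    have : χ =ᶠ[nhds ζ] fun _ => 1 := hζ
    simp [db, this.fderiv_eq]
  have hdt : tsupport (db χ) ⊆ V := (tsupport_db χ).trans (hχt.trans fun y hy => hy.1)
  obtain ⟨J, hJ0, hJ⟩ := exists_J
  let c : ℂ → ℂ := fun ζ => db χ ζ * u ζ
  have hcc : Continuous c := cont_mul_supp (cont_db hχ) H.isOpen hdt hu.continuousOn
  have hct : tsupport c ⊆ tsupport (db χ) := tsupport_mul_subset_left
  have hdbc : HasCompactSupport (db χ) := HasCompactSupport.of_support_subset_isCompact hχc ((subset_tsupport _).trans (tsupport_db χ))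
  have hcs : HasCompactSupport c := hdbc.mul_right
  have hinv : ∀ y : ℂ, ContinuousOn (fun ζ : ℂ => (ζ - y)⁻¹) {y}ᶜ := fun y =>
    (continuousOn_id.sub continuousOn_const).inv₀ (fun x hx => sub_ne_zero.mpr hx)
  have hform : ∀ y ∈ K, ∫ ζ, c ζ * (ζ - y)⁻¹ = u y * J := by
    intro y hy
    have hyt := hdb0 y (hKK hy)
    have hsub : tsupport (db χ) ⊆ {y}ᶜ := fun ζ hζ h => hyt (h ▸ hζ)
    have hz := dbar_zero (h := dslope u y) hχ hχc H.isOpen (hχt.trans fun y hy => hy.1)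
      ((Complex.differentiableOn_dslope (H.isOpen.mem_nhds hy.1)).mpr hu)
    have hI1 : MeasureTheory.Integrable fun ζ => c ζ * (ζ - y)⁻¹ :=
      (cont_mul_supp hcc isOpen_compl_singleton (hct.trans hsub) (hinv y)).integrable_of_hasCompactSupport hcs.mul_right
    have hI2 : MeasureTheory.Integrable fun ζ => db χ ζ * (ζ - y)⁻¹ :=
      (cont_mul_supp (cont_db hχ) isOpen_compl_singleton hsub (hinv y)).integrable_of_hasCompactSupport hdbc.mul_right
    have : (fun ζ => db χ ζ * dslope u y ζ) = fun ζ => c ζ * (ζ - y)⁻¹ - u y * (db χ ζ * (ζ - y)⁻¹) := by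
      ext ζ
      by_cases hζ : ζ = y
      · subst hζ
        have : db χ ζ = 0 := image_eq_zero_of_notMem_tsupport hyt
        simp [c, this]
      · rw [dslope_of_ne _ hζ, slope_def_field]; simp only [c]; rw [div_eq_mul_inv]; ring
    rw [this, MeasureTheory.integral_sub hI1 (hI2.const_mul _), MeasureTheory.integral_const_mul,
      hJ χ hχ hχc y (hχ1 y (hKK hy)), sub_eq_zero] at hz
    exact hz
  haveI : CompactSpace K := isCompact_iff_compactSpace.mp hK
  let S0 : Submodule ℂ C(K, ℂ) :=
    { carrier := {F | ∃ E : ℂ → ℂ, Differentiable ℂ E ∧ ∀ y : K, F y = E y}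
      add_mem' := by
        rintro a b ⟨E, hE, h⟩ ⟨E', hE', h'⟩
        exact ⟨fun z => E z + E' z, hE.add hE', fun y => by simp [h, h']⟩
      zero_mem' := ⟨fun _ => 0, differentiable_const 0, fun y => by simp⟩
      smul_mem' := by
        rintro a b ⟨E, hE, h⟩
        exact ⟨fun z => a * E z, hE.const_mul a, fun y => by simp [h]⟩ }
  let S := S0.topologicalClosure
  let Ψ' : C(ℂ × K, ℂ) := ⟨fun p => c p.1 * (p.1 - p.2)⁻¹, by
    rw [continuous_iff_continuousAt]
    rintro ⟨ζ, y⟩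
    by_cases hζ : ζ = y
    · have : ζ ∉ tsupport c := fun h => hdb0 y (hKK y.2) (hζ ▸ hct h)
      have h2 : ∀ᶠ p : ℂ × K in nhds (ζ, y), c p.1 * (p.1 - p.2)⁻¹ = 0 := by
        have := (notMem_tsupport_iff_eventuallyEq.mp this)
        have h3 : Tendsto (Prod.fst : ℂ × K → ℂ) (nhds (ζ, y)) (nhds ζ) := continuous_fst.continuousAt
        filter_upwards [h3.eventually this] with p hp
        simp [hp]
      exact continuousAt_const.congr (h2.mono fun p hp => hp.symm)
    · have h1 : ContinuousAt (fun p : ℂ × K => c p.1) (ζ, y) := (hcc.comp continuous_fst).continuousAt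
      have h2 : ContinuousAt (fun p : ℂ × K => p.1 - (p.2 : ℂ)) (ζ, y) := by fun_prop
      exact h1.mul (h2.inv₀ (sub_ne_zero.mpr hζ))⟩
  let Ψ : C(ℂ, C(K, ℂ)) := Ψ'.curry
  have hΨ : ∀ ζ (y : K), Ψ ζ y = c ζ * (ζ - y)⁻¹ := fun ζ y => rfl
  have hΨS : ∀ ζ, Ψ ζ ∈ S := by
    intro ζ
    by_cases hc0 : c ζ = 0
    · have : Ψ ζ = 0 := by ext y; simp [hΨ, hc0]
      rw [this]; exact S.zero_mem
    have hζt : ζ ∈ tsupport (db χ) := hct (subset_tsupport _ hc0)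
    have hζK : ζ ∉ K' := fun h => hdb0 ζ h hζt
    have hζV : ζ ∈ V := hdt hζt
    have hζs : s < ‖G ζ - x‖ := by
      by_contra h; push Not at h
      exact hζK (hKK ⟨hζV, h⟩)
    change Ψ ζ ∈ closure (S0 : Set C(K, ℂ))
    rw [Metric.mem_closure_iff]
    intro e he
    obtain ⟨E, hE, hE1⟩ := cauchy_kernel_approx hK H.diff (x := x) (s := s) (fun y hy => hy.2) (fun h => hζK (hKK h)) hζs
      (ε := e / 2 / ‖c ζ‖) (by positivity)
    refine ⟨⟨fun y => c ζ * E y, by have := hE.continuous; fun_prop⟩, ⟨fun y => c ζ * E y, hE.const_mul _, fun y => rfl⟩, ?_⟩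
    refine lt_of_le_of_lt ((ContinuousMap.dist_le (by positivity : 0 ≤ e / 2)).mpr fun y => ?_) (half_lt_self he)
    rw [dist_comm, dist_eq_norm, hΨ]
    simp only [ContinuousMap.coe_mk]
    rw [← mul_sub, norm_mul]
    have := hE1 y y.2
    rwa [le_div_iff₀ (by positivity), mul_comm] at this
  have hScl : IsClosed (S : Set C(K, ℂ)) := S0.isClosed_topologicalClosure
  haveI : CompleteSpace S := hScl.completeSpace_coe
  let Φ : ℂ → S := fun ζ => ⟨Ψ ζ, hΨS ζ⟩
  have hΦc : Continuous Φ := Ψ.continuous.subtype_mk _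
  have hΦs : HasCompactSupport Φ := by
    refine HasCompactSupport.intro (show IsCompact (tsupport c) from hcs) ?_
    intro ζ hζ
    apply Subtype.ext
    change Ψ ζ = 0
    ext y; rw [hΨ, image_eq_zero_of_notMem_tsupport hζ]; simp
  have hΦI : MeasureTheory.Integrable Φ := hΦc.integrable_of_hasCompactSupport hΦs
  let I : S := ∫ ζ, Φ ζ
  have hIy : ∀ y : K, (I : C(K, ℂ)) y = u y * J := by
    intro y
    rw [← hform y y.2]
    have := ((ContinuousMap.evalCLM ℂ y).comp S.subtypeL).integral_comp_comm hΦI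
    exact this.symm
  have hImem : (I : C(K, ℂ)) ∈ closure (S0 : Set C(K, ℂ)) := I.2
  rw [Metric.mem_closure_iff] at hImem
  obtain ⟨F, ⟨E, hE, hFE⟩, hd⟩ := hImem (ε * ‖J‖) (by positivity)
  refine ⟨fun y => E y * J⁻¹, hE.mul_const _, ?_⟩
  intro y hyV hys
  have h3 := (ContinuousMap.dist_apply_le_dist (f := (I : C(K, ℂ))) (g := F) ⟨y, hyV, hys⟩).trans hd.le
  rw [hIy, hFE, dist_comm, dist_eq_norm] at h3
  have : E y * J⁻¹ - u y = (E y - u y * J) * J⁻¹ := by field_simp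
  rw [this, norm_mul, norm_inv, ← div_eq_mul_inv, div_le_iff₀ (by positivity)]
  exact h3

open Metric Set Function Filter

theorem HH.exists_primitive {V : Set ℂ} {G : ℂ → ℂ} {x : ℂ} {R : ℝ} (H : HH V G x R) {v : ℂ → ℂ}
    (hv : DifferentiableOn ℂ v V) : ∃ P : ℂ → ℂ, DifferentiableOn ℂ P V ∧ ∀ y ∈ V, deriv P y = v y := by
  obtain ⟨p, hp⟩ := H.conn.nonempty
  have hk : ∀ k : ℕ, ∃ E : ℂ → ℂ, Differentiable ℂ E ∧
      ∀ y ∈ V, ‖G y - x‖ ≤ R - 1 / ((k:ℝ) + 1) → ‖E y - v y‖ ≤ 1 / ((k:ℝ) + 1) := fun k =>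
    runge H (by have : 0 < 1 / ((k:ℝ) + 1) := by positivity
                linarith) hv (by positivity)
  choose E hE hEv using hk
  have hP : ∀ k : ℕ, ∃ P : ℂ → ℂ, P p = 0 ∧ ∀ y, HasDerivAt P (E k y) y := by
    intro k
    obtain ⟨P, h0, hP⟩ := ((hE k).isExactOn_univ).with_val_at p 0
    exact ⟨P, h0, fun y => hP y (mem_univ y)⟩
  choose P hP0 hP using hP
  have hGc : Continuous fun y => ‖G y - x‖ := by have := H.diff.continuous; fun_prop
  -- uniform convergence on small balls
  have hloc : ∀ y ∈ V, ∃ r > 0, ball y r ⊆ V ∧ ∀ᶠ k in atTop, ∀ w ∈ ball y r, ‖E k w - v w‖ ≤ 1 / ((k:ℝ) + 1) := by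
    intro y hy
    obtain ⟨s, hs1, hs2⟩ := exists_between (H.maps y hy)
    have : {w | w ∈ V ∧ ‖G w - x‖ < s} ∈ nhds y := by
      filter_upwards [H.isOpen.mem_nhds hy, hGc.continuousAt.eventually_lt_const hs1] with w h1 h2 using ⟨h1, h2⟩
    obtain ⟨r, hr, hsub⟩ := Metric.mem_nhds_iff.mp this
    refine ⟨r, hr, fun w hw => (hsub hw).1, ?_⟩
    have ht := tendsto_one_div_add_atTop_nhds_zero_nat (𝕜 := ℝ)
    filter_upwards [ht.eventually_le_const (show 0 < R - s by linarith)] with k hk w hw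
    exact hEv k w (hsub hw).1 (by have := (hsub hw).2; linarith)
  have hbd : ∀ y ∈ V, ∃ r > 0, ball y r ⊆ V ∧ ∃ M : ℝ, ∀ᶠ k in atTop, ∀ w ∈ ball y r, ‖E k w‖ ≤ M := by
    intro y hy
    obtain ⟨r, hr, hsub, hev⟩ := hloc y hy
    obtain ⟨r', hr', hb⟩ := Metric.mem_nhds_iff.mp
      ((hv.continuousOn.continuousAt (H.isOpen.mem_nhds hy)).norm.eventually_lt_const (lt_add_one ‖v y‖))
    refine ⟨min r r', lt_min hr hr', (ball_subset_ball (min_le_left _ _)).trans hsub, ‖v y‖ + 2, ?_⟩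
    filter_upwards [hev] with k hk w hw
    have h1 := hk w (ball_subset_ball (min_le_left _ _) hw)
    have h2 : ‖v w‖ < ‖v y‖ + 1 := hb (ball_subset_ball (min_le_right _ _) hw)
    have h3 : 1 / ((k:ℝ) + 1) ≤ 1 := by
      rw [div_le_one (by positivity)]; have : (0:ℝ) ≤ k := Nat.cast_nonneg k
      linarith
    have h4 := norm_add_le (E k w - v w) (v w)
    rw [sub_add_cancel] at h4
    linarith
  -- local boundedness of P
  set A : Set ℂ := {y | ∃ r > 0, ∃ M : ℝ, ∀ᶠ k in atTop, ∀ w ∈ ball y r, ‖P k w‖ ≤ M} with hA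
  have hAo : IsOpen A := by
    rw [Metric.isOpen_iff]
    rintro y ⟨r, hr, M, h⟩
    refine ⟨r / 2, by positivity, ?_⟩
    intro w hw
    refine ⟨r / 2, by positivity, M, h.mono fun k hk q hq => hk q ?_⟩
    rw [mem_ball] at *
    linarith [dist_triangle q w y]
  have step : ∀ y ∈ V, ∃ r > 0, ∀ q ∈ ball y r, (∃ M : ℝ, ∀ᶠ k in atTop, ‖P k q‖ ≤ M) → y ∈ A := by
    intro y hy
    obtain ⟨r, hr, hsub, M, hM⟩ := hbd y hy
    refine ⟨r, hr, ?_⟩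
    rintro q hq ⟨M', hM'⟩
    refine ⟨r, hr, M' + M * (2 * r), ?_⟩
    filter_upwards [hM, hM'] with k h1 h2 w hw
    have h3 := (convex_ball y r).norm_image_sub_le_of_norm_hasDerivWithin_le (f := P k) (f' := E k) (C := M)
      (fun z _ => (hP k z).hasDerivWithinAt) h1 hq hw
    have h4 := norm_add_le (P k w - P k q) (P k q)
    rw [sub_add_cancel] at h4
    have h5 : ‖w - q‖ ≤ 2 * r := by
      rw [← dist_eq_norm]
      rw [mem_ball] at hw hq
      linarith [dist_triangle_right w q y]
    have hM0 : 0 ≤ M := (norm_nonneg _).trans (h1 y (mem_ball_self hr))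
    have := mul_le_mul_of_nonneg_left h5 hM0
    linarith
  have hVA : V ⊆ A := by
    refine H.conn.isPreconnected.subset_of_closure_inter_subset hAo ⟨p, hp, ?_⟩ ?_
    · obtain ⟨r, hr, h⟩ := step p hp
      exact h p (mem_ball_self hr) ⟨0, Eventually.of_forall fun k => by simp [hP0]⟩
    · rintro y ⟨hyc, hyV⟩
      obtain ⟨r, hr, h⟩ := step y hyV
      obtain ⟨q, hq, hd⟩ := Metric.mem_closure_iff.mp hyc r hr
      obtain ⟨r', hr', M, hM⟩ := hq
      exact h q (by rwa [mem_ball, dist_comm]) ⟨M, hM.mono fun k hk => hk q (mem_ball_self hr')⟩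
  let l : Ultrafilter ℕ := Filter.hyperfilter ℕ
  have hl : (l : Filter ℕ) ≤ atTop := Nat.hyperfilter_le_atTop
  have hPd : ∀ k, DifferentiableOn ℂ (P k) V := fun k y _ => (hP k y).differentiableAt.differentiableWithinAt
  have hlb : LocBdd P l V := by
    intro y hy
    obtain ⟨r, hr, M, hM⟩ := hVA hy
    obtain ⟨r', hr', hs⟩ := Metric.isOpen_iff.mp H.isOpen y hy
    refine ⟨min r r', lt_min hr hr', M, (ball_subset_ball (min_le_right _ _)).trans hs, ?_⟩
    filter_upwards [hM.filter_mono hl] with k hk w hw using hk w (ball_subset_ball (min_le_left _ _) hw)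
  obtain ⟨h, hh, hlim⟩ := montel_ultra l H.isOpen hPd hlb
  refine ⟨h, hh, fun y hy => ?_⟩
  have h1 := (hlim.deriv (Eventually.of_forall hPd) H.isOpen).tendsto_at hy
  have h2 : Tendsto (fun k => E k y) l (nhds (v y)) := by
    obtain ⟨r, hr, -, hev⟩ := hloc y hy
    rw [tendsto_iff_norm_sub_tendsto_zero]
    refine squeeze_zero' (Eventually.of_forall fun k => norm_nonneg _)
      ((hev.mono fun k hk => hk y (mem_ball_self hr)).filter_mono hl) ?_
    exact (tendsto_one_div_add_atTop_nhds_zero_nat (𝕜 := ℝ)).mono_left hl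
  refine tendsto_nhds_unique h1 (h2.congr fun k => ?_)
  exact (hP k y).deriv.symm

theorem HH.exists_log {V : Set ℂ} {G : ℂ → ℂ} {x : ℂ} {R : ℝ} (H : HH V G x R) {u : ℂ → ℂ}
    (hu : DifferentiableOn ℂ u V) (h0 : ∀ y ∈ V, u y ≠ 0) :
    ∃ L : ℂ → ℂ, DifferentiableOn ℂ L V ∧ ∀ y ∈ V, Complex.exp (L y) = u y := by
  obtain ⟨p, hp⟩ := H.conn.nonempty
  obtain ⟨L, hL, hLd⟩ := H.exists_primitive (v := fun y => deriv u y / u y) ((hu.deriv H.isOpen).div hu h0)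
  have hda : ∀ y ∈ V, HasDerivAt (fun y => u y * Complex.exp (-L y)) 0 y := by
    intro y hy
    have h1 := (hu.differentiableAt (H.isOpen.mem_nhds hy)).hasDerivAt
    have h2 := (hL.differentiableAt (H.isOpen.mem_nhds hy)).hasDerivAt
    rw [hLd y hy] at h2
    have h3 := h1.mul h2.neg.cexp
    have : deriv u y * Complex.exp (-L y) + u y * (Complex.exp (-L y) * -(deriv u y / u y)) = 0 := by
      field_simp [h0 y hy]; ring
    simp only [Pi.neg_apply] at h3
    rw [this] at h3
    exact h3
  have hconst : ∀ y ∈ V, u y * Complex.exp (-L y) = u p * Complex.exp (-L p) := by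
    intro y hy
    refine H.isOpen.is_const_of_deriv_eq_zero (f := fun y => u y * Complex.exp (-L y)) H.conn.isPreconnected ?_ ?_ hy hp
    · exact fun y hy => (hda y hy).differentiableAt.differentiableWithinAt
    · exact fun y hy => (hda y hy).deriv
  have hc : u p * Complex.exp (-L p) ≠ 0 := mul_ne_zero (h0 p hp) (Complex.exp_ne_zero _)
  refine ⟨fun y => L y + Complex.log (u p * Complex.exp (-L p)), hL.add_const _, ?_⟩
  intro y hy
  rw [Complex.exp_add, Complex.exp_log hc, ← hconst y hy, Complex.exp_neg]
  field_simp [Complex.exp_ne_zero]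

theorem HH.exists_sqrt {V : Set ℂ} {G : ℂ → ℂ} {x : ℂ} {R : ℝ} (H : HH V G x R) {u : ℂ → ℂ}
    (hu : DifferentiableOn ℂ u V) (h0 : ∀ y ∈ V, u y ≠ 0) :
    ∃ q : ℂ → ℂ, DifferentiableOn ℂ q V ∧ ∀ y ∈ V, q y ^ 2 = u y := by
  obtain ⟨L, hL, hLe⟩ := H.exists_log hu h0
  refine ⟨fun y => Complex.exp (L y / 2), (hL.div_const 2).cexp, fun y hy => ?_⟩
  rw [← Complex.exp_nat_mul, ← hLe y hy]
  congr 1; push_cast; ring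

open Metric Set Function Filter

theorem HH.ne_univ {V : Set ℂ} {G : ℂ → ℂ} {x : ℂ} {R : ℝ} (H : HH V G x R) : V ≠ univ := by
  intro hV
  have hb : Bornology.IsBounded (range G) := by
    refine (isBounded_iff_forall_norm_le).mpr ⟨‖x‖ + R, ?_⟩
    rintro _ ⟨y, rfl⟩
    have h1 := H.maps y (hV ▸ mem_univ y)
    have h2 := norm_add_le (G y - x) x
    rw [sub_add_cancel] at h2; linarith
  obtain ⟨c, hc⟩ := H.diff.exists_const_forall_eq_of_bounded hb
  have h1 := H.cpt ‖c - x‖ (by have := H.maps 0 (hV ▸ mem_univ 0); rwa [hc] at this)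
  have h2 : {y | y ∈ V ∧ ‖G y - x‖ ≤ ‖c - x‖} = univ := by
    ext y; simp [hV, hc]
  rw [h2] at h1
  exact noncompact_univ ℂ h1

theorem exists_near {V : Set ℂ} (hV : IsOpen V) (hne : V ≠ univ) {a : ℂ} (ha : a ∈ V) :
    ∃ b ∉ V, 0 < dist a b ∧ dist a b = infDist a Vᶜ ∧ ball a (dist a b) ⊆ V := by
  have h1 : (Vᶜ).Nonempty := nonempty_compl.mpr hne
  obtain ⟨b, hb, hd⟩ := hV.isClosed_compl.exists_infDist_eq_dist h1 a
  refine ⟨b, hb, ?_, hd.symm, ?_⟩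
  · rw [dist_pos]; rintro rfl; exact hb ha
  · intro y hy
    by_contra h
    have := infDist_le_dist_of_mem (x := a) (show y ∈ Vᶜ from h)
    rw [mem_ball, dist_comm] at hy
    linarith

theorem HH.T_map {V : Set ℂ} {G : ℂ → ℂ} {x : ℂ} {R : ℝ} (H : HH V G x R) {a b : ℂ} (ha : a ∈ V) (hb : b ∉ V)
    (hball : ball a (dist a b) ⊆ V) :
    ∃ T : ℂ → ℂ, DifferentiableOn ℂ T V ∧ InjOn T V ∧ T a = 0 ∧ (∀ y ∈ V, ‖T y‖ ≤ 6) ∧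
      ∀ y ∈ V, ‖T y‖ ≤ 1 / 10 → dist y a ≤ dist a b / 2 := by
  have hab : a ≠ b := by rintro rfl; exact hb ha
  have hab' : a - b ≠ 0 := sub_ne_zero.mpr hab
  obtain ⟨q, hq, hq2⟩ := H.exists_sqrt (u := fun y => (y - b) / (a - b))
    ((differentiableOn_id.sub_const b).div_const _)
    (fun y hy => div_ne_zero (sub_ne_zero.mpr (by rintro rfl; exact hb hy)) hab')
  have hqa : q a ^ 2 = 1 := by rw [hq2 a ha, div_self hab']
  set Sq : ℂ → ℂ := fun y => q y * q a with hSq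
  have hSd : DifferentiableOn ℂ Sq V := hq.mul_const _
  have hSa : Sq a = 1 := by rw [hSq]; simp only; rw [← sq, hqa]
  have hS2 : ∀ y ∈ V, Sq y ^ 2 = (y - b) / (a - b) := by
    intro y hy; simp only [hSq]; rw [mul_pow, hqa, mul_one, hq2 y hy]
  have hSinj : ∀ y ∈ V, ∀ y' ∈ V, Sq y ^ 2 = Sq y' ^ 2 → y = y' := by
    intro y hy y' hy' h
    rw [hS2 y hy, hS2 y' hy', div_left_inj' hab'] at h
    exact sub_left_injective h
  have hS0 : ∀ y ∈ V, Sq y ≠ 0 := by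
    intro y hy h
    have := hS2 y hy
    rw [h] at this
    have h2 : (y - b)/(a - b) = 0 := by rw [← this]; norm_num
    rw [div_eq_zero_iff] at h2
    rcases h2 with h2 | h2
    · exact hb (sub_eq_zero.mp h2 ▸ hy)
    · exact hab' h2
  have hdist : ∀ y ∈ V, dist y a = dist a b * ‖Sq y ^ 2 - 1‖ := by
    intro y hy
    rw [hS2 y hy, dist_eq_norm, dist_eq_norm, ← norm_mul]
    congr 1; field_simp; ring
  have hpos : 0 < dist a b := dist_pos.mpr hab
  have hre : ∀ y ∈ ball a (dist a b), 0 < (Sq y).re := by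
    have hne : ∀ y ∈ ball a (dist a b), (Sq y).re ≠ 0 := by
      intro y hy h
      have h1 := hdist y (hball hy)
      rw [mem_ball, h1] at hy
      have h2 : ‖Sq y ^ 2 - 1‖ < 1 := by
        by_contra h'; push Not at h'; nlinarith
      have h3 := (Complex.abs_re_le_norm (Sq y ^ 2 - 1)).trans_lt h2
      have h4 : (Sq y ^ 2 - 1).re = -((Sq y).im)^2 - 1 := by
        rw [sq]; simp [h]; ring
      rw [h4, abs_lt] at h3
      nlinarith [h3.1, sq_nonneg (Sq y).im]
    intro y hy
    by_contra hneg
    push Not at hneg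
    have hpc : IsPreconnected (ball a (dist a b)) := isPreconnected_ball
    have hcont : ContinuousOn (fun y => (Sq y).re) (ball a (dist a b)) :=
      Complex.continuous_re.comp_continuousOn (hSd.continuousOn.mono hball)
    obtain ⟨w, hw, hw0⟩ := hpc.intermediate_value hy (mem_ball_self hpos) hcont (show (0:ℝ) ∈ Icc _ _ from ⟨hneg, by simp [hSa]⟩)
    exact hne w hw hw0
  have homit : ∀ y ∈ V, 2 / 5 ≤ ‖Sq y + 1‖ := by
    intro y hy
    by_contra h
    push Not at h
    set w := - Sq y with hw
    have hw1 : ‖w - 1‖ < 2 / 5 := by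
      have : w - 1 = -(Sq y + 1) := by rw [hw]; ring
      rw [this, norm_neg]; exact h
    have hw2 : ‖w ^ 2 - 1‖ < 1 := by
      have : w ^ 2 - 1 = (w - 1) * ((w - 1) + 2) := by ring
      rw [this, norm_mul]
      have h3 := norm_add_le (w - 1) 2
      have h4 : ‖(2:ℂ)‖ = 2 := by simp
      rw [h4] at h3
      nlinarith [norm_nonneg (w - 1)]
    have hwre : 0 < w.re := by
      have h3 := (Complex.abs_re_le_norm (w - 1)).trans_lt hw1
      rw [abs_lt] at h3; simp at h3; linarith [h3.1]
    have hsq : Sq y ^ 2 = w ^ 2 := by rw [hw]; ring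
    have hyb : y ∈ ball a (dist a b) := by
      rw [mem_ball, hdist y hy, hsq]; nlinarith
    have := hre y hyb
    rw [hw] at hwre; simp at hwre; linarith
  have hden : ∀ y ∈ V, Sq y + 1 ≠ 0 := by
    intro y hy h
    have := homit y hy; rw [h] at this; norm_num at this
  refine ⟨fun y => (Sq y - 1) / (Sq y + 1), (hSd.sub_const 1).div (hSd.add_const 1) hden, ?_, by simp [hSa], ?_, ?_⟩
  · intro y hy y' hy' h
    simp only at h
    rw [div_eq_div_iff (hden y hy) (hden y' hy')] at h
    refine hSinj y hy y' hy' ?_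
    have : Sq y = Sq y' := by linear_combination h / 2
    rw [this]
  · intro y hy
    have h1 : (Sq y - 1) / (Sq y + 1) = 1 - 2 / (Sq y + 1) := by
      have := hden y hy
      field_simp; ring
    simp only [h1]
    have h2 := norm_sub_le (1:ℂ) (2 / (Sq y + 1))
    have h3 : ‖2 / (Sq y + 1)‖ ≤ 5 := by
      rw [norm_div, div_le_iff₀ (by have := homit y hy; linarith)]
      have := homit y hy
      simp; linarith
    rw [norm_one] at h2; linarith
  · intro y hy hT
    simp only at hT
    set t := (Sq y - 1) / (Sq y + 1) with ht
    have hts : t * (Sq y + 1) = Sq y - 1 := div_mul_cancel₀ _ (hden y hy)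
    have h1t : 9/10 ≤ ‖1 - t‖ := by
      have := norm_sub_norm_le (1:ℂ) t
      simp at this; linarith
    have h1t0 : 1 - t ≠ 0 := by
      intro h; rw [h] at h1t; norm_num at h1t
    have hSt : Sq y = (1 + t) / (1 - t) := by
      rw [eq_div_iff h1t0]; linear_combination -hts
    have : Sq y ^ 2 - 1 = 4 * t / (1 - t) ^ 2 := by
      rw [hSt]; field_simp; ring
    rw [hdist y hy, this, norm_div, norm_mul, norm_pow]
    have : ‖(4:ℂ)‖ * ‖t‖ / ‖1 - t‖ ^ 2 ≤ 1 / 2 := by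
      rw [div_le_iff₀ (by positivity)]
      simp; nlinarith
    nlinarith

theorem mobius_den {w ζ : ℂ} (hw : ‖w‖ < 1) (hζ : ‖ζ‖ < 1) : 1 - (starRingEnd ℂ) w * ζ ≠ 0 := by
  intro h
  have h1 : (starRingEnd ℂ) w * ζ = 1 := by linear_combination -h
  have h2 : ‖(starRingEnd ℂ) w * ζ‖ < 1 := by
    rw [norm_mul, Complex.norm_conj]; nlinarith [norm_nonneg w, norm_nonneg ζ]
  rw [h1] at h2; simp at h2

theorem mobius_lt {w ζ : ℂ} (hw : ‖w‖ < 1) (hζ : ‖ζ‖ < 1) : ‖(ζ - w) / (1 - (starRingEnd ℂ) w * ζ)‖ < 1 := by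
  have hd := norm_pos_iff.mpr (mobius_den hw hζ)
  rw [norm_div, div_lt_one hd]
  refine lt_of_pow_lt_pow_left₀ 2 hd.le ?_
  rw [← Complex.normSq_eq_norm_sq, ← Complex.normSq_eq_norm_sq]
  have h1 : Complex.normSq w < 1 := by rw [Complex.normSq_eq_norm_sq]; nlinarith [norm_nonneg w]
  have h2 : Complex.normSq ζ < 1 := by rw [Complex.normSq_eq_norm_sq]; nlinarith [norm_nonneg ζ]
  have : Complex.normSq (1 - (starRingEnd ℂ) w * ζ) - Complex.normSq (ζ - w) = (1 - Complex.normSq w) * (1 - Complex.normSq ζ) := by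
    simp [Complex.normSq_apply]; ring
  nlinarith

theorem mobius_inj {w ζ ζ' : ℂ} (hw : ‖w‖ < 1) (hζ : ‖ζ‖ < 1) (hζ' : ‖ζ'‖ < 1)
    (h : (ζ - w) / (1 - (starRingEnd ℂ) w * ζ) = (ζ' - w) / (1 - (starRingEnd ℂ) w * ζ')) : ζ = ζ' := by
  rw [div_eq_div_iff (mobius_den hw hζ) (mobius_den hw hζ')] at h
  have h1 : (1 - w * (starRingEnd ℂ) w) * (ζ - ζ') = 0 := by linear_combination h
  have := mobius_den hw hw
  rw [mul_comm] at this
  rcases mul_eq_zero.mp h1 with h2 | h2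
  · exact absurd h2 this
  · exact sub_eq_zero.mp h2

theorem mobius_deriv {w : ℂ} {h : ℂ → ℂ} {p : ℂ} {d : ℂ} (hw : ‖w‖ < 1) (hp : ‖h p‖ < 1) (hd : HasDerivAt h d p) :
    HasDerivAt (fun y => (h y - w) / (1 - (starRingEnd ℂ) w * h y))
      (d * (1 - (starRingEnd ℂ) w * w) / (1 - (starRingEnd ℂ) w * h p)^2) p := by
  have h1 := (hd.sub_const w).div ((hd.const_mul ((starRingEnd ℂ) w)).const_sub 1) (mobius_den hw hp)
  have e : (d * (1 - (starRingEnd ℂ) w * h p) - (h p - w) * -((starRingEnd ℂ) w * d)) / (1 - (starRingEnd ℂ) w * h p) ^ 2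
    = (d * (1 - (starRingEnd ℂ) w * w) / (1 - (starRingEnd ℂ) w * h p)^2) := by congr 1; ring
  rw [e] at h1
  exact h1

open Metric Set Function Filter

theorem HH.rmt {V : Set ℂ} {G : ℂ → ℂ} {x : ℂ} {R : ℝ} (H : HH V G x R) {p : ℂ} (hp : p ∈ V) :
    ∃ χ : ℂ → ℂ, DifferentiableOn ℂ χ (ball 0 1) ∧ InjOn χ (ball 0 1) ∧ χ '' ball 0 1 = V ∧ χ 0 = p := by
  obtain ⟨b, hb, hr, -, hball⟩ := exists_near H.isOpen H.ne_univ hp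
  set r := dist p b with hrdef
  set Fam : Set (ℂ → ℂ) := {h | DifferentiableOn ℂ h V ∧ InjOn h V ∧ h p = 0 ∧ ∀ y ∈ V, ‖h y‖ < 1} with hFam
  have hder : ∀ h ∈ Fam, HasDerivAt h (deriv h p) p := fun h hh =>
    (hh.1.differentiableAt (H.isOpen.mem_nhds hp)).hasDerivAt
  set A : Set ℝ := (fun h => ‖deriv h p‖) '' Fam with hA
  have hAbdd : BddAbove A := by
    refine ⟨1 / (r/2), ?_⟩
    rintro _ ⟨h, hh, rfl⟩
    have hsub : closedBall p (r/2) ⊆ V := (closedBall_subset_ball (by linarith)).trans hball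
    refine Complex.norm_deriv_le_of_forall_mem_sphere_norm_le (by positivity) ?_ ?_
    · refine DifferentiableOn.diffContOnCl ?_
      rw [closure_ball p (by positivity)]; exact hh.1.mono hsub
    · intro z hz
      exact (hh.2.2.2 z (hsub (sphere_subset_closedBall hz))).le
  obtain ⟨T, hTd, hTi, hT0, hT6, -⟩ := H.T_map hp hb hball
  have hT7 : (fun y => T y / 7) ∈ Fam := by
    refine ⟨hTd.div_const 7, ?_, by simp [hT0], ?_⟩
    · intro y hy y' hy' h
      simp only at h
      exact hTi hy hy' (by linear_combination 7 * h)
    · intro y hy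
      simp only [norm_div]
      have := hT6 y hy
      norm_num; linarith
  have hAne : A.Nonempty := ⟨_, _, hT7, rfl⟩
  have hpos : 0 < sSup A := by
    refine lt_of_lt_of_le ?_ (le_csSup hAbdd ⟨_, hT7, rfl⟩)
    exact norm_pos_iff.mpr (inj_deriv_ne_zero H.isOpen hT7.1 hT7.2.1 hp)
  have hseq : ∀ k : ℕ, ∃ h ∈ Fam, sSup A - 1 / ((k:ℝ) + 1) < ‖deriv h p‖ := by
    intro k
    obtain ⟨_, ⟨h, hh, rfl⟩, h2⟩ := exists_lt_of_lt_csSup hAne (show sSup A - 1 / ((k:ℝ) + 1) < sSup A by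
      have : 0 < 1 / ((k:ℝ) + 1) := by positivity
      linarith)
    exact ⟨h, hh, h2⟩
  choose F hF hFd using hseq
  let l : Ultrafilter ℕ := Filter.hyperfilter ℕ
  have hl : (l : Filter ℕ) ≤ atTop := Nat.hyperfilter_le_atTop
  have hlb : LocBdd F l V := by
    intro y hy
    obtain ⟨r', hr', hs⟩ := Metric.isOpen_iff.mp H.isOpen y hy
    exact ⟨r', hr', 1, hs, Eventually.of_forall fun k w hw => ((hF k).2.2.2 w (hs hw)).le⟩
  obtain ⟨h, hh, hlim⟩ := montel_ultra l H.isOpen (fun k => (hF k).1) hlb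
  have hhp : h p = 0 := tendsto_nhds_unique (hlim.tendsto_at hp) (by simp only [(hF _).2.2.1]; exact tendsto_const_nhds)
  have hh1 : ∀ y ∈ V, ‖h y‖ ≤ 1 := fun y hy =>
    le_of_tendsto (hlim.tendsto_at hy).norm (Eventually.of_forall fun k => ((hF k).2.2.2 y hy).le)
  have hhd : sSup A ≤ ‖deriv h p‖ := by
    have h1 := ((hlim.deriv (Eventually.of_forall fun k => (hF k).1) H.isOpen).tendsto_at hp).norm
    have h2 : Tendsto (fun k : ℕ => sSup A - 1 / ((k:ℝ) + 1)) l (nhds (sSup A - 0)) :=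
      ((tendsto_one_div_add_atTop_nhds_zero_nat (𝕜 := ℝ)).const_sub _).mono_left hl
    rw [sub_zero] at h2
    exact le_of_tendsto_of_tendsto h2 h1 (Eventually.of_forall fun k => (hFd k).le)
  have hd0 : deriv h p ≠ 0 := norm_pos_iff.mp (hpos.trans_le hhd)
  have hhi : InjOn h V := by
    have hnc : ∃ y ∈ V, h y ≠ h p := by
      by_contra hcon
      push Not at hcon
      have : h =ᶠ[nhds p] fun _ => h p := by
        filter_upwards [H.isOpen.mem_nhds hp] with y hy using hcon y hy
      exact hd0 (by rw [this.deriv_eq]; simp)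
    obtain ⟨y, hy, hne⟩ := hnc
    exact hurwitz_inj H.isOpen H.conn.isPreconnected hh (Eventually.of_forall fun k => (hF k).1)
      (Eventually.of_forall fun k => (hF k).2.1) hlim hy hp hne
  have hh2 : ∀ y ∈ V, ‖h y‖ < 1 := by
    intro y hy
    have ho := isOpen_image_of_inj H.isOpen hh hhi
    have hs : h '' V ⊆ closedBall 0 1 := by
      rintro _ ⟨z, hz, rfl⟩; simpa using hh1 z hz
    have := interior_maximal hs ho
    rw [interior_closedBall _ one_ne_zero] at this
    simpa using this ⟨y, hy, rfl⟩
  have hsurj : ball 0 1 ⊆ h '' V := by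
    intro w hw
    by_contra hwV
    rw [mem_ball_zero_iff] at hw
    have hw0 : w ≠ 0 := by rintro rfl; exact hwV ⟨p, hp, hhp⟩
    set k0 : ℂ → ℂ := fun y => (h y - w) / (1 - (starRingEnd ℂ) w * h y) with hk0
    have hk0d : DifferentiableOn ℂ k0 V := (hh.sub_const w).div ((hh.const_mul _).const_sub 1)
      (fun y hy => mobius_den hw (hh2 y hy))
    have hk0ne : ∀ y ∈ V, k0 y ≠ 0 := by
      intro y hy
      refine div_ne_zero (sub_ne_zero.mpr ?_) (mobius_den hw (hh2 y hy))
      rintro h'; exact hwV ⟨y, hy, h'⟩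
    obtain ⟨q, hq, hq2⟩ := H.exists_sqrt hk0d hk0ne
    have hq1 : ∀ y ∈ V, ‖q y‖ < 1 := by
      intro y hy
      have h1 := mobius_lt hw (hh2 y hy)
      have h2 : ‖q y‖ ^ 2 < 1 := by rw [← norm_pow, hq2 y hy]; exact h1
      nlinarith [norm_nonneg (q y)]
    have hqi : InjOn q V := by
      intro y hy y' hy' he
      refine hhi hy hy' (mobius_inj hw (hh2 y hy) (hh2 y' hy') ?_)
      change k0 y = k0 y'
      rw [← hq2 y hy, ← hq2 y' hy', he]
    have hqp := hq1 p hp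
    set k : ℂ → ℂ := fun y => (q y - q p) / (1 - (starRingEnd ℂ) (q p) * q y) with hk
    have hkF : k ∈ Fam := by
      refine ⟨(hq.sub_const _).div ((hq.const_mul _).const_sub 1) (fun y hy => mobius_den hqp (hq1 y hy)), ?_, by simp [hk], ?_⟩
      · intro y hy y' hy' he
        exact hqi hy hy' (mobius_inj hqp (hq1 y hy) (hq1 y' hy') he)
      · exact fun y hy => mobius_lt hqp (hq1 y hy)
    have hqd := (hq.differentiableAt (H.isOpen.mem_nhds hp)).hasDerivAt
    have hhd' := (hh.differentiableAt (H.isOpen.mem_nhds hp)).hasDerivAt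
    have e1 := (mobius_deriv hqp hqp hqd).deriv
    have e2 := (mobius_deriv hw (hh2 p hp) hhd')
    have e3 : HasDerivAt k0 (2 * q p * deriv q p) p := by
      have h1 := hqd.pow 2
      have h2 : (q ^ 2) =ᶠ[nhds p] k0 := by
        filter_upwards [H.isOpen.mem_nhds hp] with y hy using hq2 y hy
      have h3 := h1.congr_of_eventuallyEq h2.symm
      simpa using h3
    have e4 := e3.unique e2
    rw [hhp] at e4
    simp only [mul_zero, sub_zero, one_pow, div_one] at e4
    have hk0p : ‖q p‖ ^ 2 = ‖w‖ := by
      rw [← norm_pow, hq2 p hp, hk0]; simp [hhp]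
    have hle : ‖deriv k p‖ ≤ ‖deriv h p‖ := (le_csSup hAbdd ⟨k, hkF, rfl⟩).trans hhd
    have hcq : ‖1 - (starRingEnd ℂ) (q p) * q p‖ = 1 - ‖q p‖^2 := by
      have : 1 - (starRingEnd ℂ) (q p) * q p = ((1 - ‖q p‖^2 : ℝ) : ℂ) := by
        rw [mul_comm, Complex.mul_conj, Complex.normSq_eq_norm_sq]; push_cast; ring
      rw [this, Complex.norm_real, Real.norm_eq_abs, abs_of_pos]
      nlinarith [norm_nonneg (q p)]
    have hcw : ‖1 - (starRingEnd ℂ) w * w‖ = 1 - ‖w‖^2 := by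
      have : 1 - (starRingEnd ℂ) w * w = ((1 - ‖w‖^2 : ℝ) : ℂ) := by
        rw [mul_comm, Complex.mul_conj, Complex.normSq_eq_norm_sq]; push_cast; ring
      rw [this, Complex.norm_real, Real.norm_eq_abs, abs_of_pos]
      nlinarith [norm_nonneg w]
    have n4 := congrArg norm e4
    rw [norm_mul, norm_mul, norm_mul, hcw] at n4
    have n1 := congrArg norm e1
    rw [norm_div, norm_mul, norm_pow, hcq] at n1
    change ‖deriv k p‖ = _ at n1
    have hdp : 0 < ‖deriv h p‖ := norm_pos_iff.mpr hd0
    have hqpos : 0 < ‖q p‖ := by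
      have : 0 < ‖w‖ := norm_pos_iff.mpr hw0
      by_contra h'; push Not at h'
      have h0 : ‖q p‖ = 0 := le_antisymm h' (norm_nonneg _)
      rw [h0] at hk0p; norm_num at hk0p; exact hw0 (norm_eq_zero.mp hk0p.symm)
    rw [← hk0p] at n4
    set t := ‖q p‖ with ht
    have h1t : 0 < 1 - t^2 := by nlinarith
    have n1' : ‖deriv k p‖ * (1 - t^2) = ‖deriv q p‖ := by
      rw [n1]; field_simp
    rw [show ‖(2:ℂ)‖ = 2 by simp, ← n1'] at n4
    have n5 : 2 * t * ‖deriv k p‖ = ‖deriv h p‖ * (1 + t^2) := by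
      have : (2 * t * ‖deriv k p‖ - ‖deriv h p‖ * (1 + t^2)) * (1 - t^2) = 0 := by linear_combination n4
      rcases mul_eq_zero.mp this with h | h
      · linarith
      · linarith
    have : 2 * t * ‖deriv k p‖ ≤ 2 * t * ‖deriv h p‖ := by gcongr
    have h6 : 0 < ‖deriv h p‖ * (1 - t)^2 := mul_pos hdp (by have : 0 < 1 - t := by linarith
                                                             positivity)
    nlinarith
  have himg : h '' V = ball 0 1 := by
    refine subset_antisymm ?_ hsurj
    rintro _ ⟨z, hz, rfl⟩; simpa using hh2 z hz
  have hli : LeftInvOn (invFunOn h V) h V := hhi.leftInvOn_invFunOn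
  refine ⟨invFunOn h V, ?_, ?_, ?_, ?_⟩
  · rw [← himg]; exact inv_holo H.isOpen hh hhi hli
  · rw [← himg]
    rintro _ ⟨a, ha, rfl⟩ _ ⟨b, hb, rfl⟩ he
    rw [hli ha, hli hb] at he; rw [he]
  · rw [← himg]; exact hli.image_image
  · rw [← hhp]; exact hli hp

open Metric Set Function Filter

/-- Distortion lemma (E). -/
theorem HH.lemE {V : Set ℂ} {G : ℂ → ℂ} {x : ℂ} {R : ℝ} (H : HH V G x R) {N M : ℕ} (Z : Finset ℂ)
    (hZ : ∀ a, a ∈ Z ↔ a ∈ V ∧ G a = x) (hN : Z.card ≤ N)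
    (hord : ∀ a ∈ V, G a = x → ∃ C : ℝ, ∀ᶠ y in nhds a, ‖y - a‖ ^ M ≤ C * ‖G y - x‖)
    {q : ℂ} (hq : q ∈ V) (hqx : ‖G q - x‖ ≤ R / (3 * 60 ^ (N * (M + 1)))) :
    ∃ a ∈ Z, dist q a ≤ infDist a Vᶜ / 2 := by
  have hT : ∀ a ∈ Z, ∃ T : ℂ → ℂ, DifferentiableOn ℂ T V ∧ T a = 0 ∧ (∀ y ∈ V, ‖T y‖ ≤ 6) ∧
      ∀ y ∈ V, ‖T y‖ ≤ 1 / 10 → dist y a ≤ infDist a Vᶜ / 2 := by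
    intro a ha
    have haV := ((hZ a).mp ha).1
    obtain ⟨b, hb, -, he, hball⟩ := exists_near H.isOpen H.ne_univ haV
    obtain ⟨T, h1, -, h2, h3, h4⟩ := H.T_map haV hb hball
    exact ⟨T, h1, h2, h3, by rw [← he]; exact h4⟩
  choose! T hTd hT0 hT6 hTq using hT
  by_contra hcon
  push Not at hcon
  have hbig : ∀ a ∈ Z, 1 / 10 < ‖T a q‖ := by
    intro a ha
    by_contra h; push Not at h
    exact absurd (hTq a ha q hq h) (not_le.mpr (hcon a ha))
  set P : ℂ → ℂ := fun y => ∏ a ∈ Z, (T a y / 6) ^ (M + 1) with hP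
  have hPd : DifferentiableOn ℂ P V := by
    refine DifferentiableOn.fun_finsetProd fun a ha => ?_
    exact ((hTd a ha).div_const 6).pow _
  have hP1 : ∀ y ∈ V, ∀ Z' ⊆ Z, ‖∏ a ∈ Z', (T a y / 6) ^ (M + 1)‖ ≤ 1 := by
    intro y hy Z' hZ'
    rw [norm_prod]
    refine Finset.prod_le_one (fun _ _ => norm_nonneg _) fun a ha => ?_
    rw [norm_pow, norm_div]
    refine pow_le_one₀ (by positivity) ?_
    have := hT6 a (hZ' ha) y hy
    norm_num; linarith
  have hPq : (1 / 60 : ℝ) ^ (N * (M + 1)) ≤ ‖P q‖ := by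
    rw [hP]; simp only [norm_prod, norm_pow, norm_div]
    calc (1 / 60 : ℝ) ^ (N * (M + 1)) ≤ (1 / 60 : ℝ) ^ (Z.card * (M + 1)) := by
          refine pow_le_pow_of_le_one (by norm_num) (by norm_num) ?_
          gcongr
      _ = ∏ a ∈ Z, (1 / 60 : ℝ) ^ (M + 1) := by
          rw [Finset.prod_const, ← pow_mul]; congr 1; ring
      _ ≤ _ := by
          refine Finset.prod_le_prod (fun _ _ => by positivity) fun a ha => ?_
          have := hbig a ha
          refine pow_le_pow_left₀ (by norm_num) ?_ _
          have h6 : ‖(6:ℂ)‖ = 6 := by simp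
          rw [h6]; linarith
  set Q : ℂ → ℂ := fun y => P y / (G y - x) with hQ
  have hQ0 : ∀ a ∈ Z, Q a = 0 := by
    intro a ha; simp [hQ, ((hZ a).mp ha).2]
  have hQc : ContinuousOn Q V := by
    intro y hy
    apply ContinuousAt.continuousWithinAt
    by_cases hyZ : y ∈ Z
    · rw [ContinuousAt, hQ0 y hyZ]
      obtain ⟨C, hC⟩ := hord y hy ((hZ y).mp hyZ).2
      have hTy : DifferentiableAt ℂ (T y) y := (hTd y hyZ).differentiableAt (H.isOpen.mem_nhds hy)
      obtain ⟨K, hK⟩ := hTy.hasDerivAt.hasFDerivAt.isBigO_sub.bound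
      have hlim : Tendsto (fun w => (|K| / 6) ^ (M + 1) * |C| * ‖w - y‖) (nhds y) (nhds ((|K| / 6) ^ (M + 1) * |C| * ‖y - y‖)) := by
        apply ContinuousAt.tendsto (f := fun w => (|K| / 6) ^ (M + 1) * |C| * ‖w - y‖)
        fun_prop
      rw [sub_self, norm_zero, mul_zero] at hlim
      rw [tendsto_zero_iff_norm_tendsto_zero]
      refine squeeze_zero' (Eventually.of_forall fun w => norm_nonneg _) ?_ hlim
      filter_upwards [hC, hK, H.isOpen.mem_nhds hy] with w h1 h2 h3
      rw [hT0 y hyZ, sub_zero] at h2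
      have h2' : ‖T y w‖ ≤ |K| * ‖w - y‖ := h2.trans (by gcongr; exact le_abs_self K)
      have h4 : ‖P w‖ ≤ (|K| * ‖w - y‖ / 6) ^ (M + 1) := by
        rw [hP]; simp only
        rw [← Finset.mul_prod_erase Z _ hyZ, norm_mul]
        have h5 := hP1 w h3 (Z.erase y) (Finset.erase_subset _ _)
        have h6 : ‖(T y w / 6) ^ (M + 1)‖ ≤ (|K| * ‖w - y‖ / 6) ^ (M + 1) := by
          rw [norm_pow, norm_div]
          have : ‖(6:ℂ)‖ = 6 := by simp
          rw [this]; gcongr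
        calc _ ≤ (|K| * ‖w - y‖ / 6) ^ (M + 1) * 1 := by gcongr
          _ = _ := mul_one _
      rw [hQ]; simp only; rw [norm_div]
      rcases eq_or_lt_of_le (norm_nonneg (G w - x)) with h0 | h0
      · rw [← h0, div_zero]; positivity
      rw [div_le_iff₀ h0]
      refine h4.trans ?_
      have h7 : ‖w - y‖ ^ M ≤ |C| * ‖G w - x‖ := h1.trans (by gcongr; exact le_abs_self C)
      calc (|K| * ‖w - y‖ / 6) ^ (M + 1) = (|K| / 6) ^ (M + 1) * ‖w - y‖ * ‖w - y‖ ^ M := by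
            rw [show |K| * ‖w - y‖ / 6 = |K| / 6 * ‖w - y‖ by ring, mul_pow, pow_succ ‖w - y‖]; ring
        _ ≤ (|K| / 6) ^ (M + 1) * ‖w - y‖ * (|C| * ‖G w - x‖) := by gcongr
        _ = _ := by ring
    · have hne : G y - x ≠ 0 := fun h => hyZ ((hZ y).mpr ⟨hy, sub_eq_zero.mp h⟩)
      exact (hPd.continuousOn.continuousAt (H.isOpen.mem_nhds hy)).div (H.diff.continuous.continuousAt.sub continuousAt_const) hne
  have hRp := H.pos
  have hR2 : R / 2 < R := by linarith
  have hpow : (1:ℝ) ≤ 60 ^ (N * (M + 1)) := one_le_pow₀ (by norm_num)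
  have hqx2 : ‖G q - x‖ < R / 2 := by
    refine hqx.trans_lt ?_
    rw [div_lt_div_iff₀ (by positivity) (by norm_num)]
    nlinarith
  set U : Set ℂ := {y | y ∈ V ∧ ‖G y - x‖ < R / 2} \ Z with hU
  have hGc : Continuous fun y => ‖G y - x‖ := by have := H.diff.continuous; fun_prop
  have hUo : IsOpen U := by
    refine IsOpen.sdiff ?_ Z.finite_toSet.isClosed
    exact H.isOpen.inter (isOpen_lt hGc continuous_const)
  have hUK : U ⊆ {y | y ∈ V ∧ ‖G y - x‖ ≤ R / 2} := fun y hy => ⟨hy.1.1, hy.1.2.le⟩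
  have hcl : closure U ⊆ {y | y ∈ V ∧ ‖G y - x‖ ≤ R / 2} := closure_minimal hUK (H.cpt _ hR2).isClosed
  have hdc : DiffContOnCl ℂ Q U := by
    refine ⟨?_, hQc.mono fun y hy => (hcl hy).1⟩
    refine (hPd.mono fun y hy => hy.1.1).div ((H.diff.sub_const x).differentiableOn) ?_
    intro y hy h
    exact hy.2 ((hZ y).mpr ⟨hy.1.1, sub_eq_zero.mp h⟩)
  by_cases hqZ : q ∈ Z
  · exact absurd (hcon q hqZ) (not_lt.mpr (by rw [dist_self]; have := infDist_nonneg (x := q) (s := Vᶜ); linarith))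
  have hqU : q ∈ U := ⟨⟨hq, hqx2⟩, hqZ⟩
  have hmaxp := Complex.norm_le_of_forall_mem_frontier_norm_le ((H.cpt _ hR2).isBounded.subset hUK) hdc (C := 2 / R) ?_
    (subset_closure hqU)
  · rw [hQ] at hmaxp
    simp only [norm_div] at hmaxp
    have hne : 0 < ‖G q - x‖ := norm_pos_iff.mpr fun h => hqZ ((hZ q).mpr ⟨hq, sub_eq_zero.mp h⟩)
    rw [div_le_iff₀ hne] at hmaxp
    have h1 : 2 / R * ‖G q - x‖ ≤ 2 / R * (R / (3 * 60 ^ (N * (M + 1)))) := by gcongr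
    have h2 : 2 / R * (R / (3 * 60 ^ (N * (M + 1)))) = 2 / 3 * (1 / 60) ^ (N * (M + 1)) := by
      rw [one_div, inv_pow]; field_simp
    have h3 : (0:ℝ) < (1 / 60) ^ (N * (M + 1)) := by positivity
    linarith
  · intro y hy
    have hyc := hcl hy.1
    by_cases hyZ : y ∈ Z
    · rw [hQ0 y hyZ]; simp; positivity
    have hyR : ‖G y - x‖ = R / 2 := by
      refine le_antisymm hyc.2 ?_
      by_contra h; push Not at h
      have : y ∈ U := ⟨⟨hyc.1, h⟩, hyZ⟩
      exact hy.2 (by rwa [hUo.interior_eq])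
    rw [hQ]; simp only; rw [norm_div, hyR]
    have := hP1 y hyc.1 Z subset_rfl
    rw [div_le_div_iff₀ (by positivity) hRp]
    have h5 : ‖P y‖ ≤ 1 := this
    nlinarith

open Metric Set Function Filter

theorem subset_ball_of_sphere {C : Set ℂ} (hC : IsPreconnected C) {p y : ℂ} {r : ℝ} (hy : y ∈ C)
    (hyb : y ∈ ball p r) (hs : ∀ z ∈ C, z ∉ sphere p r) : C ⊆ ball p r := by
  refine hC.subset_left_of_subset_union (u := ball p r) (v := (closedBall p r)ᶜ) isOpen_ball isClosed_closedBall.isOpen_compl ?_ ?_ ⟨y, hy, hyb⟩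
  · rw [disjoint_compl_right_iff_subset]; exact ball_subset_closedBall
  · intro z hz
    rcases lt_trichotomy (dist z p) r with h | h | h
    · exact Or.inl h
    · exact absurd h (hs z hz)
    · right; simpa using h

theorem isolated_of_nc {f : ℂ → ℂ} (hf : Differentiable ℂ f) {p : ℂ} (hnc : ¬ ∀ᶠ z in nhds p, f z = f p) :
    ∀ᶠ z in nhdsWithin p {p}ᶜ, f z ≠ f p := by
  have h1 : AnalyticAt ℂ (fun z => f z - f p) p := (hf.analyticAt p).sub analyticAt_const
  rcases h1.eventually_eq_zero_or_eventually_ne_zero with h | h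
  · exact absurd (h.mono fun z hz => sub_eq_zero.mp hz) hnc
  · exact h.mono fun z hz => sub_ne_zero.mp hz

theorem curve_lim {f : ℂ → ℂ} (hf : Differentiable ℂ f) (hnc : ∀ p, ¬ ∀ᶠ z in nhds p, f z = f p)
    {γ : ℝ → ℂ} (hγ : ContinuousOn γ (Ico 0 1)) {v : ℂ}
    (hv : Tendsto (fun t => f (γ t)) (nhdsWithin 1 (Iio 1)) (nhds v)) (hav : ¬ AsymptoticValue f v) :
    ∃ p, f p = v ∧ Tendsto γ (nhdsWithin 1 (Iio 1)) (nhds p) := by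
  have hnt : ¬ Tendsto (fun t => ‖γ t‖) (nhdsWithin 1 (Iio 1)) atTop := by
    intro h
    let τ : ℝ → ℝ := fun t => |t| / (1 + |t|)
    have hτc : Continuous τ := by
      refine Continuous.div (by fun_prop) (by fun_prop) fun t => ?_
      positivity
    have hτ1 : ∀ t, τ t ∈ Ico (0:ℝ) 1 := fun t => ⟨by positivity, by
      simp only [τ]; rw [div_lt_one (by positivity)]; linarith⟩
    have hτt : Tendsto τ atTop (nhdsWithin 1 (Iio 1)) := by
      refine tendsto_nhdsWithin_iff.mpr ⟨?_, Eventually.of_forall fun t => (hτ1 t).2⟩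
      have h1 : Tendsto (fun t : ℝ => 1 - (1 + t)⁻¹) atTop (nhds (1 - 0)) :=
        (tendsto_inv_atTop_zero.comp (tendsto_atTop_add_const_left _ 1 tendsto_id)).const_sub 1
      rw [sub_zero] at h1
      refine h1.congr' ?_
      filter_upwards [eventually_ge_atTop 0] with t ht
      simp only [τ, abs_of_nonneg ht]
      field_simp; ring
    exact hav ⟨γ ∘ τ, hγ.comp_continuous hτc hτ1, h.comp hτt, hv.comp hτt⟩
  rw [Filter.tendsto_atTop] at hnt
  push Not at hnt
  obtain ⟨b, hb⟩ := hnt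
  have hfr : ∃ᶠ t in nhdsWithin (1:ℝ) (Iio 1), γ t ∈ closedBall (0:ℂ) b := by
    refine hb.mono fun t ht => ?_
    simpa using ht.le
  obtain ⟨p, -, hp⟩ := (isCompact_closedBall (0:ℂ) b).exists_mapClusterPt_of_frequently hfr
  have hfp : f p = v := by
    have h1 : MapClusterPt (f p) (nhdsWithin (1:ℝ) (Iio 1)) (f ∘ γ) := hp.continuousAt_comp hf.continuous.continuousAt
    have h2 : (nhds (f p) ⊓ nhds v).NeBot := NeBot.mono h1 (inf_le_inf_left _ hv)
    exact eq_of_nhds_neBot h2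
  refine ⟨p, hfp, ?_⟩
  rw [Metric.tendsto_nhds]
  intro d hd
  obtain ⟨r, hr, hrd, -, ε, hε, hsp⟩ := exists_sphere_bound isOpen_univ hf.differentiableOn (mem_univ p) (isolated_of_nc hf (hnc p)) hd
  have hev : ∀ᶠ t in nhdsWithin (1:ℝ) (Iio 1), ‖f (γ t) - f p‖ < ε ∧ 0 < t := by
    have h1 := Metric.tendsto_nhds.mp hv ε hε
    rw [← hfp] at h1
    filter_upwards [h1, (lt_mem_nhds (show (0:ℝ) < 1 by norm_num)).filter_mono nhdsWithin_le_nhds] with t h1 h2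
    exact ⟨by rwa [← dist_eq_norm], h2⟩
  obtain ⟨t0, ht0, hIoo⟩ := (mem_nhdsLT_iff_exists_Ioo_subset' (show (0:ℝ) < 1 by norm_num)).mp hev
  have hI : Ioo t0 1 ∈ nhdsWithin (1:ℝ) (Iio 1) := Ioo_mem_nhdsLT ht0
  have hfr2 : ∃ᶠ t in nhdsWithin (1:ℝ) (Iio 1), γ t ∈ ball p r := mapClusterPt_iff_frequently.mp hp _ (ball_mem_nhds p hr)
  obtain ⟨t1, ht1, ht1I⟩ := (hfr2.and_eventually hI).exists
  have hpre : IsPreconnected (γ '' Ioo t0 1) := isPreconnected_Ioo.image γ (hγ.mono fun t ht => ⟨(hIoo ht).2.le, ht.2⟩)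
  have hsub := subset_ball_of_sphere hpre ⟨t1, ht1I, rfl⟩ ht1 (by
    rintro _ ⟨t, ht, rfl⟩ hs
    have := hsp _ hs
    linarith [(hIoo ht).1])
  filter_upwards [hI] with t ht
  exact (hsub ⟨t, ht, rfl⟩ : γ t ∈ ball p r).trans hrd

theorem lift_unique {f : ℂ → ℂ} (hf : Differentiable ℂ f) {U : Set ℂ} (hU : IsOpen U) (hc : IsPreconnected U)
    {T T' : ℂ → ℂ} (hT : DifferentiableOn ℂ T U) (hT' : DifferentiableOn ℂ T' U)
    (he : ∀ ζ ∈ U, f (T ζ) = f (T' ζ)) {ζ₀ : ℂ} (h0 : ζ₀ ∈ U) (h : T ζ₀ = T' ζ₀) (hd : deriv f (T ζ₀) ≠ 0) :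
    EqOn T T' U := by
  obtain ⟨r, hr, hi⟩ := local_inj (hf.analyticAt _) hd
  have h1 : ∀ᶠ ζ in nhds ζ₀, T ζ ∈ ball (T ζ₀) r :=
    (hT.continuousOn.continuousAt (hU.mem_nhds h0)).eventually (ball_mem_nhds _ hr)
  have h2 : ∀ᶠ ζ in nhds ζ₀, T' ζ ∈ ball (T ζ₀) r := by
    rw [h]; exact (hT'.continuousOn.continuousAt (hU.mem_nhds h0)).eventually (ball_mem_nhds _ hr)
  have h3 : ∀ᶠ ζ in nhds ζ₀, ζ ∈ U ∧ T ζ = T' ζ := by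
    filter_upwards [h1, h2, hU.mem_nhds h0] with ζ a b c using ⟨c, hi a b (he ζ c)⟩
  obtain ⟨O, hO, hOo, hOm⟩ := _root_.eventually_nhds_iff.mp h3
  exact id_thm hU hc hT hT' hOo (fun ζ hζ => (hO ζ hζ).1) ⟨ζ₀, hOm⟩ fun ζ hζ => (hO ζ hζ).2

theorem lift_deriv_ne {f χ T : ℂ → ℂ} (hf : Differentiable ℂ f) {U : Set ℂ} (hU : IsOpen U) (hχ : DifferentiableOn ℂ χ U)
    (hi : InjOn χ U) (hT : DifferentiableOn ℂ T U) (he : ∀ ζ ∈ U, f (T ζ) = χ ζ) {ζ : ℂ} (hζ : ζ ∈ U) :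
    deriv f (T ζ) ≠ 0 := by
  intro h
  have h1 := (hf (T ζ)).hasDerivAt.comp ζ (hT.differentiableAt (hU.mem_nhds hζ)).hasDerivAt
  rw [h, zero_mul] at h1
  have h2 : (f ∘ T) =ᶠ[nhds ζ] χ := by
    filter_upwards [hU.mem_nhds hζ] with η hη using he η hη
  exact inj_deriv_ne_zero hU hχ hi hζ (by rw [← h2.deriv_eq]; exact h1.deriv)

/-- local inverse branch -/
theorem local_branch {f χ : ℂ → ℂ} (hf : Differentiable ℂ f) {p ζ : ℂ} (hd : deriv f p ≠ 0) {U : Set ℂ} (hU : IsOpen U)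
    (hχ : DifferentiableOn ℂ χ U) (hζ : ζ ∈ U) (he : f p = χ ζ) :
    ∃ ρ > 0, ∃ Θ : ℂ → ℂ, ball ζ ρ ⊆ U ∧ DifferentiableOn ℂ Θ (ball ζ ρ) ∧ Θ ζ = p ∧ (∀ η ∈ ball ζ ρ, f (Θ η) = χ η) ∧
      ∃ r > 0, InjOn f (ball p r) ∧ ∀ η ∈ ball ζ ρ, Θ η ∈ ball p r := by
  obtain ⟨r, hr, hi⟩ := local_inj (hf.analyticAt p) hd
  have hp : p ∈ ball p r := mem_ball_self hr
  set g := invFunOn f (ball p r) with hg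
  have hli : LeftInvOn g f (ball p r) := hi.leftInvOn_invFunOn
  have hgd : DifferentiableOn ℂ g (f '' ball p r) := inv_holo isOpen_ball hf.differentiableOn hi hli
  have ho : IsOpen (f '' ball p r) := isOpen_image_of_inj isOpen_ball hf.differentiableOn hi
  have : ∀ᶠ η in nhds ζ, η ∈ U ∧ χ η ∈ f '' ball p r := by
    have h1 := (hχ.continuousOn.continuousAt (hU.mem_nhds hζ)).eventually (ho.mem_nhds (he ▸ ⟨p, hp, rfl⟩))
    filter_upwards [h1, hU.mem_nhds hζ] with η a b using ⟨b, a⟩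
  obtain ⟨ρ, hρ, hsub⟩ := Metric.eventually_nhds_iff_ball.mp this
  refine ⟨ρ, hρ, g ∘ χ, fun η hη => (hsub η hη).1, ?_, ?_, ?_, r, hr, hi, ?_⟩
  · exact hgd.comp (hχ.mono fun η hη => (hsub η hη).1) fun η hη => (hsub η hη).2
  · simp only [comp_apply]; rw [← he]; exact hli hp
  · intro η hη
    obtain ⟨y, hy, hye⟩ := (hsub η hη).2
    simp only [comp_apply]; rw [← hye, hli hy]
  · intro η hη
    obtain ⟨y, hy, hye⟩ := (hsub η hη).2
    simp only [comp_apply]; rw [← hye, hli hy]; exact hy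

open Metric Set Function Filter

theorem radial_tendsto {ζ : ℂ} : Tendsto (fun t : ℝ => (t:ℂ) * ζ) (nhdsWithin 1 (Iio 1)) (nhds ζ) := by
  have : Continuous (fun t : ℝ => (t:ℂ) * ζ) := by fun_prop
  have h := this.tendsto 1
  simp only [Complex.ofReal_one, one_mul] at h
  exact h.mono_left nhdsWithin_le_nhds

theorem radial_mem {ζ : ℂ} (h0 : ζ ≠ 0) {t : ℝ} (ht : t ∈ Ico (0:ℝ) 1) : (t:ℂ) * ζ ∈ ball (0:ℂ) ‖ζ‖ := by
  rw [mem_ball_zero_iff, norm_mul, Complex.norm_real, Real.norm_of_nonneg ht.1]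
  have : 0 < ‖ζ‖ := norm_pos_iff.mpr h0
  nlinarith [ht.2]

def IsLift (f χ : ℂ → ℂ) (e : ℂ) (r : ℝ) (T : ℂ → ℂ) : Prop :=
  DifferentiableOn ℂ T (ball 0 r) ∧ T 0 = e ∧ ∀ ζ ∈ ball (0:ℂ) r, f (T ζ) = χ ζ

theorem IsLift.mono {f χ T : ℂ → ℂ} {e : ℂ} {r s : ℝ} (h : IsLift f χ e r T) (hs : s ≤ r) : IsLift f χ e s T :=
  ⟨h.1.mono (ball_subset_ball hs), h.2.1, fun ζ hζ => h.2.2 ζ (ball_subset_ball hs hζ)⟩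

theorem IsLift.unique {f χ T T' : ℂ → ℂ} {e : ℂ} {r : ℝ} (hf : Differentiable ℂ f) (hde : deriv f e ≠ 0)
    (hr : 0 < r) (h : IsLift f χ e r T) (h' : IsLift f χ e r T') : EqOn T T' (ball 0 r) :=
  lift_unique hf isOpen_ball isPreconnected_ball h.1 h'.1 (fun ζ hζ => by rw [h.2.2 ζ hζ, h'.2.2 ζ hζ])
    (mem_ball_self hr) (by rw [h.2.1, h'.2.1]) (by rw [h.2.1]; exact hde)

theorem IsLift.glue {f χ : ℂ → ℂ} {e : ℂ} {R : ℝ} (hf : Differentiable ℂ f) (hde : deriv f e ≠ 0)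
    (hR : 0 < R) (h : ∀ r, 0 < r → r < R → ∃ T, IsLift f χ e r T) : ∃ T, IsLift f χ e R T := by
  choose! T hT using h
  set s : ℂ → ℝ := fun ζ => (‖ζ‖ + R) / 2 with hs
  have hs1 : ∀ ζ ∈ ball (0:ℂ) R, 0 < s ζ ∧ s ζ < R ∧ ‖ζ‖ < s ζ := by
    intro ζ hζ
    rw [mem_ball_zero_iff] at hζ
    have := norm_nonneg ζ
    simp only [hs]
    refine ⟨by linarith, by linarith, by linarith⟩
  have key : ∀ r, 0 < r → r < R → ∀ ζ ∈ ball (0:ℂ) r, T (s ζ) ζ = T r ζ := by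
    intro r hr hrR ζ hζ
    obtain ⟨a, b, c⟩ := hs1 ζ (ball_subset_ball hrR.le hζ)
    rw [mem_ball_zero_iff] at hζ
    refine IsLift.unique hf hde (lt_min a hr) ((hT _ a b).mono (min_le_left _ r)) ((hT _ hr hrR).mono (min_le_right (s ζ) _)) ?_
    rw [mem_ball_zero_iff]; exact lt_min c hζ
  refine ⟨fun ζ => T (s ζ) ζ, ?_, ?_, ?_⟩
  · intro ζ hζ
    obtain ⟨a, b, c⟩ := hs1 ζ hζ
    have h1 : ζ ∈ ball (0:ℂ) (s ζ) := by rwa [mem_ball_zero_iff]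
    have h2 := ((hT _ a b).1.differentiableAt (isOpen_ball.mem_nhds h1))
    refine (h2.congr_of_eventuallyEq ?_).differentiableWithinAt
    filter_upwards [isOpen_ball.mem_nhds h1] with η hη
    exact key _ a b η hη
  · obtain ⟨a, b, c⟩ := hs1 0 (mem_ball_self hR)
    exact (hT _ a b).2.1
  · intro ζ hζ
    obtain ⟨a, b, c⟩ := hs1 ζ hζ
    exact (hT _ a b).2.2 ζ (by rwa [mem_ball_zero_iff])

theorem lift_alt {f χ : ℂ → ℂ} (hf : Differentiable ℂ f) (hnc : ∀ p, ¬ ∀ᶠ z in nhds p, f z = f p)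
    (hχ : DifferentiableOn ℂ χ (ball 0 1)) (hi : InjOn χ (ball 0 1)) (hav : ∀ ζ ∈ ball (0:ℂ) 1, ¬ AsymptoticValue f (χ ζ))
    {e : ℂ} (he : f e = χ 0) (hde : deriv f e ≠ 0) :
    (∃ T, IsLift f χ e 1 T) ∨ ∃ ζ ∈ ball (0:ℂ) 1, ζ ≠ 0 ∧ ∃ T, IsLift f χ e ‖ζ‖ T ∧ ∃ c, deriv f c = 0 ∧ f c = χ ζ ∧
      Tendsto (fun t : ℝ => T ((t:ℂ) * ζ)) (nhdsWithin 1 (Iio 1)) (nhds c) := by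
  set A : Set ℝ := {r | 0 < r ∧ r ≤ 1 ∧ ∃ T, IsLift f χ e r T} with hA
  have hne : A.Nonempty := by
    obtain ⟨ρ, hρ, Θ, h1, h2, h3, h4, -⟩ := local_branch hf hde isOpen_ball hχ (mem_ball_self one_pos) he
    exact ⟨min ρ 1, lt_min hρ one_pos, min_le_right _ _, Θ, IsLift.mono (r := ρ) ⟨h2, h3, h4⟩ (min_le_left _ _)⟩
  have hbd : BddAbove A := ⟨1, fun r hr => hr.2.1⟩
  set R := sSup A with hRdef
  have hR0 : 0 < R := by
    obtain ⟨a, ha⟩ := hne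
    exact ha.1.trans_le (le_csSup hbd ha)
  have hR1 : R ≤ 1 := csSup_le hne fun r hr => hr.2.1
  obtain ⟨T, hT⟩ := IsLift.glue (f := f) (χ := χ) (e := e) hf hde hR0 (by
    intro r hr hrR
    obtain ⟨a, ha, har⟩ := exists_lt_of_lt_csSup hne hrR
    obtain ⟨T, hT⟩ := ha.2.2
    exact ⟨T, hT.mono har.le⟩)
  rcases hR1.eq_or_lt with h1 | h1
  · left; rw [h1] at hT; exact ⟨T, hT⟩
  right
  by_contra hcon
  push Not at hcon
  have hsp : ∀ ζ ∈ sphere (0:ℂ) R, ∃ ρ > 0, ∃ Θ : ℂ → ℂ, DifferentiableOn ℂ Θ (ball ζ ρ) ∧ EqOn Θ T (ball ζ ρ ∩ ball 0 R) := by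
    intro ζ hζ
    rw [mem_sphere_zero_iff_norm] at hζ
    have hζ0 : ζ ≠ 0 := by intro h; rw [h, norm_zero] at hζ; linarith
    have hζ1 : ζ ∈ ball (0:ℂ) 1 := by rw [mem_ball_zero_iff]; linarith
    have hmem : ∀ t ∈ Ico (0:ℝ) 1, (t:ℂ) * ζ ∈ ball (0:ℂ) R := fun t ht => hζ ▸ radial_mem hζ0 ht
    have hIev : ∀ᶠ t in nhdsWithin (1:ℝ) (Iio 1), t ∈ Ico (0:ℝ) 1 := Ico_mem_nhdsLT one_pos
    have hlim : Tendsto (fun t : ℝ => f (T ((t:ℂ) * ζ))) (nhdsWithin 1 (Iio 1)) (nhds (χ ζ)) := by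
      have h2 := (hχ.continuousOn.continuousAt (isOpen_ball.mem_nhds hζ1)).tendsto.comp (radial_tendsto (ζ := ζ))
      refine h2.congr' ?_
      filter_upwards [hIev] with t ht
      exact (hT.2.2 _ (hmem t ht)).symm
    obtain ⟨p, hp, hpt⟩ := curve_lim hf hnc (γ := fun t : ℝ => T ((t:ℂ) * ζ))
      (hT.1.continuousOn.comp (by fun_prop) hmem) hlim (hav ζ hζ1)
    have hdp : deriv f p ≠ 0 := fun h => hcon ζ hζ1 hζ0 T (hζ ▸ hT) p h hp hpt
    obtain ⟨ρ, hρ, Θ, hb1, hΘ, hΘζ, hfΘ, r, hr, hir, hΘr⟩ := local_branch hf hdp isOpen_ball hχ hζ1 hp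
    refine ⟨ρ, hρ, Θ, hΘ, ?_⟩
    have e1 : ∀ᶠ t : ℝ in nhdsWithin (1:ℝ) (Iio 1), T ((t:ℂ) * ζ) ∈ ball p r := hpt.eventually (ball_mem_nhds _ hr)
    have e2 : ∀ᶠ t : ℝ in nhdsWithin (1:ℝ) (Iio 1), (t:ℂ) * ζ ∈ ball ζ ρ := radial_tendsto.eventually (ball_mem_nhds _ hρ)
    obtain ⟨t, h1, h2, h3⟩ := (e1.and (e2.and hIev)).exists
    have hm := hmem t h3
    refine lift_unique hf (isOpen_ball.inter isOpen_ball) ((convex_ball ζ ρ).inter (convex_ball 0 R)).isPreconnected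
      (hΘ.mono inter_subset_left) (hT.1.mono inter_subset_right) (fun η hη => by rw [hfΘ η hη.1, hT.2.2 η hη.2])
      ⟨h2, hm⟩ (hir (hΘr _ h2) h1 (by rw [hfΘ _ h2, hT.2.2 _ hm])) ?_
    exact lift_deriv_ne hf isOpen_ball (hχ.mono hb1) (hi.mono hb1) hΘ hfΘ h2
  obtain ⟨R', hR', H, hH, hHe⟩ := gl_extend hR0 hT.1 hsp
  have hm : 0 < min R' 1 := lt_min (hR0.trans hR') one_pos
  have hlift : IsLift f χ e (min R' 1) H := by
    refine ⟨hH.mono (ball_subset_ball (min_le_left _ _)), by rw [hHe (mem_ball_self hR0)]; exact hT.2.1, ?_⟩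
    refine id_thm (f := fun ζ => f (H ζ)) (g := χ) (O := ball 0 R) isOpen_ball isPreconnected_ball ?_ (hχ.mono (ball_subset_ball (min_le_right _ _)))
      isOpen_ball (ball_subset_ball (le_min hR'.le h1.le)) ⟨0, mem_ball_self hR0⟩ ?_
    · exact hf.comp_differentiableOn (hH.mono (ball_subset_ball (min_le_left _ _)))
    · intro ζ hζ
      simp only
      rw [hHe hζ, hT.2.2 ζ hζ]
  have := le_csSup hbd (show min R' 1 ∈ A from ⟨hm, min_le_right _ _, H, hlift⟩)
  exact absurd this (not_le.mpr (lt_min hR' h1))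

open Metric Set Function Filter

theorem local_deg {f : ℂ → ℂ} {c : ℂ} (hf : AnalyticAt ℂ f c) (hnc : ¬ ∀ᶠ z in nhds c, f z = f c) :
    ∃ m : ℕ, 1 ≤ m ∧ (∃ ε > 0, ∀ E : Finset ℂ, ∀ v, (∀ e ∈ E, e ∈ ball c ε ∧ f e = v) → E.card ≤ m) ∧
      ∃ C, ∀ᶠ y in nhds c, ‖y - c‖ ^ m ≤ C * ‖f y - f c‖ := by
  obtain ⟨m, hm, k, hk, hk0, hk', hev⟩ := normal_form hf hnc
  refine ⟨m, hm, ?_, ?_⟩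
  · obtain ⟨r, hr, hi⟩ := local_inj hk hk'
    obtain ⟨r2, hr2, h2⟩ := Metric.eventually_nhds_iff_ball.mp hev
    refine ⟨min r r2, lt_min hr hr2, fun E v hE => ?_⟩
    classical
    have h3 : (E.image k).card = E.card := by
      apply Finset.card_image_of_injOn
      intro a ha b hb hab
      exact hi (ball_subset_ball (min_le_left _ _) (hE a ha).1) (ball_subset_ball (min_le_left _ _) (hE b hb).1) hab
    have h4 : E.image k ⊆ (Polynomial.nthRoots m (v - f c)).toFinset := by
      intro y hy
      obtain ⟨e, he, rfl⟩ := Finset.mem_image.mp hy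
      rw [Multiset.mem_toFinset, Polynomial.mem_nthRoots hm]
      have := h2 e (ball_subset_ball (min_le_right _ _) (hE e he).1)
      rw [← (hE e he).2, this]; ring
    calc E.card = (E.image k).card := h3.symm
      _ ≤ _ := Finset.card_le_card h4
      _ ≤ _ := Multiset.toFinset_card_le _
      _ ≤ m := Polynomial.card_nthRoots _ _
  · have hd := hk.differentiableAt.hasDerivAt
    have hO := hd.isTheta_sub hk'
    obtain ⟨C, hC⟩ := hO.2.bound
    rw [Filter.prod_pure, eventually_map] at hC
    simp only at hC
    refine ⟨|C| ^ m, ?_⟩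
    filter_upwards [hC, hev] with y h1 h2
    rw [h2, hk0, sub_zero] at *
    have e1 : f c + k y ^ m - f c = k y ^ m := by ring
    rw [e1, norm_pow, ← mul_pow]
    refine pow_le_pow_left₀ (norm_nonneg _) ?_ m
    refine h1.trans ?_
    gcongr
    exact le_abs_self C

theorem order_up {f : ℂ → ℂ} {c : ℂ} {m M : ℕ} (hmM : m ≤ M) 
    (h : ∃ C, ∀ᶠ y in nhds c, ‖y - c‖ ^ m ≤ C * ‖f y - f c‖) : ∃ C, ∀ᶠ y in nhds c, ‖y - c‖ ^ M ≤ C * ‖f y - f c‖ := by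
  obtain ⟨C, hC⟩ := h
  refine ⟨C, ?_⟩
  filter_upwards [hC, ball_mem_nhds c one_pos] with y h1 h2
  rw [mem_ball, dist_eq_norm] at h2
  exact (pow_le_pow_of_le_one (norm_nonneg _) h2.le hmM).trans h1

theorem order_one {f : ℂ → ℂ} {c : ℂ} (hf : AnalyticAt ℂ f c) (hd : deriv f c ≠ 0) :
    ∃ C, ∀ᶠ y in nhds c, ‖y - c‖ ^ 1 ≤ C * ‖f y - f c‖ := by
  obtain ⟨C, hC⟩ := (hf.differentiableAt.hasDerivAt.isTheta_sub hd).2.bound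
  rw [Filter.prod_pure, eventually_map] at hC
  exact ⟨C, hC.mono fun y hy => by rwa [pow_one]⟩

theorem uniform_deg {f : ℂ → ℂ} (hf : Differentiable ℂ f) (hnc : ∀ p, ¬ ∀ᶠ z in nhds p, f z = f p) (Cr : Finset ℂ) :
    ∃ m : ℕ, 1 ≤ m ∧ ∀ c ∈ Cr, (∃ ε > 0, ∀ E : Finset ℂ, ∀ v, (∀ e ∈ E, e ∈ ball c ε ∧ f e = v) → E.card ≤ m) ∧
      ∃ C, ∀ᶠ y in nhds c, ‖y - c‖ ^ m ≤ C * ‖f y - f c‖ := by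
  have h : ∀ c, _ := fun c => local_deg (hf.analyticAt c) (hnc c)
  choose m hm h1 h2 using h
  refine ⟨Cr.sup m + 1, by omega, fun c hc => ?_⟩
  have hle : m c ≤ Cr.sup m + 1 := (Finset.le_sup (f := m) hc).trans (by omega)
  refine ⟨?_, order_up hle (h2 c)⟩
  obtain ⟨ε, hε, h⟩ := h1 c
  exact ⟨ε, hε, fun E v hE => (h E v hE).trans hle⟩

structure Comp (f : ℂ → ℂ) (V W : Set ℂ) : Prop where
  isOpen : IsOpen W
  preconn : IsPreconnected W
  ne : W.Nonempty
  sub : ∀ y ∈ W, f y ∈ V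
  max : ∀ C, IsPreconnected C → (∀ y ∈ C, f y ∈ V) → (C ∩ W).Nonempty → C ⊆ W

/-- points of `f⁻¹ V` in closure of `W` are in `W` -/
theorem Comp.mem_of_tendsto {f : ℂ → ℂ} {V W : Set ℂ} (K : Comp f V W) (hf : Continuous f) (hV : IsOpen V)
    {ι : Type*} {l : Filter ι} [l.NeBot] {u : ι → ℂ} {c : ℂ} (hu : Tendsto u l (nhds c)) (hW : ∀ᶠ i in l, u i ∈ W)
    (hc : f c ∈ V) : c ∈ W := by
  obtain ⟨r, hr, hb⟩ := Metric.isOpen_iff.mp (hV.preimage hf) c hc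
  obtain ⟨i, h1, h2⟩ := ((hu.eventually (ball_mem_nhds c hr)).and hW).exists
  exact K.max (ball c r) isPreconnected_ball (fun y hy => hb hy) ⟨u i, h1, h2⟩ (mem_ball_self hr)

theorem Comp.inj_of_lift {f χ T : ℂ → ℂ} {V W : Set ℂ} (K : Comp f V W) (hf : Differentiable ℂ f) {e : ℂ} (heW : e ∈ W)
    (hχ : DifferentiableOn ℂ χ (ball 0 1)) (hi : InjOn χ (ball 0 1)) (him : χ '' ball 0 1 = V)
    (hT : IsLift f χ e 1 T) : InjOn f W := by
  have hTi : InjOn T (ball 0 1) := fun a ha b hb hab => hi ha hb (by rw [← hT.2.2 a ha, ← hT.2.2 b hb, hab])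
  have hA : IsOpen (T '' ball 0 1) := isOpen_image_of_inj isOpen_ball hT.1 hTi
  have hAW : T '' ball 0 1 ⊆ W := by
    refine K.max _ (isPreconnected_ball.image T hT.1.continuousOn) ?_ ⟨e, ⟨0, mem_ball_self one_pos, hT.2.1⟩, heW⟩
    rintro _ ⟨ζ, hζ, rfl⟩
    rw [hT.2.2 ζ hζ, ← him]; exact ⟨ζ, hζ, rfl⟩
  set g := invFunOn χ (ball 0 1) with hg
  have hli : LeftInvOn g χ (ball 0 1) := hi.leftInvOn_invFunOn
  have hgd : DifferentiableOn ℂ g V := him ▸ inv_holo isOpen_ball hχ hi hli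
  have hgm : MapsTo g V (ball 0 1) := by
    rw [← him]; rintro _ ⟨ζ, hζ, rfl⟩; rw [hli hζ]; exact hζ
  have hσ : EqOn (fun y => T (g (f y))) id W := by
    refine id_thm K.isOpen K.preconn ?_ differentiableOn_id hA hAW ⟨e, 0, mem_ball_self one_pos, hT.2.1⟩ ?_
    · exact hT.1.comp (hgd.comp hf.differentiableOn K.sub) fun y hy => hgm (K.sub y hy)
    · rintro _ ⟨ζ, hζ, rfl⟩
      simp only [id]; rw [hT.2.2 ζ hζ, hli hζ]
  intro a ha b hb hab
  have h1 := hσ ha; have h2 := hσ hb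
  simp only [id] at h1 h2
  rw [← h1, ← h2, hab]

theorem Comp.alt {f G : ℂ → ℂ} {V W : Set ℂ} {x : ℂ} {R : ℝ} (K : Comp f V W) (H : HH V G x R)
    (hf : Differentiable ℂ f) (hnc : ∀ p, ¬ ∀ᶠ z in nhds p, f z = f p) (hav : ∀ v ∈ V, ¬ AsymptoticValue f v)
    {w : ℂ} (hw : w ∈ V) : InjOn f W ∨ ∃ χ : ℂ → ℂ, DifferentiableOn ℂ χ (ball 0 1) ∧ InjOn χ (ball 0 1) ∧
      ∀ e ∈ W, f e = w → deriv f e ≠ 0 → ∃ ζ ∈ ball (0:ℂ) 1, ζ ≠ 0 ∧ ∃ T, IsLift f χ e ‖ζ‖ T ∧ ∃ c ∈ W, deriv f c = 0 ∧ f c = χ ζ ∧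
      Tendsto (fun t : ℝ => T ((t:ℂ) * ζ)) (nhdsWithin 1 (Iio 1)) (nhds c) := by
  obtain ⟨χ, hχ, hi, him, h0⟩ := H.rmt hw
  by_cases hI : InjOn f W
  · exact Or.inl hI
  refine Or.inr ⟨χ, hχ, hi, fun e heW hew hde => ?_⟩
  have hχV : ∀ ζ ∈ ball (0:ℂ) 1, χ ζ ∈ V := fun ζ hζ => him ▸ ⟨ζ, hζ, rfl⟩
  rcases lift_alt hf hnc hχ hi (fun ζ hζ => hav _ (hχV ζ hζ)) (show f e = χ 0 by rw [hew, h0]) hde with ⟨T, hT⟩ | ⟨ζ, hζ, hζ0, T, hT, c, hc, hfc, hlim⟩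
  · exact absurd (K.inj_of_lift hf heW hχ hi him hT) hI
  · refine ⟨ζ, hζ, hζ0, T, hT, c, ?_, hc, hfc, hlim⟩
    have hsub : T '' ball 0 ‖ζ‖ ⊆ W := by
      refine K.max _ (isPreconnected_ball.image T hT.1.continuousOn) ?_ ⟨e, ⟨0, mem_ball_self (norm_pos_iff.mpr hζ0), hT.2.1⟩, heW⟩
      rintro _ ⟨η, hη, rfl⟩
      rw [hT.2.2 η hη]
      exact hχV η (by rw [mem_ball_zero_iff] at *; exact hη.trans hζ)
    refine K.mem_of_tendsto hf.continuous H.isOpen hlim ?_ (hfc ▸ hχV ζ hζ)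
    filter_upwards [Ico_mem_nhdsLT (show (0:ℝ) < 1 from one_pos)] with t ht
    exact hsub ⟨_, radial_mem hζ0 ht, rfl⟩

theorem Comp.inj_of_nocrit {f G : ℂ → ℂ} {V W : Set ℂ} {x : ℂ} {R : ℝ} (K : Comp f V W) (H : HH V G x R)
    (hf : Differentiable ℂ f) (hnc : ∀ p, ¬ ∀ᶠ z in nhds p, f z = f p) (hav : ∀ v ∈ V, ¬ AsymptoticValue f v)
    (hcr : ∀ c ∈ W, deriv f c ≠ 0) : InjOn f W := by
  obtain ⟨e, he⟩ := K.ne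
  rcases K.alt H hf hnc hav (K.sub e he) with h | ⟨χ, -, -, h⟩
  · exact h
  · obtain ⟨_, _, _, _, _, c, hcW, hc, _⟩ := h e he rfl (hcr e he)
    exact absurd hc (hcr c hcW)

theorem Comp.card_le {f G : ℂ → ℂ} {V W : Set ℂ} {x : ℂ} {R : ℝ} (K : Comp f V W) (H : HH V G x R)
    (hf : Differentiable ℂ f) (hnc : ∀ p, ¬ ∀ᶠ z in nhds p, f z = f p) (hav : ∀ v ∈ V, ¬ AsymptoticValue f v)
    {Cr : Finset ℂ} (hCr : ∀ c, c ∈ Cr ↔ deriv f c = 0) {m : ℕ}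
    (hm : ∀ c ∈ Cr, (∃ ε > 0, ∀ E : Finset ℂ, ∀ v, (∀ e ∈ E, e ∈ ball c ε ∧ f e = v) → E.card ≤ m))
    {w : ℂ} (E : Finset ℂ) (hE : ∀ e ∈ E, e ∈ W ∧ f e = w) : E.card ≤ Cr.card * (m + 1) + 1 := by
  classical
  rcases E.eq_empty_or_nonempty with h0 | ⟨e0, he0⟩
  · rw [h0]; simp
  have hw : w ∈ V := (hE e0 he0).2 ▸ K.sub _ (hE e0 he0).1
  rcases K.alt H hf hnc hav hw with h | ⟨χ, hχ, hi, h⟩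
  · have : E.card ≤ 1 := Finset.card_le_one.mpr fun a ha b hb => h (hE a ha).1 (hE b hb).1 (by rw [(hE a ha).2, (hE b hb).2])
    omega
  choose! ζ hζ hζ0 T hT c hcW hc hfc hlim using h
  have hsplit := Finset.card_filter_add_card_filter_not (s := E) (fun e => e ∈ Cr)
  have h1 : (E.filter (fun e => e ∈ Cr)).card ≤ Cr.card := Finset.card_le_card fun e he => (Finset.mem_filter.mp he).2
  have h2 : (E.filter (fun e => ¬ e ∈ Cr)).card ≤ Cr.card * m := by
    rw [mul_comm]
    set F := E.filter (fun e => ¬ e ∈ Cr) with hF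
    have hFE : ∀ e ∈ F, e ∈ W ∧ f e = w ∧ deriv f e ≠ 0 := fun e he => by
      rw [hF, Finset.mem_filter, hCr] at he
      exact ⟨(hE e he.1).1, (hE e he.1).2, he.2⟩
    refine Finset.card_le_mul_card_image_of_maps_to (f := c) (fun e he => ?_) m fun b hb => ?_
    · obtain ⟨a1, a2, a3⟩ := hFE e he
      exact (hCr _).mpr (hc e a1 a2 a3)
    · obtain ⟨ε, hε, hcard⟩ := hm b hb
      set F' := F.filter (fun e => c e = b) with hF'
      have hF'' : ∀ e ∈ F', c e = b ∧ e ∈ W ∧ f e = w ∧ deriv f e ≠ 0 := fun e he => by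
        rw [hF', Finset.mem_filter] at he
        exact ⟨he.2, hFE e he.1⟩
      rcases F'.eq_empty_or_nonempty with h0 | ⟨e1, he1⟩
      · rw [h0]; simp
      obtain ⟨b0, b1, b2, b3⟩ := hF'' e1 he1
      have hζe : ∀ e ∈ F', ζ e = ζ e1 := by
        intro e he
        obtain ⟨a0, a1, a2, a3⟩ := hF'' e he
        exact hi (hζ e a1 a2 a3) (hζ e1 b1 b2 b3) (by rw [← hfc e a1 a2 a3, ← hfc e1 b1 b2 b3, a0, b0])
      have hev : ∀ᶠ t : ℝ in nhdsWithin 1 (Iio 1), ∀ e ∈ F', T e ((t:ℂ) * ζ e1) ∈ ball b ε := by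
        rw [Filter.eventually_all_finset]
        intro e he
        obtain ⟨a0, a1, a2, a3⟩ := hF'' e he
        have := hlim e a1 a2 a3
        rw [hζe e he, a0] at this
        exact this.eventually (ball_mem_nhds _ hε)
      obtain ⟨t, ht, htI⟩ := (hev.and (Ico_mem_nhdsLT (show (0:ℝ) < 1 from one_pos))).exists
      have hz0 := hζ0 e1 b1 b2 b3
      have hmem := radial_mem hz0 htI
      have hTe : ∀ e ∈ F', IsLift f χ e ‖ζ e1‖ (T e) := by
        intro e he
        obtain ⟨a0, a1, a2, a3⟩ := hF'' e he
        rw [← hζe e he]; exact hT e a1 a2 a3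
      have hsubb : ball (0:ℂ) ‖ζ e1‖ ⊆ ball 0 1 := ball_subset_ball (by simpa using (mem_ball_zero_iff.mp (hζ e1 b1 b2 b3)).le)
      have hinj : InjOn (fun e => T e ((t:ℂ) * ζ e1)) F' := by
        intro e he e' he' hee
        have := lift_unique hf isOpen_ball isPreconnected_ball (hTe e he).1 (hTe e' he').1
          (fun η hη => by rw [(hTe e he).2.2 η hη, (hTe e' he').2.2 η hη]) hmem hee
          (lift_deriv_ne hf isOpen_ball (hχ.mono hsubb) (hi.mono hsubb) (hTe e he).1 (hTe e he).2.2 hmem)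
        have := this (mem_ball_self (norm_pos_iff.mpr hz0))
        rwa [(hTe e he).2.1, (hTe e' he').2.1] at this
      rw [← Finset.card_image_of_injOn hinj]
      refine hcard _ (χ ((t:ℂ) * ζ e1)) fun y hy => ?_
      obtain ⟨e, he, rfl⟩ := Finset.mem_image.mp hy
      exact ⟨ht e he, (hTe e he).2.2 _ hmem⟩
  nlinarith

open Metric Set Function Filter

theorem Comp.connect {f : ℂ → ℂ} {V W : Set ℂ} (K : Comp f V W) (hV : IsOpen V)
    (hf : Differentiable ℂ f) (hnc : ∀ p, ¬ ∀ᶠ z in nhds p, f z = f p) (hav : ∀ v ∈ V, ¬ AsymptoticValue f v)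
    (hcrit : {c : ℂ | deriv f c = 0}.Finite) {w : ℂ} (hw : w ∈ V) :
    ∃ δ > 0, ∀ y ∈ W, ‖f y - w‖ < δ → ∃ p ∈ W, f p = w ∧ ∃ C, IsPreconnected C ∧ y ∈ C ∧ p ∈ C ∧
      ∀ z ∈ C, ‖f z - w‖ ≤ 2 * ‖f y - w‖ := by
  have h1 : ∀ᶠ v in nhds w, v ∈ V ∧ v ∉ (f '' {c : ℂ | deriv f c = 0}) \ {w} := by
    have hfin : ((f '' {c : ℂ | deriv f c = 0}) \ {w}).Finite := (hcrit.image f).diff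
    filter_upwards [hV.mem_nhds hw, hfin.isClosed.isOpen_compl.mem_nhds (show w ∈ _ from fun h => h.2 rfl)] with v a b using ⟨a, b⟩
  obtain ⟨d, hd, hb⟩ := Metric.eventually_nhds_iff_ball.mp h1
  refine ⟨d / 2, by positivity, fun y hy hyd => ?_⟩
  by_cases hyw : f y = w
  · exact ⟨y, hy, hyw, {y}, isPreconnected_singleton, rfl, rfl, by rintro z rfl; rw [hyw]; simp⟩
  have hpos : 0 < ‖f y - w‖ := norm_pos_iff.mpr (sub_ne_zero.mpr hyw)
  set χ : ℂ → ℂ := fun ζ => f y + (w - f y) * ζ with hχdef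
  have hχd : Differentiable ℂ χ := by fun_prop
  have hχi : InjOn χ (ball 0 1) := by
    intro a _ b _ hab
    have : (w - f y) * a = (w - f y) * b := by simpa [hχdef] using hab
    exact mul_left_cancel₀ (sub_ne_zero.mpr (Ne.symm hyw)) this
  have hχw : ∀ ζ, χ ζ - w = (f y - w) * (1 - ζ) := fun ζ => by simp only [hχdef]; ring
  have hχn : ∀ ζ ∈ ball (0:ℂ) 1, ‖χ ζ - w‖ ≤ 2 * ‖f y - w‖ := by
    intro ζ hζ
    rw [hχw, norm_mul]
    rw [mem_ball_zero_iff] at hζ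
    have : ‖1 - ζ‖ ≤ 2 := (norm_sub_le _ _).trans (by rw [norm_one]; linarith)
    nlinarith
  have hχb : ∀ ζ ∈ ball (0:ℂ) 1, χ ζ ∈ ball w d := by
    intro ζ hζ
    rw [mem_ball, dist_eq_norm]; linarith [hχn ζ hζ]
  have hχne : ∀ ζ ∈ ball (0:ℂ) 1, χ ζ ≠ w := by
    intro ζ hζ h
    have := hχw ζ
    rw [h, sub_self, eq_comm, mul_eq_zero] at this
    rcases this with h | h
    · exact hyw (sub_eq_zero.mp h)
    · rw [mem_ball_zero_iff, ← sub_eq_zero.mp h, norm_one] at hζ; exact lt_irrefl _ hζ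
  have hnc' : ∀ c, ∀ ζ ∈ ball (0:ℂ) 1, f c = χ ζ → deriv f c ≠ 0 := fun c ζ hζ h hc =>
    (hb _ (hχb ζ hζ)).2 ⟨⟨c, hc, h⟩, hχne ζ hζ⟩
  have h0 : f y = χ 0 := by simp [hχdef]
  rcases lift_alt hf hnc hχd.differentiableOn hχi (fun ζ hζ => hav _ (hb _ (hχb ζ hζ)).1) h0 (hnc' y 0 (mem_ball_self one_pos) h0) with ⟨T, hT⟩ | ⟨ζ, hζ, _, _, _, c, hc, hfc, _⟩
  swap
  · exact absurd hc (hnc' c ζ hζ hfc)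
  have hmem : ∀ t ∈ Ico (0:ℝ) 1, (t:ℂ) * 1 ∈ ball (0:ℂ) 1 := fun t ht => by simpa using radial_mem (one_ne_zero (α := ℂ)) ht
  have hIev : ∀ᶠ t in nhdsWithin (1:ℝ) (Iio 1), t ∈ Ico (0:ℝ) 1 := Ico_mem_nhdsLT one_pos
  have hlim : Tendsto (fun t : ℝ => f (T ((t:ℂ) * 1))) (nhdsWithin 1 (Iio 1)) (nhds w) := by
    have h2 := (hχd.continuous.tendsto 1).comp (radial_tendsto (ζ := 1))
    have h3 : χ 1 = w := by simp [hχdef]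
    rw [h3] at h2
    refine h2.congr' ?_
    filter_upwards [hIev] with t ht
    exact (hT.2.2 _ (hmem t ht)).symm
  obtain ⟨p, hp, hpt⟩ := curve_lim hf hnc (γ := fun t : ℝ => T ((t:ℂ) * 1))
      (hT.1.continuousOn.comp (by fun_prop) hmem) hlim (hav w hw)
  have hpc : p ∈ closure (T '' ball 0 1) := mem_closure_of_tendsto hpt (hIev.mono fun t ht => ⟨_, hmem t ht, rfl⟩)
  have hCp : IsPreconnected (insert p (T '' ball 0 1)) :=
    (isPreconnected_ball.image T hT.1.continuousOn).subset_closure (subset_insert _ _) (insert_subset hpc subset_closure)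
  have hyT : y ∈ T '' ball 0 1 := ⟨0, mem_ball_self one_pos, hT.2.1⟩
  have hCb : ∀ z ∈ insert p (T '' ball 0 1), ‖f z - w‖ ≤ 2 * ‖f y - w‖ := by
    rintro z (rfl | ⟨ζ, hζ, rfl⟩)
    · rw [hp, sub_self, norm_zero]; positivity
    · rw [hT.2.2 ζ hζ]; exact hχn ζ hζ
  have hCW : insert p (T '' ball 0 1) ⊆ W := by
    refine K.max _ hCp (fun z hz => (hb _ ?_).1) ⟨y, mem_insert_of_mem _ hyT, hy⟩
    rw [mem_ball, dist_eq_norm]; linarith [hCb z hz]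
  exact ⟨p, hCW (mem_insert _ _), hp, _, hCp, mem_insert_of_mem _ hyT, mem_insert _ _, hCb⟩

theorem finite_of_card_le {S : Set ℂ} {N : ℕ} (h : ∀ E : Finset ℂ, (∀ e ∈ E, e ∈ S) → E.card ≤ N) : S.Finite := by
  by_contra hS
  obtain ⟨E, hE, hc⟩ := Set.Infinite.exists_subset_card_eq hS (N+1)
  have := h E fun e he => hE he
  omega

theorem Comp.hh {f G : ℂ → ℂ} {V W : Set ℂ} {x : ℂ} {R : ℝ} (K : Comp f V W) (H : HH V G x R)
    (hf : Differentiable ℂ f) (hnc : ∀ p, ¬ ∀ᶠ z in nhds p, f z = f p) (hav : ∀ v ∈ V, ¬ AsymptoticValue f v)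
    (hcrit : {c : ℂ | deriv f c = 0}.Finite) : HH W (fun y => G (f y)) x R where
  isOpen := K.isOpen
  conn := ⟨K.ne, K.preconn⟩
  diff := H.diff.comp hf
  pos := H.pos
  maps := fun y hy => H.maps _ (K.sub y hy)
  cpt := by
    intro s hs
    rw [isCompact_iff_ultrafilter_le_nhds]
    intro U hU
    rw [le_principal_iff] at hU
    have hKc := H.cpt s hs
    rw [isCompact_iff_ultrafilter_le_nhds] at hKc
    obtain ⟨w, hw, hUw⟩ := hKc (U.map f) (by
      rw [le_principal_iff, Ultrafilter.coe_map, mem_map]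
      filter_upwards [hU] with y hy using ⟨K.sub y hy.1, hy.2⟩)
    have hUw' : Tendsto f U (nhds w) := hUw
    obtain ⟨δ, hδ, hcon⟩ := K.connect H.isOpen hf hnc hav hcrit hw.1
    choose! p hpW hpw C hC hyC hpC hCb using hcon
    have hZ : {p | p ∈ W ∧ f p = w}.Finite := by
      obtain ⟨m, -, hm⟩ := uniform_deg hf hnc hcrit.toFinset
      exact finite_of_card_le fun E hE => K.card_le H hf hnc hav (Cr := hcrit.toFinset) (fun c => by simp) (fun c hc => (hm c hc).1) E hE
    have hev1 : ∀ᶠ y in (U : Filter ℂ), y ∈ W ∧ ‖f y - w‖ < δ := by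
      filter_upwards [hU, hUw'.eventually (ball_mem_nhds _ hδ)] with y h1 h2
      exact ⟨h1.1, by rwa [dist_eq_norm] at h2⟩
    have hex : ∃ e ∈ {p | p ∈ W ∧ f p = w}, ∀ᶠ y in (U : Filter ℂ), p y = e := by
      have : (⋃ e ∈ {p | p ∈ W ∧ f p = w}, {y | p y = e}) ∈ U := by
        filter_upwards [hev1] with y hy
        simp only [mem_iUnion]
        exact ⟨p y, ⟨hpW y hy.1 hy.2, hpw y hy.1 hy.2⟩, rfl⟩
      obtain ⟨e, he, h⟩ := (Ultrafilter.finite_biUnion_mem_iff hZ).mp this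
      exact ⟨e, he, h⟩
    obtain ⟨e, ⟨heW, hew⟩, hpe⟩ := hex
    refine ⟨e, ⟨heW, by rw [hew]; exact hw.2⟩, ?_⟩
    rw [Metric.nhds_basis_ball.ge_iff]
    intro d hd
    obtain ⟨r, hr, hrd, -, ε, hε, hsp⟩ := exists_sphere_bound isOpen_univ hf.differentiableOn (mem_univ e) (isolated_of_nc hf (hnc e)) hd
    filter_upwards [hev1, hpe, hUw'.eventually (ball_mem_nhds _ (half_pos hε))] with y h1 h2 h3
    rw [dist_eq_norm] at h3
    have hsub := subset_ball_of_sphere (hC y h1.1 h1.2) (hpC y h1.1 h1.2) (p := e) (r := r) (by rw [h2]; exact mem_ball_self hr) (by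
      intro z hz hs
      have h4 := hsp z hs
      have h5 := hCb y h1.1 h1.2 z hz
      rw [hew] at h4
      linarith)
    exact ball_subset_ball hrd.le (hsub (hyC y h1.1 h1.2))

open Metric Set Function Filter

structure Std (f : ℂ → ℂ) (Cr : Finset ℂ) (m : ℕ) : Prop where
  diff : Differentiable ℂ f
  nc : ∀ p, ¬ ∀ᶠ z in nhds p, f z = f p
  hCr : ∀ c, c ∈ Cr ↔ deriv f c = 0
  m1 : 1 ≤ m
  cnt : ∀ c ∈ Cr, ∃ ε > 0, ∀ E : Finset ℂ, ∀ v, (∀ e ∈ E, e ∈ ball c ε ∧ f e = v) → E.card ≤ m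
  ord : ∀ c ∈ Cr, ∃ C, ∀ᶠ y in nhds c, ‖y - c‖ ^ m ≤ C * ‖f y - f c‖

theorem Std.openMap {f : ℂ → ℂ} {Cr : Finset ℂ} {m : ℕ} (St : Std f Cr m) : IsOpenMap f := by
  refine IsOpenMap.of_nhds_le fun z => ?_
  rcases (St.diff.analyticAt z).eventually_constant_or_nhds_le_map_nhds with h | h
  · exact absurd h (St.nc z)
  · exact h

theorem Std.openMap_iter {f : ℂ → ℂ} {Cr : Finset ℂ} {m : ℕ} (St : Std f Cr m) (i : ℕ) : IsOpenMap f^[i] := by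
  induction i with
  | zero => exact IsOpenMap.id
  | succ i ih => rw [iterate_succ]; exact ih.comp St.openMap

def VL (f : ℂ → ℂ) (i : ℕ) (B : Set ℂ) (p : ℂ) : Set ℂ := connectedComponentIn (f^[i] ⁻¹' B) p

theorem VL_sub {f : ℂ → ℂ} {i : ℕ} {B : Set ℂ} {p y : ℂ} (h : y ∈ VL f i B p) : f^[i] y ∈ B :=
  (connectedComponentIn_subset (f^[i] ⁻¹' B) p h : y ∈ f^[i] ⁻¹' B)

theorem VL_self {f : ℂ → ℂ} {i : ℕ} {B : Set ℂ} {p : ℂ} (h : f^[i] p ∈ B) : p ∈ VL f i B p := mem_connectedComponentIn h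

theorem VL_mem {f : ℂ → ℂ} {i : ℕ} {B : Set ℂ} {p y : ℂ} (h : y ∈ VL f i B p) : f^[i] p ∈ B := by
  by_contra h'
  rw [VL, connectedComponentIn_eq_empty (F := f^[i] ⁻¹' B) h'] at h
  exact h

theorem VL_eq {f : ℂ → ℂ} {i : ℕ} {B : Set ℂ} {p y : ℂ} (h : y ∈ VL f i B p) : VL f i B p = VL f i B y := connectedComponentIn_eq h

theorem VL_preconn {f : ℂ → ℂ} {i : ℕ} {B : Set ℂ} {p : ℂ} : IsPreconnected (VL f i B p) := isPreconnected_connectedComponentIn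

theorem VL_max {f : ℂ → ℂ} {i : ℕ} {B : Set ℂ} {p : ℂ} {C : Set ℂ} (hC : IsPreconnected C) (hs : ∀ y ∈ C, f^[i] y ∈ B)
    (hne : (C ∩ VL f i B p).Nonempty) : C ⊆ VL f i B p := by
  obtain ⟨y, h1, h2⟩ := hne
  rw [VL_eq h2]
  exact hC.subset_connectedComponentIn h1 hs

theorem VL_mono {f : ℂ → ℂ} {i : ℕ} {B B' : Set ℂ} {p : ℂ} (h : B ⊆ B') : VL f i B p ⊆ VL f i B' p :=
  connectedComponentIn_mono _ (preimage_mono h)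

theorem VL_image {f : ℂ → ℂ} (hf : Continuous f) {j l : ℕ} {B : Set ℂ} {p y : ℂ} (h : y ∈ VL f (j + l) B p) :
    f^[l] y ∈ VL f j B (f^[l] p) := by
  have hp := VL_mem h
  have h1 : f^[l] '' VL f (j+l) B p ⊆ VL f j B (f^[l] p) := by
    refine VL_max (VL_preconn.image _ (hf.iterate l).continuousOn) ?_ ⟨f^[l] p, ⟨p, VL_self hp, rfl⟩, VL_self ?_⟩
    · rintro _ ⟨z, hz, rfl⟩
      rw [← iterate_add_apply]; exact VL_sub hz
    · rw [← iterate_add_apply]; exact hp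
  exact h1 ⟨y, h, rfl⟩

theorem VL_open {f : ℂ → ℂ} (hf : Continuous f) {i : ℕ} {B : Set ℂ} (hB : IsOpen B) {p : ℂ} : IsOpen (VL f i B p) :=
  (hB.preimage (hf.iterate i)).connectedComponentIn

theorem VL_comp {f : ℂ → ℂ} (hf : Continuous f) {i : ℕ} {B : Set ℂ} (hB : IsOpen B) {p : ℂ} (hp : f^[i+1] p ∈ B) :
    Comp f (VL f i B (f p)) (VL f (i+1) B p) where
  isOpen := VL_open hf hB
  preconn := VL_preconn
  ne := ⟨p, VL_self hp⟩
  sub := fun y hy => VL_image (l := 1) hf hy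
  max := fun C hC hs hne => VL_max hC (fun y hy => by rw [iterate_succ_apply]; exact VL_sub (hs y hy)) hne

theorem hh_ball {x : ℂ} {ρ : ℝ} (hρ : 0 < ρ) : HH (ball x ρ) id x ρ where
  isOpen := isOpen_ball
  conn := ⟨⟨x, mem_ball_self hρ⟩, isPreconnected_ball⟩
  diff := differentiable_id
  pos := hρ
  maps := fun y hy => by simpa [dist_eq_norm] using hy
  cpt := by
    intro s hs
    have : {y | y ∈ ball x ρ ∧ ‖id y - x‖ ≤ s} = closedBall x s := by
      ext y; simp only [mem_setOf_eq, mem_ball, mem_closedBall, dist_eq_norm, id]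
      exact ⟨fun h => h.2, fun h => ⟨h.trans_lt hs, h⟩⟩
    rw [this]; exact isCompact_closedBall _ _

def AvoidsAsym (f : ℂ → ℂ) (B : Set ℂ) : Prop := ∀ a, AsymptoticValue f a → ∀ k, f^[k] a ∉ B

theorem VL_noasym {f : ℂ → ℂ} {B : Set ℂ} (h : AvoidsAsym f B) {i : ℕ} {p : ℂ} : ∀ v ∈ VL f i B p, ¬ AsymptoticValue f v :=
  fun v hv ha => h v ha i (VL_sub hv)

theorem Std.hh {f : ℂ → ℂ} {Cr : Finset ℂ} {m : ℕ} (St : Std f Cr m) {x : ℂ} {ρ : ℝ} (hρ : 0 < ρ) (hA : AvoidsAsym f (ball x ρ)) :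
    ∀ (i : ℕ) (p : ℂ), f^[i] p ∈ ball x ρ → HH (VL f i (ball x ρ) p) f^[i] x ρ := by
  intro i
  induction i with
  | zero =>
    intro p hp
    have : VL f 0 (ball x ρ) p = ball x ρ := isPreconnected_ball.connectedComponentIn hp
    rw [this]; exact hh_ball hρ
  | succ i ih =>
    intro p hp
    refine (VL_comp St.diff.continuous isOpen_ball hp).hh (ih (f p) hp) St.diff St.nc (VL_noasym hA) ?_
    exact Cr.finite_toSet.subset fun c hc => (St.hCr c).mpr hc

def GoodUpTo (f : ℂ → ℂ) (Cr : Finset ℂ) (B : Set ℂ) (k : ℕ) : Prop :=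
  ∀ c ∈ Cr, ∀ j l, 1 ≤ j → 1 ≤ l → j + l ≤ k → f^[l] c ∉ VL f j B c

theorem GoodUpTo.mono {f : ℂ → ℂ} {Cr : Finset ℂ} {B : Set ℂ} {k k' : ℕ} (h : GoodUpTo f Cr B k) (hk : k' ≤ k) :
    GoodUpTo f Cr B k' := fun c hc j l hj hl hjl => h c hc j l hj hl (hjl.trans hk)

theorem order_comp {f G : ℂ → ℂ} {a : ℂ} {m M : ℕ} (hf : ContinuousAt f a)
    (h1 : ∃ C, ∀ᶠ y in nhds a, ‖y - a‖ ^ m ≤ C * ‖f y - f a‖)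
    (h2 : ∃ C, ∀ᶠ y in nhds (f a), ‖y - f a‖ ^ M ≤ C * ‖G y - G (f a)‖) :
    ∃ C, ∀ᶠ y in nhds a, ‖y - a‖ ^ (M * m) ≤ C * ‖G (f y) - G (f a)‖ := by
  obtain ⟨C, hC⟩ := h1
  obtain ⟨C', hC'⟩ := h2
  refine ⟨|C| ^ M * C', ?_⟩
  filter_upwards [hC, hf.eventually hC'] with y a1 a2
  rw [mul_comm M m, pow_mul]
  calc (‖y - a‖ ^ m) ^ M ≤ (|C| * ‖f y - f a‖) ^ M := by
        refine pow_le_pow_left₀ (by positivity) (a1.trans ?_) M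
        gcongr; exact le_abs_self C
    _ = |C| ^ M * ‖f y - f a‖ ^ M := by rw [mul_pow]
    _ ≤ |C| ^ M * (C' * ‖G (f y) - G (f a)‖) := by gcongr
    _ = _ := by ring

theorem Std.levels {f : ℂ → ℂ} {Cr : Finset ℂ} {m : ℕ} (St : Std f Cr m) {x : ℂ} {ρ : ℝ} (hρ : 0 < ρ) (hA : AvoidsAsym f (ball x ρ))
    {k : ℕ} (hG : GoodUpTo f Cr (ball x ρ) k) :
    ∀ (i : ℕ), i ≤ k → ∀ p : ℂ, f^[i] p ∈ ball x ρ → ∃ S : Finset ℂ, S ⊆ Cr ∧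
      (∀ c ∈ S, ∃ j l, 1 ≤ j ∧ j + l = i ∧ c ∈ VL f j (ball x ρ) (f^[l] p)) ∧
      (∀ E : Finset ℂ, ∀ w, (∀ e ∈ E, e ∈ VL f i (ball x ρ) p ∧ f^[i] e = w) → E.card ≤ (Cr.card * (m + 1) + 1) ^ S.card) ∧
      ∀ a ∈ VL f i (ball x ρ) p, ∃ C, ∀ᶠ y in nhds a, ‖y - a‖ ^ (m ^ S.card) ≤ C * ‖f^[i] y - f^[i] a‖ := by
  classical
  intro i
  induction i with
  | zero =>
    intro _ p hp
    refine ⟨∅, by simp, by simp, ?_, ?_⟩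
    · intro E w hE
      simp only [Finset.card_empty, pow_zero]
      exact Finset.card_le_one.mpr fun a ha b hb => by
        have h1 := (hE a ha).2; have h2 := (hE b hb).2
        simp only [iterate_zero, id] at h1 h2; rw [h1, h2]
    · intro a _
      exact ⟨1, Eventually.of_forall fun y => by simp⟩
  | succ i ih =>
    intro hik p hp
    obtain ⟨S, hS, hSl, hSc, hSo⟩ := ih (by omega) (f p) hp
    have K := VL_comp St.diff.continuous isOpen_ball hp
    have H := St.hh hρ hA i (f p) hp
    have hlev : ∀ c ∈ S, ∃ j l, 1 ≤ j ∧ 1 ≤ l ∧ j + l = i + 1 ∧ c ∈ VL f j (ball x ρ) (f^[l] p) := by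
      intro c hc
      obtain ⟨j, l, hj, hjl, hm⟩ := hSl c hc
      exact ⟨j, l+1, hj, by omega, by omega, by rwa [iterate_succ_apply]⟩
    by_cases hcr : ∃ c ∈ VL f (i+1) (ball x ρ) p, deriv f c = 0
    · obtain ⟨c, hcW, hc⟩ := hcr
      have hcS : c ∉ S := by
        intro hcS
        obtain ⟨j, l, hj, hl, hjl, hm⟩ := hlev c hcS
        refine hG c (hS hcS) j l hj hl (by omega) ?_
        rw [← VL_eq hm]
        exact VL_image St.diff.continuous (hjl ▸ hcW)
      have hcard : (insert c S).card = S.card + 1 := Finset.card_insert_of_notMem hcS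
      refine ⟨insert c S, ?_, ?_, ?_, ?_⟩
      · exact Finset.insert_subset ((St.hCr c).mpr hc) hS
      · intro c' hc'
        rcases Finset.mem_insert.mp hc' with rfl | h
        · exact ⟨i+1, 0, by omega, by omega, hcW⟩
        · obtain ⟨j, l, hj, hl, hjl, hm⟩ := hlev c' h
          exact ⟨j, l, hj, hjl, hm⟩
      · intro E w hE
        rw [hcard, pow_succ']
        refine (Finset.card_le_mul_card_image (f := f) E (Cr.card * (m + 1) + 1) fun b hb => ?_).trans ?_
        · exact K.card_le H St.diff St.nc (VL_noasym hA) St.hCr St.cnt (w := b) _ fun e he =>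
            ⟨(hE e (Finset.mem_filter.mp he).1).1, (Finset.mem_filter.mp he).2⟩
        · refine Nat.mul_le_mul_left _ (hSc _ w fun e he => ?_)
          obtain ⟨e', he', rfl⟩ := Finset.mem_image.mp he
          exact ⟨K.sub _ (hE e' he').1, (hE e' he').2⟩
      · intro a ha
        rw [hcard, pow_succ]
        refine order_comp (G := f^[i]) (St.diff a).continuousAt ?_ (hSo (f a) (K.sub a ha))
        by_cases hda : deriv f a = 0
        · exact St.ord a ((St.hCr a).mpr hda)
        · exact order_up St.m1 (order_one (St.diff.analyticAt a) hda)
    · push Not at hcr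
      refine ⟨S, hS, ?_, ?_, ?_⟩
      · intro c hc
        obtain ⟨j, l, hj, hl, hjl, hm⟩ := hlev c hc
        exact ⟨j, l, hj, hjl, hm⟩
      · intro E w hE
        have hinj := K.inj_of_nocrit H St.diff St.nc (VL_noasym hA) hcr
        rw [← Finset.card_image_of_injOn (f := f) (s := E) fun a ha b hb => hinj (hE a ha).1 (hE b hb).1]
        refine hSc _ w fun e he => ?_
        obtain ⟨e', he', rfl⟩ := Finset.mem_image.mp he
        exact ⟨K.sub _ (hE e' he').1, (hE e' he').2⟩
      · intro a ha
        have := order_comp (G := f^[i]) (St.diff a).continuousAt (order_one (St.diff.analyticAt a) (hcr a ha)) (hSo (f a) (K.sub a ha))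
        rwa [mul_one] at this

/-- Combined distortion estimate. -/
theorem Std.E' {f : ℂ → ℂ} {Cr : Finset ℂ} {m : ℕ} (St : Std f Cr m) : ∃ A : ℝ, 4 ≤ A ∧ ∃ N : ℕ, 
    ∀ (x : ℂ) (ρ : ℝ), 0 < ρ → AvoidsAsym f (ball x ρ) → ∀ k, GoodUpTo f Cr (ball x ρ) k → ∀ i ≤ k, ∀ p, f^[i] p ∈ ball x ρ →
    (∀ E : Finset ℂ, ∀ w, (∀ e ∈ E, e ∈ VL f i (ball x ρ) p ∧ f^[i] e = w) → E.card ≤ N) ∧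
    ∃ Z : Finset ℂ, Z.card ≤ N ∧ (∀ a, a ∈ Z ↔ a ∈ VL f i (ball x ρ) p ∧ f^[i] a = x) ∧
      ∀ q ∈ VL f i (ball x ρ) p, ‖f^[i] q - x‖ ≤ ρ / A → ∃ a ∈ Z, dist q a ≤ infDist a (VL f i (ball x ρ) p)ᶜ / 2 := by
  set N := (Cr.card * (m + 1) + 1) ^ Cr.card with hN
  set M := m ^ Cr.card with hM
  refine ⟨3 * 60 ^ ((N+1) * (M + 1)), ?_, N+1, ?_⟩
  · have : (60:ℝ) ^ 1 ≤ 60 ^ ((N+1) * (M+1)) := pow_le_pow_right₀ (by norm_num) (by nlinarith)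
    linarith
  intro x ρ hρ hA k hG i hi p hp
  obtain ⟨S, hS, -, hSc, hSo⟩ := St.levels hρ hA hG i hi p hp
  have hSC := Finset.card_le_card hS
  have hfin : {a | a ∈ VL f i (ball x ρ) p ∧ f^[i] a = x}.Finite := finite_of_card_le fun E hE => hSc E x hE
  have hZ : ∀ a, a ∈ hfin.toFinset ↔ a ∈ VL f i (ball x ρ) p ∧ f^[i] a = x := fun a => by simp
  have hcard : hfin.toFinset.card ≤ N := (hSc _ x fun e he => (hZ e).mp he).trans (Nat.pow_le_pow_right (by omega) hSC)
  refine ⟨fun E w hE => (hSc E w hE).trans ((Nat.pow_le_pow_right (by omega) hSC).trans (by omega)), hfin.toFinset, by omega, hZ, fun q hq hqx => ?_⟩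
  refine (St.hh hρ hA i p hp).lemE (N := N+1) (M := M) hfin.toFinset hZ (by omega) ?_ hq hqx
  intro a ha hax
  have := order_up (Nat.pow_le_pow_right St.m1 hSC) (hSo a ha)
  rwa [hax] at this

theorem HH.onto {V : Set ℂ} {G : ℂ → ℂ} {x : ℂ} {R : ℝ} (H : HH V G x R) (hop : IsOpenMap G) {O : Set ℂ} (hO : IsOpen O)
    (hOc : IsPreconnected O) (hOR : O ⊆ ball x R) {q : ℂ} (hq : q ∈ V) (hqO : G q ∈ O) :
    O ⊆ G '' connectedComponentIn (G ⁻¹' O ∩ V) q := by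
  set C := connectedComponentIn (G ⁻¹' O ∩ V) q with hC
  have hopn : IsOpen (G ⁻¹' O ∩ V) := (hO.preimage H.diff.continuous).inter H.isOpen
  have hCo : IsOpen C := hopn.connectedComponentIn
  have hqC : q ∈ C := mem_connectedComponentIn ⟨hqO, hq⟩
  refine hOc.subset_of_closure_inter_subset (hop _ hCo) ⟨G q, hqO, q, hqC, rfl⟩ ?_
  rintro v ⟨hv, hvO⟩
  have hvR : ‖v - x‖ < R := by simpa [dist_eq_norm] using hOR hvO
  obtain ⟨s, hs1, hs2⟩ := exists_between hvR
  obtain ⟨u, hu, hut⟩ := mem_closure_iff_seq_limit.mp hv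
  choose y hy hyu using hu
  have hev : ∀ᶠ n in atTop, y n ∈ {y | y ∈ V ∧ ‖G y - x‖ ≤ s} := by
    have h1 : Tendsto (fun n => ‖u n - x‖) atTop (nhds ‖v - x‖) := (hut.sub_const x).norm
    filter_upwards [h1.eventually (gt_mem_nhds hs1)] with n hn
    exact ⟨(connectedComponentIn_subset _ _ (hy n)).2, by rw [hyu]; exact hn.le⟩
  obtain ⟨b, hb, φ, hφ, hlim⟩ := (H.cpt s hs2).tendsto_subseq' hev.frequently
  have hGb : G b = v := by
    have h1 := (H.diff.continuous.tendsto b).comp hlim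
    have h2 : Tendsto (G ∘ y ∘ φ) atTop (nhds v) := by
      have := hut.comp hφ.tendsto_atTop
      refine this.congr fun n => ?_
      simp [hyu]
    exact tendsto_nhds_unique h1 h2
  refine ⟨b, ?_, hGb⟩
  have hbm : b ∈ G ⁻¹' O ∩ V := ⟨by rw [mem_preimage, hGb]; exact hvO, hb.1⟩
  obtain ⟨r, hr, hbr⟩ := Metric.isOpen_iff.mp hopn b hbm
  obtain ⟨n, hn⟩ := (hlim.eventually (ball_mem_nhds b hr)).exists
  have h3 : y (φ n) ∈ C := hy _
  rw [hC, connectedComponentIn_eq h3]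
  exact isPreconnected_ball.subset_connectedComponentIn hn hbr (mem_ball_self hr)

open Metric Set Function Filter

def touchGraph (V : Set ℂ) (r : ℂ → ℝ) (P : Finset ℂ) : SimpleGraph P where
  Adj a b := a ≠ b ∧ ∃ v ∈ V, dist v a ≤ r a / 2 ∧ dist v b ≤ r b / 2
  symm := ⟨fun a b ⟨h, v, hv, h1, h2⟩ => ⟨h.symm, v, hv, h2, h1⟩⟩
  loopless := ⟨fun a h => h.1 rfl⟩

theorem chain_walk {V : Set ℂ} {r : ℂ → ℝ} {P : Finset ℂ} (h0 : ∀ a, 0 ≤ r a)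
    (hr : ∀ a b v, dist v a ≤ r a / 2 → dist v b ≤ r b / 2 → r b ≤ 3 * r a) {a b : P} (w : (touchGraph V r P).Walk a b) :
    r b ≤ 3 ^ w.length * r a ∧ dist (a:ℂ) b ≤ w.length * 3 ^ w.length * r a := by
  induction w with
  | nil => simp
  | @cons a a' b h w ih =>
    have h' := h
    obtain ⟨-, v, hv, h1, h2⟩ := h'
    have h3 := hr _ _ v h1 h2
    have h4 : dist (a:ℂ) a' ≤ r a / 2 + r a' / 2 := (dist_triangle_left _ _ v).trans (by linarith)
    have hp : (1:ℝ) ≤ 3 ^ w.length := one_le_pow₀ (by norm_num)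
    have h5 : (3:ℝ) ^ w.length * r a' ≤ 3 ^ w.length * (3 * r a) := by gcongr
    have h6 : (w.length:ℝ) * 3 ^ w.length * r a' ≤ (w.length:ℝ) * 3 ^ w.length * (3 * r a) := by gcongr
    have h7 := dist_triangle (a:ℂ) a' b
    have h8 : 1 * r a ≤ 3 ^ w.length * r a := by gcongr; exact h0 _
    simp only [SimpleGraph.Walk.length_cons]
    push_cast
    rw [pow_succ]
    constructor
    · linarith [ih.1]
    · linarith [ih.2, h0 a]

theorem chain_R {V V2 : Set ℂ} (hV : IsPreconnected V) {P : Finset ℂ} {K : ℕ} (hK : P.card ≤ K)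
    (hcov : ∀ v ∈ V, ∃ a ∈ P, dist v a ≤ infDist a V2ᶜ / 2) {u v : ℂ} (hu : u ∈ V) (hv : v ∈ V) :
    infDist v V2ᶜ ≤ 3 ^ (K + 1) * infDist u V2ᶜ ∧ dist u v ≤ 2 * (K + 1) * 3 ^ K * infDist u V2ᶜ := by
  classical
  set r : ℂ → ℝ := fun a => infDist a V2ᶜ with hr
  have h0 : ∀ a, 0 ≤ r a := fun a => infDist_nonneg
  have hlip : ∀ a b, r a ≤ r b + dist a b := fun a b => infDist_le_infDist_add_dist
  have hrat : ∀ a b v, dist v a ≤ r a / 2 → dist v b ≤ r b / 2 → r b ≤ 3 * r a := by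
    intro a b v h1 h2
    have h3 := hlip b v; have h4 := hlip v a
    rw [dist_comm] at h3
    linarith
  obtain ⟨a, haP, ha⟩ := hcov u hu
  set Γ := touchGraph V r P
  have key : ∃ b : P, Γ.Reachable ⟨a, haP⟩ b ∧ dist v b ≤ r b / 2 := by
    by_contra hcon
    push Not at hcon
    set A1 : Set ℂ := ⋃ b ∈ {b : P | Γ.Reachable ⟨a, haP⟩ b}, closedBall (b:ℂ) (r b / 2)
    set A2 : Set ℂ := ⋃ b ∈ {b : P | ¬ Γ.Reachable ⟨a, haP⟩ b}, closedBall (b:ℂ) (r b / 2)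
    have hA1 : IsClosed A1 := (Set.toFinite _).isClosed_biUnion fun b _ => isClosed_closedBall
    have hA2 : IsClosed A2 := (Set.toFinite _).isClosed_biUnion fun b _ => isClosed_closedBall
    have hA1m : ∀ w, w ∈ A1 ↔ ∃ b : P, Γ.Reachable ⟨a, haP⟩ b ∧ dist w b ≤ r b / 2 := by
      intro w; simp only [A1, mem_iUnion₂, mem_setOf_eq, mem_closedBall, exists_prop]
    have hA2m : ∀ w, w ∈ A2 ↔ ∃ b : P, ¬ Γ.Reachable ⟨a, haP⟩ b ∧ dist w b ≤ r b / 2 := by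
      intro w; simp only [A2, mem_iUnion₂, mem_setOf_eq, mem_closedBall, exists_prop]
    have hcover : V ⊆ A1 ∪ A2 := by
      intro w hw
      obtain ⟨b, hb, hd⟩ := hcov w hw
      by_cases h : Γ.Reachable ⟨a, haP⟩ ⟨b, hb⟩
      · exact Or.inl ((hA1m w).mpr ⟨⟨b, hb⟩, h, hd⟩)
      · exact Or.inr ((hA2m w).mpr ⟨⟨b, hb⟩, h, hd⟩)
    have hv1 : v ∉ A1 := by
      rw [hA1m]; rintro ⟨b, hb, hd⟩
      exact absurd hd (not_le.mpr (hcon b hb))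
    obtain ⟨w, hwV, hw1, hw2⟩ := isPreconnected_closed_iff.mp hV A1 A2 hA1 hA2 hcover
      ⟨u, hu, (hA1m u).mpr ⟨⟨a, haP⟩, SimpleGraph.Reachable.refl _, ha⟩⟩
      ⟨v, hv, (hcover hv).resolve_left hv1⟩
    obtain ⟨b1, hb1, hd1⟩ := (hA1m w).mp hw1
    obtain ⟨b2, hb2, hd2⟩ := (hA2m w).mp hw2
    refine hb2 (hb1.trans (SimpleGraph.Adj.reachable ⟨?_, w, hwV, hd1, hd2⟩))
    rintro rfl; exact hb2 hb1
  obtain ⟨b, ⟨w⟩, hvb⟩ := key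
  have hlen : w.toPath.1.length ≤ K := by
    have := w.toPath.2.length_lt
    rw [Fintype.card_coe] at this
    omega
  have hcw := chain_walk h0 hrat w.toPath.1
  set n := w.toPath.1.length
  have e1 : (3:ℝ) ^ n ≤ 3 ^ K := pow_le_pow_right₀ (by norm_num) hlen
  have e2 : (n:ℝ) * 3 ^ n ≤ K * 3 ^ K := by gcongr
  have e3 : r b ≤ 3 ^ K * r a := hcw.1.trans (by gcongr; exact h0 a)
  have e4 : dist a b ≤ K * 3 ^ K * r a := hcw.2.trans (by gcongr; exact h0 a)
  have e5 := hlip a u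
  have e6 := hlip v b
  rw [dist_comm] at e5
  have e7 : r a ≤ 2 * r u := by linarith
  have e8 : (3:ℝ) ^ K * r a ≤ 3 ^ K * (2 * r u) := by gcongr
  have e9 : (K:ℝ) * 3 ^ K * r a ≤ K * 3 ^ K * (2 * r u) := by gcongr
  have e10 : (1:ℝ) * r u ≤ 3 ^ K * r u := by gcongr; exact h0 u; exact one_le_pow₀ (by norm_num)
  constructor
  · change r v ≤ _ * r u
    rw [pow_succ]; linarith
  · have t1 := dist_triangle4 u a b v
    rw [dist_comm (b:ℂ) v] at t1
    change _ ≤ _ * r u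
    linarith

open Metric Set Function Filter

theorem Std.radius {f : ℂ → ℂ} {Cr : Finset ℂ} {m : ℕ} (St : Std f Cr m) : ∃ K : ℕ,
    ∀ (x : ℂ) (ρ : ℝ), 0 < ρ → AvoidsAsym f (ball x (2 * ρ)) → ∀ i,
      (∀ x' ρ', 0 < ρ' → ball x' (2 * ρ') ⊆ ball x (2 * ρ) → GoodUpTo f Cr (ball x' ρ') i) → ∀ p, f^[i] p ∈ ball x ρ →
      ∀ u ∈ VL f i (ball x ρ) p, ∀ v ∈ VL f i (ball x ρ) p,
      infDist v (VL f i (ball x (2 * ρ)) p)ᶜ ≤ 3 ^ (K + 1) * infDist u (VL f i (ball x (2 * ρ)) p)ᶜ ∧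
      dist u v ≤ 2 * (K + 1) * 3 ^ K * infDist u (VL f i (ball x (2 * ρ)) p)ᶜ := by
  classical
  obtain ⟨A, hA, N, hE⟩ := St.E'
  have hA0 : 0 < A := by linarith
  obtain ⟨X, hXs, hXf, hXc⟩ := Metric.finite_approx_of_totallyBounded
    ((isCompact_closedBall (0:ℂ) 1).totallyBounded.subset ball_subset_closedBall) (1 / (2 * A)) (by positivity)
  refine ⟨hXf.toFinset.card * (N * N), ?_⟩
  intro x ρ hρ hav i hG p hp u hu v hv
  set V := VL f i (ball x ρ) p with hVdef
  set V2 := VL f i (ball x (2 * ρ)) p with hV2def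
  have hb2 : ball x ρ ⊆ ball x (2 * ρ) := ball_subset_ball (by linarith)
  have havB : AvoidsAsym f (ball x ρ) := fun a ha k h => hav a ha k (hb2 h)
  have H := St.hh hρ havB i p hp
  have hV2ne : V2 ≠ univ := (St.hh (by linarith : 0 < 2 * ρ) hav i p (hb2 hp)).ne_univ
  have hV2c : V2ᶜ.Nonempty := nonempty_compl.mpr hV2ne
  have hVV2 : V ⊆ V2 := VL_mono hb2
  have hcard := (hE x ρ hρ havB i (hG x ρ hρ le_rfl) i le_rfl p hp).1
  have hsub : ∀ α ∈ X, ball (x + ρ * α) ρ ⊆ ball x (2 * ρ) := by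
    intro α hα y hy
    have h1 := hXs hα
    rw [mem_ball_zero_iff] at h1
    rw [mem_ball] at hy ⊢
    have h2 : dist (x + ρ * α) x < ρ := by
      rw [dist_eq_norm, add_sub_cancel_left, norm_mul, Complex.norm_real, Real.norm_of_nonneg hρ.le]
      nlinarith
    linarith [dist_triangle y (x + ρ * α) x]
  have hfin : ∀ w, {e | e ∈ V ∧ f^[i] e = w}.Finite := fun w => finite_of_card_le fun E hE' => hcard E w hE'
  have hα : ∀ α ∈ X, ∀ e ∈ {e | e ∈ V ∧ f^[i] e = x + ρ * α}, ∃ Z : Finset ℂ, Z.card ≤ N ∧ 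
      ∀ q ∈ VL f i (ball (x + ρ * α) (ρ/2)) e, ‖f^[i] q - (x + ρ * α)‖ ≤ (ρ/2) / A → 
        ∃ a ∈ Z, dist q a ≤ infDist a (VL f i (ball (x + ρ * α) (ρ/2)) e)ᶜ / 2 := by
    intro α hα e he
    have hs := hsub α hα
    obtain ⟨-, Z, h1, -, h3⟩ := hE (x + ρ * α) (ρ/2) (by positivity) (fun a ha k h => hav a ha k (hs (ball_subset_ball (by linarith) h))) i
      (hG _ _ (by positivity) (by rw [mul_div_cancel₀ _ (two_ne_zero)]; exact hs)) i le_rfl e (by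
        rw [he.2]; exact mem_ball_self (by positivity))
    exact ⟨Z, h1, h3⟩
  choose! Z hZc hZ using hα
  set P := hXf.toFinset.biUnion fun α => (hfin (x + ρ * α)).toFinset.biUnion fun e => Z α e with hP
  have hPc : P.card ≤ hXf.toFinset.card * (N * N) := by
    refine Finset.card_biUnion_le_card_mul _ _ _ fun α hα => ?_
    have hα' : α ∈ X := by simpa using hα
    refine (Finset.card_biUnion_le_card_mul _ _ N fun e he => hZc α hα' e (by simpa using he)).trans ?_
    refine Nat.mul_le_mul_right _ (hcard _ (x + ρ * α) fun e he => by simpa using he)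
  refine chain_R VL_preconn hPc (V2 := V2) ?_ hu hv
  intro q hq
  have hqB : f^[i] q ∈ ball x ρ := VL_sub hq
  have hq0 : (f^[i] q - x) / ρ ∈ ball (0:ℂ) 1 := by
    rw [mem_ball_zero_iff, norm_div, Complex.norm_real, Real.norm_of_nonneg hρ.le, div_lt_one hρ, ← dist_eq_norm]
    exact hqB
  obtain ⟨α, hα, hαd⟩ := mem_iUnion₂.mp (hXc hq0)
  have hd : ‖f^[i] q - (x + ρ * α)‖ < (ρ / 2) / A := by
    have e1 : f^[i] q - (x + ρ * α) = ρ * ((f^[i] q - x) / ρ - α) := by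
      have : (ρ:ℂ) ≠ 0 := by exact_mod_cast hρ.ne'
      field_simp; ring
    rw [mem_ball, dist_eq_norm] at hαd
    rw [e1, norm_mul, Complex.norm_real, Real.norm_of_nonneg hρ.le]
    calc _ < ρ * (1 / (2 * A)) := by gcongr
      _ = _ := by field_simp
  have hd2 : f^[i] q ∈ ball (x + ρ * α) (ρ / 2) := by
    rw [mem_ball, dist_eq_norm]
    refine hd.trans_le (div_le_self (by positivity) (by linarith))
  have hxα : x + ρ * α ∈ ball x ρ := by
    have h1 := hXs hα
    rw [mem_ball_zero_iff] at h1
    rw [mem_ball, dist_eq_norm, add_sub_cancel_left, norm_mul, Complex.norm_real, Real.norm_of_nonneg hρ.le]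
    nlinarith
  obtain ⟨e, he, hex⟩ := H.onto (St.openMap_iter i) (O := ball (x + ρ * α) (ρ / 2) ∩ ball x ρ) (isOpen_ball.inter isOpen_ball)
    ((convex_ball _ _).inter (convex_ball _ _)).isPreconnected inter_subset_right hq ⟨hd2, hqB⟩
    ⟨mem_ball_self (by positivity : (0:ℝ) < ρ / 2), hxα⟩
  have heV : e ∈ V := (connectedComponentIn_subset _ _ he).2
  have hqe : q ∈ VL f i (ball (x + ρ * α) (ρ / 2)) e := by
    have heq : e ∈ VL f i (ball (x + ρ * α) (ρ / 2)) q := by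
      refine connectedComponentIn_mono q (?_ : _ ⊆ f^[i] ⁻¹' (ball (x + ρ * α) (ρ / 2))) he
      intro y hy; exact hy.1.1
    rw [← VL_eq heq]; exact VL_self hd2
  obtain ⟨a, ha, had⟩ := hZ α hα e ⟨heV, hex⟩ q hqe hd.le
  refine ⟨a, ?_, had.trans ?_⟩
  · rw [hP, Finset.mem_biUnion]
    refine ⟨α, by simpa using hα, ?_⟩
    rw [Finset.mem_biUnion]
    exact ⟨e, by simpa using ⟨heV, hex⟩, ha⟩
  · have hVL : VL f i (ball (x + ρ * α) (ρ / 2)) e ⊆ V2 := by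
      refine VL_max VL_preconn (fun y hy => hsub α hα (ball_subset_ball (by linarith) (VL_sub hy))) ⟨e, VL_self (by
        rw [hex]; exact mem_ball_self (by positivity)), hVV2 heV⟩
    have := infDist_le_infDist_of_subset (x := a) (compl_subset_compl.mpr hVL) hV2c
    linarith

open Metric Set Function Filter

theorem ball_infDist_sub {V : Set ℂ} {p y : ℂ} (hy : y ∈ ball p (infDist p Vᶜ)) : y ∈ V := by
  by_contra h
  have h1 : infDist p Vᶜ ≤ dist p y := infDist_le_dist_of_mem (show y ∈ Vᶜ from h)
  rw [mem_ball, dist_comm] at hy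
  linarith

theorem Std.good {f : ℂ → ℂ} {Cr : Finset ℂ} {m : ℕ} (St : Std f Cr m) {z z0 : ℂ} {t0 : ℝ} (ht0 : 0 < t0)
    (hav : AvoidsAsym f (ball z t0)) (hz : ∀ l, 1 ≤ l → f^[l] z ≠ z) (hz0 : ∀ k, f^[k] z0 ∉ ball z t0)
    (hcr : ∀ c ∈ Cr, (∀ k, f^[k] c ∉ ball z t0) ∨ ∃ ε > 0, ∀ l, 1 ≤ l → ε ≤ dist c (f^[l] c)) :
    ∃ t, 0 < t ∧ t ≤ t0 ∧ ∀ x ρ, 0 < ρ → ball x (2 * ρ) ⊆ ball z t → ∀ k, GoodUpTo f Cr (ball x ρ) k := by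
  classical
  by_contra hcon
  push Not at hcon
  obtain ⟨K, hK⟩ := St.radius
  set κ : ℝ := 2 * (K + 1) * 3 ^ K with hκ
  have hκ0 : 0 < κ := by positivity
  set Q : ℂ → ℝ → Prop := fun c t => ∃ i l s, 1 ≤ l ∧ f^[i] c ∈ ball z t ∧ s ≤ dist c z0 ∧ dist c (f^[l] c) ≤ κ * s ∧
    (∀ y ∈ ball c s, f^[i] y ∈ ball z t) ∧ ∀ y ∈ ball (f^[l] c) (s / 3 ^ (K+1)), f^[i] y ∈ ball z t with hQ
  have hQmono : ∀ c t t', t ≤ t' → Q c t → Q c t' := by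
    rintro c t t' h ⟨i, l, s, h1, h2, h3, h4, h5, h6⟩
    have hb := ball_subset_ball (x := z) h
    exact ⟨i, l, s, h1, hb h2, h3, h4, fun y hy => hb (h5 y hy), fun y hy => hb (h6 y hy)⟩
  have hex : ∀ t, 0 < t → t ≤ t0 → ∃ c ∈ Cr, Q c t := by
    intro t ht htt
    have hP : ∃ k, ∃ x ρ, 0 < ρ ∧ ball x (2 * ρ) ⊆ ball z t ∧ ¬ GoodUpTo f Cr (ball x ρ) k := by
      obtain ⟨x, ρ, h1, h2, k, h3⟩ := hcon t ht htt
      exact ⟨k, x, ρ, h1, h2, h3⟩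
    obtain ⟨x, ρ, hρ, hsub, hbad⟩ := Nat.find_spec hP
    have hmin := fun k' hk' => Nat.find_min hP (m := k') hk'
    set k := Nat.find hP
    unfold GoodUpTo at hbad
    push Not at hbad
    obtain ⟨c, hc, i, l, hi, hl, hil, hmem⟩ := hbad
    have hbig := ball_subset_ball (x := z) htt
    have hG : ∀ x' ρ', 0 < ρ' → ball x' (2 * ρ') ⊆ ball x (2 * ρ) → GoodUpTo f Cr (ball x' ρ') i := by
      intro x' ρ' h1 h2
      by_contra h
      exact hmin i (by omega) ⟨x', ρ', h1, h2.trans hsub, h⟩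
    have hfc := VL_mem hmem
    have hb2 : ball x ρ ⊆ ball x (2 * ρ) := ball_subset_ball (by linarith)
    have h1 := hK x ρ hρ (fun a ha k h => hav a ha k (hbig (hsub h))) i hG c hfc c (VL_self hfc) _ hmem
    have h2 := hK x ρ hρ (fun a ha k h => hav a ha k (hbig (hsub h))) i hG c hfc _ hmem c (VL_self hfc)
    refine ⟨c, hc, i, l, infDist c (VL f i (ball x (2 * ρ)) c)ᶜ, hl, hsub (hb2 hfc), ?_, h1.2, ?_, ?_⟩
    · exact infDist_le_dist_of_mem (fun h => hz0 i (hbig (hsub (VL_sub h))))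
    · intro y hy
      exact hsub (VL_sub (ball_infDist_sub hy))
    · intro y hy
      refine hsub (VL_sub (p := c) (ball_infDist_sub (ball_subset_ball ?_ hy)))
      rw [div_le_iff₀ (by positivity)]
      linarith [h2.1]
  have hc : ∃ c ∈ Cr, ∀ t, 0 < t → t ≤ t0 → Q c t := by
    by_contra h
    push Not at h
    choose! t h1 h2 h3 using h
    have hne : Cr.Nonempty := by
      obtain ⟨c, hc, -⟩ := hex t0 ht0 le_rfl
      exact ⟨c, hc⟩
    obtain ⟨c0, hc0, hmin⟩ := Finset.exists_min_image Cr t hne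
    obtain ⟨c, hc, hq⟩ := hex (t c0) (h1 c0 hc0) (h2 c0 hc0)
    exact h3 c hc (hQmono c _ _ (hmin c hc) hq)
  obtain ⟨c, hcC, hc⟩ := hc
  obtain ⟨ε, hε, hεl⟩ : ∃ ε > 0, ∀ l, 1 ≤ l → ε ≤ dist c (f^[l] c) := by
    rcases hcr c hcC with h | h
    · obtain ⟨i, _, _, _, h2, _⟩ := hc t0 ht0 le_rfl
      exact absurd h2 (h i)
    · exact h
  set η := ε / κ / 3 ^ (K+1) with hη
  have hη0 : 0 < η := by positivity
  have hdat : ∀ j : ℕ, ∃ i l, 1 ≤ l ∧ dist c (f^[l] c) ≤ κ * dist c z0 ∧ f^[i] c ∈ ball z (t0 / (j+1)) ∧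
      ∀ y ∈ ball (f^[l] c) η, f^[i] y ∈ ball z (t0 / (j+1)) := by
    intro j
    obtain ⟨i, l, s, h1, h2, h3, h4, h5, h6⟩ := hc (t0 / (j+1)) (by positivity) (div_le_self ht0.le (by linarith [(Nat.cast_nonneg j : (0:ℝ) ≤ j)]))
    refine ⟨i, l, h1, h4.trans (by gcongr), h2, fun y hy => h6 y (ball_subset_ball ?_ hy)⟩
    rw [hη]
    gcongr
    rw [div_le_iff₀ hκ0]
    linarith [hεl l h1]
  choose i l hl hb hi hy using hdat
  obtain ⟨y, -, φ, hφ, hlim⟩ := (isCompact_closedBall c (κ * dist c z0)).tendsto_subseq (x := fun j => f^[l j] c) fun j => by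
    rw [mem_closedBall, dist_comm]; exact hb j
  have hev := Metric.tendsto_atTop.mp hlim (η/2) (by positivity)
  obtain ⟨J, hJ⟩ := hev
  have ht : Tendsto (fun j : ℕ => t0 / ((φ j : ℝ) + 1)) atTop (nhds 0) := by
    have h1 : Tendsto (fun j : ℕ => t0 / ((j : ℝ) + 1)) atTop (nhds 0) :=
      tendsto_const_nhds.div_atTop (tendsto_atTop_add_const_right _ _ tendsto_natCast_atTop_atTop)
    exact h1.comp hφ.tendsto_atTop
  have hA : Tendsto (fun j => f^[i (φ j)] c) atTop (nhds z) := by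
    rw [tendsto_iff_dist_tendsto_zero]
    exact squeeze_zero (fun _ => dist_nonneg) (fun j => (mem_ball.mp (hi (φ j))).le) ht
  have hB : Tendsto (fun j => f^[i (φ j)] (f^[l (φ J)] c)) atTop (nhds z) := by
    rw [tendsto_iff_dist_tendsto_zero]
    refine squeeze_zero' (Eventually.of_forall fun _ => dist_nonneg) ?_ ht
    filter_upwards [eventually_ge_atTop J] with j hj
    refine (mem_ball.mp (hy (φ j) _ ?_)).le
    have h1 := hJ j hj
    have h2 := hJ J le_rfl
    simp only [comp_apply] at h1 h2
    rw [mem_ball]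
    linarith [dist_triangle_right (f^[l (φ J)] c) (f^[l (φ j)] c) y]
  have hC : Tendsto (fun j => f^[i (φ j)] (f^[l (φ J)] c)) atTop (nhds (f^[l (φ J)] z)) := by
    have := ((St.diff.continuous.iterate (l (φ J))).tendsto z).comp hA
    refine this.congr fun j => ?_
    simp only [comp_apply]
    rw [← iterate_add_apply, ← iterate_add_apply, add_comm]
  exact hz _ (hl _) (tendsto_nhds_unique hC hB)

open Metric Set Function Filter

theorem SD.iter_eq {g : ℂ → ℂ} {z₀ lam : ℂ} {D : Set ℂ} {φ ψ : ℂ → ℂ} (S : SD g z₀ lam D φ ψ) {w : ℂ} (hw : w ∈ D)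
    (k : ℕ) : g^[k] w = ψ (lam ^ k * φ w) := by
  rw [S.ψ_conj_iter (S.φ_maps hw), S.ψφ w hw]

theorem SD.joint {g : ℂ → ℂ} {z₀ lam : ℂ} {D : Set ℂ} {φ ψ : ℂ → ℂ} (S : SD g z₀ lam D φ ψ) {p : ℂ} (hp : p ∈ D) :
    Tendsto (fun x : ℂ × ℂ => ψ (x.1 * φ x.2)) (nhds ((1:ℂ), p)) (nhds p) := by
  have h1 : ContinuousAt φ p := (S.φ_diff.differentiableAt (S.isOpen.mem_nhds hp)).continuousAt
  have h2 : ContinuousAt ψ (φ p) := (S.ψ_diff.differentiableAt (isOpen_ball.mem_nhds (S.φ_maps hp))).continuousAt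
  have h3 : Tendsto (fun x : ℂ × ℂ => x.1 * φ x.2) (nhds ((1:ℂ), p)) (nhds (φ p)) := by
    have a : Tendsto (fun x : ℂ × ℂ => φ x.2) (nhds ((1:ℂ), p)) (nhds (φ p)) :=
      Tendsto.comp (g := φ) h1 (continuous_snd.tendsto ((1:ℂ), p))
    have b : Tendsto (fun x : ℂ × ℂ => x.1) (nhds ((1:ℂ), p)) (nhds 1) := continuous_fst.tendsto ((1:ℂ), p)
    simpa using b.mul a
  have h4 := h2.tendsto.comp h3
  rwa [S.ψφ p hp] at h4

/-- Step 5, first part: closeness to the identity near a good boundary point. -/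
theorem Std.near_id {f : ℂ → ℂ} {Cr : Finset ℂ} {m0 : ℕ} (St : Std f Cr m0) {n : ℕ} {z₀ lam : ℂ} {D : Set ℂ} {φ ψ : ℂ → ℂ}
    (S : SD (f^[n]) z₀ lam D φ ψ) {z : ℂ} (hz : z ∈ frontier D) {ρ : ℝ} (hρ : 0 < ρ) (hA : AvoidsAsym f (ball z ρ))
    (hG : ∀ k, GoodUpTo f Cr (ball z ρ) k) :
    ∃ δ > 0, ∃ θ > 0, ∀ m : ℕ, ‖lam ^ m - 1‖ < θ → ∀ w ∈ closedBall z δ, ‖(f^[n])^[m] w - w‖ ≤ 1 := by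
  obtain ⟨A, hA4, N, hE⟩ := St.E'
  have hA0 : 0 < A := by linarith
  set ρ' := ρ / A with hρ'
  have hρ'0 : 0 < ρ' := by positivity
  have hρ'ρ : ρ' ≤ ρ := div_le_self hρ.le (by linarith)
  have hit : ∀ m : ℕ, f^[n * m] = (f^[n])^[m] := fun m => Function.iterate_mul f n m
  set l : Filter ℕ := comap (fun m => lam ^ m) (nhds 1) with hl
  have hlNe : l.NeBot := by
    rw [hl, comap_neBot_iff]
    intro t ht
    exact ⟨0, by simpa using mem_of_mem_nhds ht⟩
  have hlt : Tendsto (fun m : ℕ => lam ^ m) l (nhds 1) := tendsto_comap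
  obtain ⟨p, hp1, hp2⟩ : ∃ p ∈ D, p ∈ ball z (ρ'/4) := by
    obtain ⟨p, h1, h2⟩ := Metric.mem_closure_iff.mp (frontier_subset_closure hz) (ρ'/4) (by positivity)
    exact ⟨p, h1, by rwa [mem_ball']⟩
  have hpt : ∀ w ∈ D, Tendsto (fun m => (f^[n])^[m] w) l (nhds w) := by
    intro w hw
    have h := (S.joint hw).comp (hlt.prodMk_nhds (tendsto_const_nhds (x := w)))
    exact h.congr fun m => (S.iter_eq hw m).symm
  -- a uniform ball
  obtain ⟨r0, hr0, hr0D, hr0m⟩ : ∃ r0 > 0, ball p r0 ⊆ D ∧ ∀ᶠ m in l, ∀ w ∈ ball p r0, (f^[n])^[m] w ∈ ball z ρ' := by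
    have h1 : ∀ᶠ x : ℂ × ℂ in nhds ((1:ℂ), p), ψ (x.1 * φ x.2) ∈ ball z ρ' :=
      (S.joint hp1).eventually (isOpen_ball.mem_nhds (ball_subset_ball (by linarith) hp2))
    rw [nhds_prod_eq] at h1
    obtain ⟨P, hP, Q, hQ, hPQ⟩ := Filter.eventually_prod_iff.mp h1
    obtain ⟨r, hr, hrb⟩ := Metric.mem_nhds_iff.mp (inter_mem hQ (S.isOpen.mem_nhds hp1))
    refine ⟨r, hr, fun y hy => (hrb hy).2, ?_⟩
    filter_upwards [hlt.eventually hP] with m hm w hw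
    rw [S.iter_eq (hrb hw).2]
    exact hPQ hm (hrb hw).1
  set V : ℕ → Set ℂ := fun m => VL f (n * m) (ball z ρ) p with hV
  set W : ℕ → Set ℂ := fun m => VL f (n * m) (ball z ρ') p with hW
  have hWV : ∀ m, W m ⊆ V m := fun m => VL_mono (ball_subset_ball hρ'ρ)
  set c0 := r0 / 3 ^ (N+1) with hc0
  have hc00 : 0 < c0 := by positivity
  have hWc : ∀ᶠ m in l, p ∈ W m ∧ ∀ v ∈ W m, c0 ≤ infDist v (V m)ᶜ := by
    filter_upwards [hr0m] with m hm
    have hpm : f^[n*m] p ∈ ball z ρ' := by rw [hit]; exact hm p (mem_ball_self hr0)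
    have hpm' := ball_subset_ball hρ'ρ hpm
    obtain ⟨-, Z, hZc, -, hZ⟩ := hE z ρ hρ hA (n*m) (hG _) (n*m) le_rfl p hpm'
    have hpW : p ∈ W m := VL_self hpm
    refine ⟨hpW, fun v hv => ?_⟩
    have hch := (chain_R (V := W m) (V2 := V m) (u := v) (v := p) VL_preconn hZc ?_ hv hpW).1
    · have hr : r0 ≤ infDist p (V m)ᶜ := by
        have hb : ball p r0 ⊆ V m := by
          refine VL_max (isPreconnected_ball) ?_ ⟨p, mem_ball_self hr0, VL_self hpm'⟩
          intro y hy
          rw [hit]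
          exact ball_subset_ball hρ'ρ (hm y hy)
        have hne : ((V m)ᶜ).Nonempty := nonempty_compl.mpr (St.hh hρ hA (n*m) p hpm').ne_univ
        rw [le_infDist hne]
        intro y hy
        by_contra hlt
        exact hy (hb (by rw [mem_ball']; linarith))
      rw [hc0, div_le_iff₀ (by positivity)]
      linarith
    · intro v hv
      refine hZ v (hWV m hv) ?_
      have := VL_sub hv
      rw [mem_ball, dist_eq_norm] at this
      exact this.le
  -- propagation
  set P : ℂ → Prop := fun q => (∀ᶠ m in l, q ∈ W m) ∧ TendstoLocallyUniformlyOn (fun m => (f^[n])^[m]) id l (ball q c0) with hP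
  have hmk : ∀ q, (∀ᶠ m in l, q ∈ W m) → ∀ O : Set ℂ, IsOpen O → O ⊆ ball q c0 → O.Nonempty →
      (∀ w ∈ O, Tendsto (fun m => (f^[n])^[m] w) l (nhds w)) → P q := by
    intro q hq O hO hOs hOn hOt
    refine ⟨hq, vitali isOpen_ball isPreconnected_ball differentiableOn_id
      (fun m => (S.g_diff.iterate m).differentiableOn) ?_ hO hOs hOn hOt⟩
    intro y hy
    refine ⟨c0 - dist y q, by linarith [mem_ball.mp hy], ‖z‖ + ρ, ball_subset (by linarith), ?_⟩
    filter_upwards [hq, hWc] with m h1 h2 w hw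
    have hw2 : w ∈ ball q c0 := ball_subset (y := q) (by linarith) hw
    have hw3 : w ∈ V m := ball_infDist_sub (p := q) (ball_subset_ball (h2.2 q h1) hw2)
    have := VL_sub hw3
    rw [hit, mem_ball, dist_eq_norm] at this
    have h5 := norm_add_le ((f^[n])^[m] w - z) z
    rw [sub_add_cancel] at h5
    linarith
  have hPp : P p := by
    refine hmk p (hWc.mono fun m h => h.1) (ball p r0 ∩ ball p c0) (isOpen_ball.inter isOpen_ball) inter_subset_right
      ⟨p, mem_ball_self hr0, mem_ball_self hc00⟩ fun w hw => hpt w (hr0D hw.1)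
  set σ := min (c0/2) (ρ'/4) with hσ
  have hσ0 : 0 < σ := by positivity
  have hstep : ∀ q q', P q → q ∈ ball z (ρ'/4) → dist q q' < σ → P q' := by
    intro q q' hq hqz hqq
    have hs1 : σ ≤ c0/2 := min_le_left
    have hs2 : σ ≤ ρ'/4 := min_le_right
    have hcb : closedBall q σ ⊆ ball q c0 := closedBall_subset_ball (by linarith)
    have hu := (tendstoLocallyUniformlyOn_iff_forall_isCompact isOpen_ball).mp hq.2 _ hcb (isCompact_closedBall q σ)
    rw [Metric.tendstoUniformlyOn_iff] at hu
    have hq'W : ∀ᶠ m in l, q' ∈ W m := by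
      filter_upwards [hq.1, hu (ρ'/4) (by positivity)] with m h1 h2
      have hb : ball q σ ⊆ W m := by
        refine VL_max isPreconnected_ball ?_ ⟨q, mem_ball_self hσ0, h1⟩
        intro y hy
        rw [hit, mem_ball]
        have a := h2 y (ball_subset_closedBall hy)
        rw [id, dist_comm] at a
        have b := mem_ball.mp hy
        have c := mem_ball.mp hqz
        have d := dist_triangle4 ((f^[n])^[m] y) y q z
        linarith
      exact hb (by rwa [mem_ball'])
    refine hmk q' hq'W (ball q c0 ∩ ball q' c0) (isOpen_ball.inter isOpen_ball) inter_subset_right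
      ⟨q, mem_ball_self hc00, by rw [mem_ball]; linarith⟩ ?_
    intro w hw
    exact hq.2.tendsto_at hw.1
  have hPz : P z := by
    have hsub : ball z (ρ'/4) ⊆ {q | q ∈ ball z (ρ'/4) ∧ P q} := by
      refine isPreconnected_ball.subset_of_closure_inter_subset ?_ ⟨p, hp2, hp2, hPp⟩ ?_
      · rw [Metric.isOpen_iff]
        rintro q ⟨hq1, hq2⟩
        obtain ⟨r, hr, hrb⟩ := Metric.isOpen_iff.mp isOpen_ball q hq1
        refine ⟨min r σ, by positivity, fun y hy => ⟨hrb (ball_subset_ball min_le_left hy), hstep q y hq2 hq1 ?_⟩⟩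
        rw [dist_comm]
        exact lt_of_lt_of_le hy min_le_right
      · rintro q' ⟨h1, h2⟩
        obtain ⟨q, ⟨hq1, hq2⟩, hd⟩ := Metric.mem_closure_iff.mp h1 σ hσ0
        exact ⟨h2, hstep q q' hq2 hq1 (by rwa [dist_comm])⟩
    exact (hsub (mem_ball_self (by positivity))).2
  have hu := (tendstoLocallyUniformlyOn_iff_forall_isCompact isOpen_ball).mp hPz.2 (closedBall z (c0/2))
    (closedBall_subset_ball (by linarith)) (isCompact_closedBall _ _)
  rw [Metric.tendstoUniformlyOn_iff] at hu
  have h1 := hu 1 one_pos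
  rw [hl, Filter.eventually_comap, Metric.eventually_nhds_iff_ball] at h1
  obtain ⟨θ, hθ, h⟩ := h1
  refine ⟨c0/2, by positivity, θ, hθ, fun m hm w hw => ?_⟩
  have := h (lam^m) (by rwa [mem_ball, dist_eq_norm]) m rfl w hw
  rw [id, dist_comm, dist_eq_norm] at this
  exact this.le

theorem Std.bounded {f : ℂ → ℂ} {Cr : Finset ℂ} {m0 : ℕ} (St : Std f Cr m0) {n : ℕ} {z₀ lam : ℂ} {D : Set ℂ} {φ ψ : ℂ → ℂ}
    (S : SD (f^[n]) z₀ lam D φ ψ) {z : ℂ} (hz : z ∈ frontier D) {ρ : ℝ} (hρ : 0 < ρ) (hA : AvoidsAsym f (ball z ρ))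
    (hG : ∀ k, GoodUpTo f Cr (ball z ρ) k) :
    ∃ δ > 0, ∃ M : ℝ, ∀ k, ∀ w ∈ ball z δ, ‖(f^[n])^[k] w‖ ≤ M := by
  obtain ⟨δ, hδ, θ, hθ, h⟩ := St.near_id S hz hρ hA hG
  have htb : TotallyBounded (range fun k : ℕ => lam ^ k) := by
    refine (isCompact_closedBall (0:ℂ) 1).totallyBounded.subset ?_
    rintro _ ⟨k, rfl⟩
    rw [mem_closedBall_zero_iff, S.lam_pow_norm]
  obtain ⟨t, hts, htf, htc⟩ := Metric.finite_approx_of_totallyBounded htb θ hθ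
  obtain ⟨L, hL⟩ : ∃ L : ℕ, ∀ k, ∃ j, j ≤ L ∧ ‖lam ^ k - lam ^ j‖ < θ := by
    have hts' : ∀ y ∈ t, ∃ k : ℕ, lam ^ k = y := fun y hy => hts hy
    choose! e he using hts'
    refine ⟨∑ y ∈ htf.toFinset, e y, fun k => ?_⟩
    have := htc ⟨k, rfl⟩
    simp only [mem_iUnion] at this
    obtain ⟨y, hy, hk⟩ := this
    refine ⟨e y, Finset.single_le_sum (f := e) (fun _ _ => Nat.zero_le _) (htf.mem_toFinset.mpr hy), ?_⟩
    rw [mem_ball, dist_eq_norm] at hk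
    rw [he y hy]; exact hk
  have hc : ∀ j : ℕ, ∃ M : ℝ, ∀ w ∈ closedBall z (δ + 1), ‖(f^[n])^[j] w‖ ≤ M := fun j =>
    (isCompact_closedBall z (δ+1)).exists_bound_of_continuousOn (S.g_diff.iterate j).continuous.continuousOn
  choose M hM using hc
  have hM0 : ∀ j, 0 ≤ M j := fun j => (norm_nonneg _).trans (hM j z (mem_closedBall_self (by linarith)))
  refine ⟨δ, hδ, ∑ j ∈ Finset.range (L+1), M j, fun k w hw => ?_⟩
  have hle : ∀ j ≤ L, M j ≤ ∑ j ∈ Finset.range (L+1), M j := fun j hj =>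
    Finset.single_le_sum (f := M) (fun j _ => hM0 j) (Finset.mem_range.mpr (by omega))
  have hwc : w ∈ closedBall z δ := ball_subset_closedBall hw
  by_cases hk : k ≤ L
  · exact (hM k w (closedBall_subset_closedBall (by linarith) hwc)).trans (hle k hk)
  obtain ⟨j, hj, hjk⟩ := hL k
  have e : k = j + (k - j) := by omega
  have hn : ‖lam ^ (k - j) - 1‖ < θ := by
    have e2 : lam ^ k - lam ^ j = lam ^ j * (lam ^ (k-j) - 1) := by
      rw [mul_sub, ← pow_add, ← e, mul_one]
    rwa [e2, norm_mul, S.lam_pow_norm, one_mul] at hjk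
  rw [e, Function.iterate_add_apply]
  refine (hM j _ ?_).trans (hle j hj)
  have a := h (k-j) hn w hwc
  rw [← dist_eq_norm] at a
  rw [mem_closedBall] at hwc ⊢
  linarith [dist_triangle ((f^[n])^[k-j] w) w z]

open Metric Set Function Filter

theorem baire_pick {F : Set ℂ} (hF : IsClosed F) (hne : F.Nonempty) {ι : Type} [Countable ι] (K : ι → Set ℂ)
    (hK : ∀ i, IsClosed (K i)) (hn : ∀ i, ∀ z ∈ F, ∀ r > 0, ¬ closedBall z r ∩ F ⊆ K i) : ∃ z ∈ F, ∀ i, z ∉ K i := by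
  by_contra hcon
  push Not at hcon
  have : CompleteSpace F := hF.completeSpace_coe
  have : Nonempty F := hne.to_subtype
  obtain ⟨i, x, hx⟩ := nonempty_interior_of_iUnion_of_closed (X := F) (f := fun i => Subtype.val ⁻¹' (K i))
    (fun i => (hK i).preimage continuous_subtype_val) (by
      rw [eq_univ_iff_forall]
      rintro ⟨z, hz⟩
      obtain ⟨i, hi⟩ := hcon z hz
      exact mem_iUnion.mpr ⟨i, hi⟩)
  rw [mem_interior_iff_mem_nhds, Metric.mem_nhds_iff] at hx
  obtain ⟨r, hr, h⟩ := hx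
  refine hn i x x.2 (r/2) (by positivity) ?_
  rintro y ⟨hy1, hy2⟩
  exact h (show (⟨y, hy2⟩ : F) ∈ ball x r by
    rw [mem_ball, Subtype.dist_eq]
    have := mem_closedBall.mp hy1
    simp only
    linarith)

theorem ods_eq (f : ℂ → ℂ) (s : ℂ) : orbitDerivedSet f s = derivedSet (range fun k : ℕ => f^[k] s) := by
  ext z
  rw [mem_derivedSet, accPt_iff_nhds]
  constructor
  · intro h U hU
    obtain ⟨k, h1, h2⟩ := h U hU
    exact ⟨_, ⟨h1, ⟨k, rfl⟩⟩, h2⟩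
  · intro h U hU
    obtain ⟨_, ⟨h1, ⟨k, rfl⟩⟩, h2⟩ := h U hU
    exact ⟨k, h1, h2⟩

theorem ods_closed (f : ℂ → ℂ) (s : ℂ) : IsClosed (orbitDerivedSet f s) := by
  rw [ods_eq]; exact isClosed_derivedSet _

theorem ods_maps {f : ℂ → ℂ} (hf : Differentiable ℂ f) (hnc : ∀ p, ¬ ∀ᶠ z in nhds p, f z = f p) (s : ℂ) :
    MapsTo f (orbitDerivedSet f s) (orbitDerivedSet f s) := by
  intro z hz U hU
  have h1 : ∀ᶠ w in nhdsWithin z {z}ᶜ, f w ≠ f z := by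
    rcases (hf.analyticAt z).eventually_eq_or_eventually_ne (analyticAt_const (v := f z)) with h | h
    · exact absurd h (hnc z)
    · exact h
  rw [eventually_nhdsWithin_iff] at h1
  obtain ⟨k, ⟨hk1, hk2⟩, hk3⟩ := hz _ (inter_mem (hf.continuous.continuousAt hU) h1)
  refine ⟨k+1, ?_, ?_⟩
  · rw [Function.iterate_succ_apply']; exact hk1
  · rw [Function.iterate_succ_apply']; exact hk2 hk3

theorem recurrent_or {f : ℂ → ℂ} {c : ℂ} (hc : deriv f c = 0) :
    RecurrentCriticalPoint f c ∨ ∃ ε > 0, ∀ l, 1 ≤ l → ε ≤ dist c (f^[l] c) := by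
  by_contra hcon
  push Not at hcon
  obtain ⟨h1, h2⟩ := hcon
  apply h1
  refine ⟨hc, ?_⟩
  by_cases hp : ∃ l, 1 ≤ l ∧ f^[l] c = c
  · obtain ⟨l, hl, hlc⟩ := hp
    refine ⟨fun i => l * i, fun a b hab => by simp only; nlinarith, ?_⟩
    have : ∀ i, f^[l * i] c = c := fun i => by
      rw [Function.iterate_mul]; exact Function.iterate_fixed hlc i
    simp only [this]
    exact tendsto_const_nhds
  push Not at hp
  have hcl : MapClusterPt c atTop (fun l => f^[l] c) := by
    rw [mapClusterPt_iff_frequently]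
    intro s hs hev
    obtain ⟨N, hN⟩ := eventually_atTop.mp hev
    have hfin : ((fun l => f^[l] c) '' (Set.Ico 1 N)).Finite := (finite_Ico 1 N).image _
    have hcn : c ∉ (fun l => f^[l] c) '' (Set.Ico 1 N) := by
      rintro ⟨l, hl, h⟩
      exact hp l hl.1 h
    obtain ⟨ε, hε, hb⟩ := Metric.mem_nhds_iff.mp (inter_mem hs (hfin.isClosed.isOpen_compl.mem_nhds hcn))
    obtain ⟨l, hl, hd⟩ := h2 ε hε
    have hm := hb (show f^[l] c ∈ ball c ε by rwa [mem_ball'])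
    by_cases hlN : l < N
    · exact hm.2 ⟨l, ⟨hl, hlN⟩, rfl⟩
    · exact hN l (by omega) hm.1
  obtain ⟨φ, h3, h4⟩ := TopologicalSpace.FirstCountableTopology.tendsto_subseq hcl
  exact ⟨φ, h3, h4⟩

theorem nc_of {f : ℂ → ℂ} (hf : Differentiable ℂ f) (hnotaff : ∀ a b : ℂ, f ≠ fun z => a * z + b) :
    ∀ p, ¬ ∀ᶠ z in nhds p, f z = f p := by
  intro p h
  refine hnotaff 0 (f p) ?_
  have := (hf.differentiableOn (s := univ).analyticOnNhd isOpen_univ).eqOn_of_preconnected_of_eventuallyEq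
    (analyticOnNhd_const (v := f p)) isPreconnected_univ (mem_univ p) h
  funext z
  simpa using this (mem_univ z)

theorem frontier_ne {g : ℂ → ℂ} {z₀ lam : ℂ} {D : Set ℂ} {φ ψ : ℂ → ℂ} (S : SD g z₀ lam D φ ψ) : (frontier D).Nonempty := by
  rw [Set.nonempty_iff_ne_empty]
  intro h
  have hcl : IsClopen D := isClopen_iff_frontier_eq_empty.mpr h
  have hu : D = univ := hcl.eq_univ ⟨z₀, S.z0_mem⟩
  have hd := S.φ_diff
  have hi := S.φ_inj
  have hm := S.φ_maps
  rw [hu] at hd hi hm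
  have hd' : Differentiable ℂ φ := differentiableOn_univ.mp hd
  have hb : Bornology.IsBounded (range φ) := by
    refine isBounded_ball.subset (?_ : range φ ⊆ ball (0:ℂ) 1)
    rintro _ ⟨y, rfl⟩
    exact hm (mem_univ y)
  have := hi (mem_univ 0) (mem_univ 1) (hd'.apply_eq_apply_of_bounded hb 0 1)
  exact zero_ne_one this

theorem per_thin {f : ℂ → ℂ} (hf : Differentiable ℂ f) {n : ℕ} {z₀ lam : ℂ} {D : Set ℂ} {φ ψ : ℂ → ℂ} (S : SD (f^[n]) z₀ lam D φ ψ)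
    {l : ℕ} (hl : 1 ≤ l) {z : ℂ} (hz : z ∈ frontier D) {r : ℝ} (hr : 0 < r) :
    ¬ closedBall z r ∩ frontier D ⊆ {w | f^[l] w = w} := by
  intro hsub
  have hfr : ∃ᶠ w in nhdsWithin z {z}ᶜ, f^[l] w = w := by
    rw [frequently_nhdsWithin_iff, Metric.nhds_basis_ball.frequently_iff]
    intro ε hε
    obtain ⟨y, h1, h2, h3⟩ := frontier_perfect S hz (r := min ε r) (by positivity)
    rw [mem_ball, lt_min_iff] at h3
    exact ⟨y, h3.1, hsub ⟨h3.2.le, h1⟩, h2⟩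
  have hid := ((hf.iterate l).differentiableOn (s := univ).analyticOnNhd isOpen_univ).eqOn_of_preconnected_of_frequently_eq
    analyticOnNhd_id isPreconnected_univ (mem_univ z) hfr
  have hall : f^[l] = id := funext fun w => hid (mem_univ w)
  have hg : (f^[n])^[l] = id := by
    rw [← Function.iterate_mul, mul_comm, Function.iterate_mul, hall]; exact Function.iterate_id n
  have hζ : (1/2:ℂ) ∈ ball (0:ℂ) 1 := by rw [mem_ball_zero_iff]; norm_num
  have h1 := S.ψ_conj_iter hζ l
  rw [hg, id] at h1
  have hζ2 : lam ^ l * (1/2:ℂ) ∈ ball (0:ℂ) 1 := by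
    rw [mem_ball_zero_iff, norm_mul, S.lam_pow_norm]; norm_num
  have h2 : lam ^ l * (1/2:ℂ) = 1/2 := by rw [← S.φψ _ hζ2, h1, S.φψ _ hζ]
  exact S.lam_ne l hl (by linear_combination 2 * h2)

theorem mane_siegel
    (f : ℂ → ℂ) (hf : Differentiable ℂ f)
    (hnotaff : ∀ a b : ℂ, f ≠ fun z => a * z + b)
    (hcrit : {c : ℂ | deriv f c = 0}.Finite)
    (hasym : {a : ℂ | AsymptoticValue f a}.Finite)
    (n : ℕ) (hn : 1 ≤ n) (z₀ : ℂ)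
    (hper : f^[n] z₀ = z₀) (hexact : ∀ k, 1 ≤ k → k < n → f^[k] z₀ ≠ z₀)
    (α : ℝ) (hα : Irrational α) (lam : ℂ)
    (hlam : lam = Complex.exp (2 * Real.pi * Complex.I * α))
    (hmult : deriv (f^[n]) z₀ = lam)
    (D : Set ℂ) (hD : IsSiegelDomain (f^[n]) z₀ lam D)
    (hmax : ∀ D' : Set ℂ, D ⊆ D' → IsSiegelDomain (f^[n]) z₀ lam D' → D' = D) :
    ∃ s : ℂ, (AsymptoticValue f s ∨ RecurrentCriticalPoint f s) ∧
      frontier D ⊆ orbitDerivedSet f s := by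
  by_contra hcon
  push Not at hcon
  have hnc := nc_of hf hnotaff
  obtain ⟨m, hm1, hm⟩ := uniform_deg hf hnc hcrit.toFinset
  have St : Std f hcrit.toFinset m :=
    ⟨hf, hnc, fun c => by simp, hm1, fun c hc => (hm c hc).1, fun c hc => (hm c hc).2⟩
  obtain ⟨φ, ψ, S⟩ := SD.of (hf.iterate n) hα hlam hmult hD
  set T : Set ℂ := {s | AsymptoticValue f s ∨ RecurrentCriticalPoint f s} with hT
  have hTf : T.Finite := (hasym.union hcrit).subset fun s hs => by
    rcases hs with h | h
    · exact Or.inl h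
    · exact Or.inr h.1
  have hTc : Countable T := hTf.countable
  have hsing : ∀ x z : ℂ, z ∈ frontier D → ∀ r > 0, ¬ closedBall z r ∩ frontier D ⊆ {x} := by
    intro x z hz r hr hs
    have h1 : z ∈ ({x} : Set ℂ) := hs ⟨mem_closedBall_self hr.le, hz⟩
    obtain ⟨y, h2, h3, h4⟩ := frontier_perfect S hz hr
    have h5 : y ∈ ({x} : Set ℂ) := hs ⟨ball_subset_closedBall h4, h2⟩
    exact h3 (h5.trans h1.symm)
  let K : (T ⊕ (T × ℕ)) ⊕ (ℕ ⊕ ℕ) → Set ℂ := Sum.elim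
    (Sum.elim (fun s => orbitDerivedSet f s) (fun s => {f^[s.2] s.1}))
    (Sum.elim (fun k => {f^[k] z₀}) (fun l => {w | f^[l+1] w = w}))
  obtain ⟨z, hz, hzK⟩ := baire_pick isClosed_frontier (frontier_ne S) K
    (by
      rintro ((s | s) | (k | l))
      · exact ods_closed f s
      · exact isClosed_singleton
      · exact isClosed_singleton
      · exact isClosed_eq (hf.iterate (l+1)).continuous continuous_id)
    (by
      rintro ((s | s) | (k | l)) z hz r hr
      · intro hs
        exact hcon s s.2 (transit S (ods_closed f s) ((ods_maps hf hnc s).iterate n) hz hr hs)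
      · exact hsing _ z hz r hr
      · exact hsing _ z hz r hr
      · exact per_thin hf S (by omega) hz hr)
  have k1 : ∀ s ∈ T, z ∉ orbitDerivedSet f s := fun s hs => hzK (Sum.inl (Sum.inl ⟨s, hs⟩))
  have k2 : ∀ s ∈ T, ∀ k, z ≠ f^[k] s := fun s hs k => hzK (Sum.inl (Sum.inr (⟨s, hs⟩, k)))
  have k3 : ∀ k, z ≠ f^[k] z₀ := fun k => hzK (Sum.inr (Sum.inl k))
  have k4 : ∀ l, f^[l+1] z ≠ z := fun l => hzK (Sum.inr (Sum.inr l))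
  have e1 : ∀ᶠ w in nhds z, ∀ s ∈ T, ∀ k, f^[k] s ≠ w := by
    rw [Filter.eventually_all_finite hTf]
    intro s hs
    have h := k1 s hs
    simp only [orbitDerivedSet, mem_setOf_eq] at h
    push Not at h
    obtain ⟨U, hU, h⟩ := h
    filter_upwards [hU] with w hw k hk
    have := h k (hk ▸ hw)
    exact k2 s hs k this.symm
  have e2 : ∀ᶠ w in nhds z, ∀ k, f^[k] z₀ ≠ w := by
    have hfin : ((fun k => f^[k] z₀) '' (Set.Iio n)).Finite := (finite_Iio n).image _
    have hzn : z ∉ (fun k => f^[k] z₀) '' (Set.Iio n) := by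
      rintro ⟨k, -, h⟩
      exact k3 k h.symm
    filter_upwards [hfin.isClosed.isOpen_compl.mem_nhds hzn] with w hw k hk
    refine hw ⟨k % n, Nat.mod_lt _ (by omega), ?_⟩
    simp only
    rw [← hk]
    exact IsPeriodicPt.iterate_mod_apply (f := f) hper k
  obtain ⟨t0, ht0, hb⟩ := Metric.eventually_nhds_iff_ball.mp (e1.and e2)
  have hav : AvoidsAsym f (ball z t0) := fun a ha k hk => (hb _ hk).1 a (Or.inl ha) k rfl
  obtain ⟨t, ht, htt, hg⟩ := St.good (z := z) (z0 := z₀) (t0 := t0) ht0 hav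
    (fun l hl h => k4 (l-1) (by rw [Nat.sub_add_cancel hl]; exact h))
    (fun k hk => (hb _ hk).2 k rfl)
    (fun c hc => by
      rcases recurrent_or ((St.hCr c).mp hc) with h | h
      · exact Or.inl fun k hk => (hb _ hk).1 c (Or.inr h) k rfl
      · exact Or.inr h)
  have hG := hg z (t/2) (by positivity) (by rw [mul_div_cancel₀ t two_ne_zero])
  have hav2 : AvoidsAsym f (ball z (t/2)) := fun a ha k hk => hav a ha k (ball_subset_ball (by linarith) hk)
  obtain ⟨δ, hδ, M, hM⟩ := St.bounded S hz (by positivity) hav2 hG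
  exact step6 S hmax hz hδ hM
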